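/- Let (R,m) be a Noetherian local ring and M a generalized Cohen–Macaulay R-module with r = dim_R M ≥ 2 and depth_R M > 0. Let Q be a parameter ideal for M. Then the following are equivalent: (1) Q is a standard parameter ideal for M; (2) e_1(Q,M) = −Σ_{i=1}^{r−1} C(r−2, i−1) · h^i(M), where h^i(M) = λ(H^i_m(M)). -/

import Mathlib

open IsLocalRing

section Defs

variable (R : Type) [CommRing R]

/-- The length of a module, as the Krull dimension of its lattice of submodules. -/
noncomputable def mLength (M : Type) [AddCommGroup M] [Module R M] : WithBot ℕ∞ :=
  Order.krullDim (Submodule R M)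

/-- The (Krull) dimension of a module. -/
noncomputable def mDim (M : Type) [AddCommGroup M] [Module R M] : WithBot ℕ∞ :=
  ringKrullDim (R ⧸ Submodule.annihilator (⊤ : Submodule R M))

/-- `f` is eventually given by the Hilbert-type polynomial of degree `t` with
coefficients `s 0, …, s t` (written in the binomial basis with alternating signs). -/
def IsHilbPolyAt (f : ℕ → WithBot ℕ∞) (t : ℕ) (s : ℕ → ℤ) : Prop :=
  ∃ N : ℕ, ∀ n ≥ N, ∃ l : ℕ, f n = (l : ℕ∞) ∧
    (l : ℤ) = ∑ i ∈ Finset.range (t + 1), (-1 : ℤ) ^ i * s i * ((n + t - i).choose (t - i) : ℤ)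

/-- `s 0, …, s t` are the Hilbert coefficients `e_i(I, M)`, i.e.
`λ(M/I^{n+1}M) = ∑ (-1)^i e_i(I,M) C(n+t-i, t-i)` for `n ≫ 0`. -/
def HasHilbCoeffs (I : Ideal R) (M : Type) [AddCommGroup M] [Module R M]
    (t : ℕ) (s : ℕ → ℤ) : Prop :=
  IsHilbPolyAt (fun n => mLength R (M ⧸ (I ^ (n + 1) • (⊤ : Submodule R M)))) t s

/-- The unmixed component `U_M(0)` of `M`: the largest submodule of dimension `< dim M`. -/
noncomputable def unmixedComp (M : Type) [AddCommGroup M] [Module R M] : Submodule R M :=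
  sSup {N : Submodule R M | mDim R ↥N < mDim R M}

/-- `x` is a d-sequence on `M`. -/
def IsDSeq {r : ℕ} (x : Fin r → R) (M : Type) [AddCommGroup M] [Module R M] : Prop :=
  ∀ i j : Fin r, i ≤ j →
    Submodule.comap (LinearMap.lsmul R M (x i * x j))
        (Ideal.span (x '' {k | k < i}) • (⊤ : Submodule R M))
      = Submodule.comap (LinearMap.lsmul R M (x j))
        (Ideal.span (x '' {k | k < i}) • (⊤ : Submodule R M))

/-- `x` is a standard (d⁺-) system: all power sequences in any order are d-sequences. -/
def IsStandardSeq {r : ℕ} (x : Fin r → R) (M : Type) [AddCommGroup M] [Module R M] : Prop :=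
  ∀ n : Fin r → ℕ, (∀ k, 1 ≤ n k) → ∀ σ : Equiv.Perm (Fin r),
    IsDSeq R (fun k => x (σ k) ^ n (σ k)) M

/-- The integral closure of an ideal, as a set. -/
def intClos (Q : Ideal R) : Set R :=
  {x : R | ∃ n : ℕ, 0 < n ∧ ∃ a : ℕ → R, (∀ i, 1 ≤ i → i ≤ n → a i ∈ Q ^ i) ∧
    x ^ n + ∑ i ∈ Finset.Icc 1 n, a i * x ^ (n - i) = 0}

variable [IsLocalRing R]

/-- `h ∈ I` is superficial for `M` with respect to `I`. -/
def IsSuperficial (I : Ideal R) (M : Type) [AddCommGroup M] [Module R M] (h : R) : Prop :=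
  h ∈ I ∧ ∃ c N : ℕ, ∀ n ≥ N,
    Submodule.comap (LinearMap.lsmul R M h) (I ^ (n + 1) • (⊤ : Submodule R M))
        ⊓ (I ^ c • (⊤ : Submodule R M))
      = I ^ n • (⊤ : Submodule R M)

/-- `Q` is a parameter ideal for `M` (`r` the dimension of `M`):
generated by `r` elements of the maximal ideal with `M/QM` of finite length. -/
def IsParamIdeal (Q : Ideal R) (M : Type) [AddCommGroup M] [Module R M] (r : ℕ) : Prop :=
  Q ≤ maximalIdeal R ∧ (∃ x : Fin r → R, Q = Ideal.span (Set.range x)) ∧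
    IsFiniteLength R (M ⧸ Q • (⊤ : Submodule R M))

/-- Local cohomology `H^i_𝔪(M)` with support in the maximal ideal. -/
noncomputable def LC (i : ℕ) (M : Type) [AddCommGroup M] [Module R M] : ModuleCat R :=
  (localCohomology (maximalIdeal R) i).obj (ModuleCat.of R M)

/-- `M` is Cohen–Macaulay: there is a regular sequence on `M` in the maximal ideal
whose length equals `dim M`. -/
def IsCM (M : Type) [AddCommGroup M] [Module R M] : Prop :=
  ∃ rs : List R, (∀ x ∈ rs, x ∈ maximalIdeal R) ∧ RingTheory.Sequence.IsRegular M rs ∧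
    (rs.length : WithBot ℕ∞) = mDim R M

/-- `M` is unmixed: `dim R̂/p = dim M` for every associated prime `p` of the completion `M̂`. -/
def IsUnmixed (M : Type) [AddCommGroup M] [Module R M] : Prop :=
  ∀ p ∈ associatedPrimes (AdicCompletion (maximalIdeal R) R)
      (AdicCompletion (maximalIdeal R) M),
    ringKrullDim ((AdicCompletion (maximalIdeal R) R) ⧸ p) = mDim R M

/-- `M` is generalized Cohen–Macaulay: `H^i_𝔪(M)` has finite length for `i < r = dim M`. -/
def IsGenCM (M : Type) [AddCommGroup M] [Module R M] (r : ℕ) : Prop :=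
  ∀ i < r, IsFiniteLength R ↥(LC R i M)

/-- The set `Λ(M)` of first Hilbert coefficients of parameter ideals for `M`. -/
def Lambda (M : Type) [AddCommGroup M] [Module R M] (r : ℕ) : Set ℤ :=
  {a : ℤ | ∃ (Q : Ideal R) (e : ℕ → ℤ),
    IsParamIdeal R Q M r ∧ HasHilbCoeffs R Q M r e ∧ e 1 = a}

/-- A standard parameter ideal: one generated by a standard system of parameters. -/
def IsStandardParamIdeal (Q : Ideal R) (M : Type) [AddCommGroup M] [Module R M]
    (r : ℕ) : Prop :=
  IsParamIdeal R Q M r ∧ ∃ x : Fin r → R, Q = Ideal.span (Set.range x) ∧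
    IsStandardSeq R x M

/-- `M` is Buchsbaum: every parameter ideal for `M` is standard. -/
def IsBuchsbaum (M : Type) [AddCommGroup M] [Module R M] (r : ℕ) : Prop :=
  ∀ Q : Ideal R, IsParamIdeal R Q M r → IsStandardParamIdeal R Q M r

/-- `M` is a Vasconcelos module. -/
def IsVasconcelos (M : Type) [AddCommGroup M] [Module R M] : Prop :=
  mDim R M ≤ 0 ∨ (0 < mDim R M ∧ ∃ (r : ℕ) (Q : Ideal R) (e : ℕ → ℤ),
    mDim R M = (r : ℕ∞) ∧ IsParamIdeal R Q M r ∧ HasHilbCoeffs R Q M r e ∧ e 1 = 0)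

/-- A Gorenstein local ring: Noetherian, Cohen–Macaulay, with an irreducible parameter ideal. -/
def IsGorensteinLocalRing : Prop :=
  IsNoetherianRing R ∧ IsCM R R ∧ ∃ (r : ℕ) (Q : Ideal R),
    mDim R R = (r : ℕ∞) ∧ IsParamIdeal R Q R r ∧
    ∀ I J : Ideal R, Q = I ⊓ J → Q = I ∨ Q = J

/-- `E` is an injective envelope of the residue field `R/𝔪`. -/
def IsInjEnvResidue (E : Type) [AddCommGroup E] [Module R E] : Prop :=
  Module.Injective R E ∧ ∃ ι : (R ⧸ maximalIdeal R) →ₗ[R] E, Function.Injective ι ∧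
    ∀ N : Submodule R E, N ⊓ LinearMap.range ι = ⊥ → N = ⊥

end Defs

/-- A (not necessarily local) Cohen–Macaulay ring: Noetherian,
with all localizations at primes Cohen–Macaulay. -/
def IsCMRing (S : Type) [CommRing S] : Prop :=
  IsNoetherianRing S ∧ ∀ (p : Ideal S) [p.IsPrime],
    IsCM (Localization.AtPrime p) (Localization.AtPrime p)

/-- A (not necessarily local) Gorenstein ring. -/
def IsGorensteinRing (S : Type) [CommRing S] : Prop :=
  IsNoetherianRing S ∧ ∀ (p : Ideal S) [p.IsPrime],
    IsGorensteinLocalRing (Localization.AtPrime p)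

/-- `HDegRel R I E M v` : `v` is the homological degree `hdeg_I(M)` computed
with Matlis duals taken relative to `E`. -/
inductive HDegRel (R : Type) [CommRing R] [IsLocalRing R] (I : Ideal R)
    (E : Type) [AddCommGroup E] [Module R E] : ModuleCat R → ℕ → Prop where
  | base : ∀ (M : ModuleCat R) (l : ℕ), mDim R M ≤ 0 → mLength R M = (l : ℕ∞) →
      HDegRel R I E M l
  | step : ∀ (M : ModuleCat R) (r : ℕ), mDim R M = (r : ℕ∞) → 0 < r →
      ∀ (e : ℕ → ℤ) (e0 : ℕ), HasHilbCoeffs R I M r e → e 0 = (e0 : ℤ) →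
      ∀ v : ℕ → ℕ,
        (∀ j < r, HDegRel R I E (ModuleCat.of R ((LC R j M) →ₗ[R] E)) (v j)) →
      HDegRel R I E M (e0 + ∑ j ∈ Finset.range r, (r - 1).choose j * v j)

section ExtCocycles

open CategoryTheory Opposite Limits

variable {R : Type} [CommRing R]

/-- Cocycles of degree `i` on a projective resolution with values in `Y`. -/
def extCocycles {X : ModuleCat.{0} R} (P : ProjectiveResolution X) (i : ℕ) (Y : ModuleCat.{0} R) :
    Submodule R (P.complex.X i ⟶ Y) :=
  LinearMap.ker (Linear.leftComp R Y (P.complex.d (i + 1) i))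

/-- The functor `X ↦ Hom(X, Y)`, viewed as a covariant functor to the opposite category. -/
noncomputable abbrev yonedaOp (Y : ModuleCat.{0} R) : ModuleCat.{0} R ⥤ (ModuleCat.{0} R)ᵒᵖ :=
  ((linearYoneda R (ModuleCat.{0} R)).obj Y).rightOp

/-- The complex `Hom(P, Y)`, viewed as a chain complex in the opposite category. -/
noncomputable abbrev yonedaCx {X : ModuleCat.{0} R} (P : ProjectiveResolution X)
    (Y : ModuleCat.{0} R) : ChainComplex (ModuleCat.{0} R)ᵒᵖ ℕ :=
  ((yonedaOp Y).mapHomologicalComplex _).obj P.complex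

/-- `Ext` computed from a projective resolution. -/
noncomputable def extIso {X : ModuleCat.{0} R} (P : ProjectiveResolution X) (i : ℕ)
    (Y : ModuleCat.{0} R) : ((yonedaOp Y).leftDerived i).obj X ≅ (yonedaCx P Y).homology i :=
  P.isoLeftDerivedObj (yonedaOp Y) i

theorem extIso_naturality_left {X X' : ModuleCat.{0} R} (u : X ⟶ X') (P : ProjectiveResolution X)
    (P' : ProjectiveResolution X') (φ : P.complex ⟶ P'.complex)
    (comm : φ.f 0 ≫ P'.π.f 0 = P.π.f 0 ≫ u) (i : ℕ) (Y : ModuleCat.{0} R) :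
    ((yonedaOp Y).leftDerived i).map u ≫ (extIso P' i Y).hom = (extIso P i Y).hom ≫
      HomologicalComplex.homologyMap (((yonedaOp Y).mapHomologicalComplex _).map φ) i :=
  ProjectiveResolution.isoLeftDerivedObj_hom_naturality u P P' φ comm (yonedaOp Y) i

theorem extIso_naturality_right {X : ModuleCat.{0} R} (P : ProjectiveResolution X) (i : ℕ)
    {Y Y' : ModuleCat.{0} R} (α : yonedaOp Y' ⟶ yonedaOp Y) :
    (NatTrans.leftDerived α i).app X ≫ (extIso P i Y).hom = (extIso P i Y').hom ≫
      HomologicalComplex.homologyMap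
        ((NatTrans.mapHomologicalComplex α (ComplexShape.down ℕ)).app P.complex) i := by
  rw [← Iso.eq_comp_inv, Category.assoc]
  exact ProjectiveResolution.leftDerived_app_eq α P i

/-- The comparison of opcycles of `Hom(P, Y)` with the cocycles. -/
noncomputable def extToOp {X : ModuleCat.{0} R} (P : ProjectiveResolution X) (i : ℕ)
    (Y : ModuleCat.{0} R) :
    (yonedaCx P Y).opcycles i ⟶ op (ModuleCat.of R (extCocycles P i Y)) :=
  (yonedaCx P Y).descOpcycles (i := i)
    (Quiver.Hom.op (ModuleCat.ofHom (extCocycles P i Y).subtype)) (i + 1) (by simp) (by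
      apply Quiver.Hom.unop_inj
      ext ⟨f, hf⟩
      exact hf)

/-- The class in `Ext` of a cocycle. -/
noncomputable def extMk {X : ModuleCat.{0} R} (P : ProjectiveResolution X) (i : ℕ)
    (Y : ModuleCat.{0} R) :
    ModuleCat.of R (extCocycles P i Y) ⟶ ((Ext R (ModuleCat.{0} R) i).obj (op X)).obj Y :=
  ((extIso P i Y).hom ≫ (yonedaCx P Y).homologyι i ≫ extToOp P i Y).unop

theorem p_extToOp {X : ModuleCat.{0} R} (P : ProjectiveResolution X) (i : ℕ)
    (Y : ModuleCat.{0} R) : (yonedaCx P Y).pOpcycles i ≫ extToOp P i Y =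
      Quiver.Hom.op (ModuleCat.ofHom (extCocycles P i Y).subtype) :=
  HomologicalComplex.p_descOpcycles _ _ _ _ _

theorem pOpcycles_unop_injective {X : ModuleCat.{0} R} (P : ProjectiveResolution X) (i : ℕ)
    (Y : ModuleCat.{0} R) : Function.Injective ((yonedaCx P Y).pOpcycles i).unop :=
  (ModuleCat.mono_iff_injective _).1 inferInstance

theorem pOpcycles_extToOp_apply {X : ModuleCat.{0} R} (P : ProjectiveResolution X) (i : ℕ)
    (Y : ModuleCat.{0} R) (f : extCocycles P i Y) :
    ((yonedaCx P Y).pOpcycles i).unop ((extToOp P i Y).unop f) = f.1 := by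
  have := congrArg Quiver.Hom.unop (p_extToOp P i Y)
  exact congrArg (fun g => g.hom f) this

theorem extToOp_bijective {X : ModuleCat.{0} R} (P : ProjectiveResolution X) (i : ℕ)
    (Y : ModuleCat.{0} R) : Function.Bijective (extToOp P i Y).unop := by
  constructor
  · intro f g h
    have := congrArg ((yonedaCx P Y).pOpcycles i).unop h
    rw [pOpcycles_extToOp_apply, pOpcycles_extToOp_apply] at this
    exact Subtype.ext this
  · intro c
    refine ⟨⟨((yonedaCx P Y).pOpcycles i).unop c, ?_⟩, ?_⟩
    · have := congrArg Quiver.Hom.unop ((yonedaCx P Y).d_pOpcycles (i + 1) i)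
      exact congrArg (fun g => g.hom c) this
    · apply pOpcycles_unop_injective
      rw [pOpcycles_extToOp_apply]

theorem extMk_surjective {X : ModuleCat.{0} R} (P : ProjectiveResolution X) (i : ℕ)
    (Y : ModuleCat.{0} R) : Function.Surjective (extMk P i Y) := by
  have : Epi ((yonedaCx P Y).homologyι i).unop := inferInstance
  have h2 : Epi (extIso P i Y).hom.unop := inferInstance
  have h3 : Epi (extToOp P i Y).unop :=
      (ModuleCat.epi_iff_surjective _).2 (extToOp_bijective P i Y).2
  intro e
  obtain ⟨a, rfl⟩ := (ModuleCat.epi_iff_surjective _).1 h2 e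
  obtain ⟨b, rfl⟩ := (ModuleCat.epi_iff_surjective _).1 this a
  obtain ⟨c, rfl⟩ := (ModuleCat.epi_iff_surjective _).1 h3 b
  exact ⟨c, rfl⟩

theorem extMk_eq_zero_iff {X : ModuleCat.{0} R} (P : ProjectiveResolution X) (i : ℕ)
    (Y : ModuleCat.{0} R) (f : extCocycles P i Y) :
    extMk P i Y f = 0 ↔ ∃ j, ∃ g : P.complex.X j ⟶ Y, f.1 = P.complex.d i j ≫ g := by
  let K := yonedaCx P Y
  have hM : Function.Injective (extIso P i Y).hom.unop :=
    (ModuleCat.mono_iff_injective _).1 inferInstance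
  have e1 : extMk P i Y f = 0 ↔ (K.homologyι i).unop ((extToOp P i Y).unop f) = 0 :=
    map_eq_zero_iff (extIso P i Y).hom.unop.hom hM
  rw [e1]
  constructor
  · intro h
    let j := (ComplexShape.down ℕ).next i
    let S := ShortComplex.mk (K.homologyι i) (K.fromOpcycles i j) (by simp)
    have hS : S.Exact := ShortComplex.exact_of_f_is_kernel S (K.homologyIsKernel i j rfl)
    have hS' := hS.unop
    rw [ShortComplex.moduleCat_exact_iff] at hS'
    obtain ⟨g, hg⟩ := hS' _ h
    refine ⟨j, g, ?_⟩
    rw [← pOpcycles_extToOp_apply, ← hg]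
    have := congrArg Quiver.Hom.unop (K.p_fromOpcycles i j)
    exact congrArg (fun u => u.hom g) this
  · rintro ⟨j, g, hg⟩
    have : (extToOp P i Y).unop f = (K.fromOpcycles i j).unop g := by
      apply pOpcycles_unop_injective
      rw [pOpcycles_extToOp_apply, hg]
      have := congrArg Quiver.Hom.unop (K.p_fromOpcycles i j)
      exact (congrArg (fun u => u.hom g) this).symm
    rw [this]
    have := congrArg Quiver.Hom.unop (K.homologyι_comp_fromOpcycles i j)
    exact (congrArg (fun u => u.hom g) this)

theorem extMk_naturality_left {X X' : ModuleCat.{0} R} (u : X ⟶ X') (P : ProjectiveResolution X)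
    (P' : ProjectiveResolution X') (φ : P.complex ⟶ P'.complex)
    (comm : φ.f 0 ≫ P'.π.f 0 = P.π.f 0 ≫ u) (i : ℕ) (Y : ModuleCat.{0} R)
    (f : extCocycles P' i Y) (f' : extCocycles P i Y) (hf : f'.1 = φ.f i ≫ f.1) :
    (((Ext R (ModuleCat.{0} R) i).map u.op).app Y) (extMk P' i Y f) = extMk P i Y f' := by
  let F := yonedaOp Y
  let Φ := (F.mapHomologicalComplex (ComplexShape.down ℕ)).map φ
  have h1 := extIso_naturality_left u P P' φ comm i Y
  have h2 : (F.leftDerived i).map u ≫ (extIso P' i Y).hom ≫ (yonedaCx P' Y).homologyι i =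
      (extIso P i Y).hom ≫ (yonedaCx P Y).homologyι i ≫
        HomologicalComplex.opcyclesMap Φ i := by
    rw [← HomologicalComplex.homologyι_naturality, reassoc_of% h1]
  have h3 : (HomologicalComplex.opcyclesMap Φ i).unop ((extToOp P' i Y).unop f) =
      (extToOp P i Y).unop f' := by
    apply pOpcycles_unop_injective
    rw [pOpcycles_extToOp_apply]
    have := congrArg Quiver.Hom.unop (HomologicalComplex.p_opcyclesMap Φ i)
    refine (congrArg (fun u => u.hom ((extToOp P' i Y).unop f)) this).trans ?_
    rw [hf]
    exact congrArg (fun z => φ.f i ≫ z) (pOpcycles_extToOp_apply P' i Y f)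
  have h4 := congrArg Quiver.Hom.unop h2
  have h5 := congrArg (fun g => g.hom ((extToOp P' i Y).unop f)) h4
  refine h5.trans ?_
  refine (congrArg (fun z => (extIso P i Y).hom.unop.hom
    (((yonedaCx P Y).homologyι i).unop.hom z)) h3)

theorem extMk_naturality_right {X : ModuleCat.{0} R} (P : ProjectiveResolution X)
    (i : ℕ) {Y Y' : ModuleCat.{0} R} (v : Y ⟶ Y')
    (f : extCocycles P i Y) (f' : extCocycles P i Y') (hf : f'.1 = f.1 ≫ v) :
    (((Ext R (ModuleCat.{0} R) i).obj (op X)).map v) (extMk P i Y f) = extMk P i Y' f' := by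
  let α : yonedaOp Y' ⟶ yonedaOp Y := NatTrans.rightOp ((linearYoneda R (ModuleCat.{0} R)).map v)
  let Φ := (NatTrans.mapHomologicalComplex α (ComplexShape.down ℕ)).app P.complex
  have h2 : (NatTrans.leftDerived α i).app X ≫ (extIso P i Y).hom ≫
      (yonedaCx P Y).homologyι i =
      (extIso P i Y').hom ≫ (yonedaCx P Y').homologyι i ≫
        HomologicalComplex.opcyclesMap Φ i := by
    rw [← HomologicalComplex.homologyι_naturality, reassoc_of% (extIso_naturality_right P i α)]
  have h3 : (HomologicalComplex.opcyclesMap Φ i).unop ((extToOp P i Y).unop f) =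
      (extToOp P i Y').unop f' := by
    apply pOpcycles_unop_injective
    rw [pOpcycles_extToOp_apply]
    have := congrArg Quiver.Hom.unop (HomologicalComplex.p_opcyclesMap Φ i)
    refine (congrArg (fun u => u.hom ((extToOp P i Y).unop f)) this).trans ?_
    rw [hf]
    exact congrArg (fun z => z ≫ v) (pOpcycles_extToOp_apply P i Y f)
  have h4 := congrArg Quiver.Hom.unop h2
  have h5 := congrArg (fun g => g.hom ((extToOp P i Y).unop f)) h4
  refine h5.trans ?_
  refine (congrArg (fun z => (extIso P i Y').hom.unop.hom
    (((yonedaCx P Y').homologyι i).unop.hom z)) h3)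

end ExtCocycles

section LocalCohomologyClasses

open CategoryTheory Opposite Limits

variable {R : Type} [CommRing R] (J : Ideal R)

open localCohomology in
/-- A projective resolution of `R ⧸ J ^ n`. -/
noncomputable def lcRes (n : ℕ) :
    ProjectiveResolution ((ringModIdeals (idealPowersDiagram J)).obj (op n)) :=
  ProjectiveResolution.of _

open localCohomology in
/-- The lift to resolutions of the projections between the quotients `R ⧸ J ^ n`. -/
noncomputable def lcTrans {n n' : ℕ} (h : n ≤ n') :
    (lcRes J n').complex ⟶ (lcRes J n).complex :=
  ProjectiveResolution.lift ((ringModIdeals (idealPowersDiagram J)).map (homOfLE h).op) _ _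

theorem lcTrans_π {n n' : ℕ} (h : n ≤ n') :
    (lcTrans J h).f 0 ≫ (lcRes J n).π.f 0 = (lcRes J n').π.f 0 ≫
      (localCohomology.ringModIdeals (localCohomology.idealPowersDiagram J)).map (homOfLE h).op :=
  ProjectiveResolution.lift_commutes_zero _ _ _

open localCohomology in
/-- The structure maps of the colimit defining local cohomology. -/
noncomputable def lcι (i n : ℕ) (Y : ModuleCat.{0} R) :
    ((Ext R (ModuleCat.{0} R) i).obj
      (op ((ringModIdeals (idealPowersDiagram J)).obj (op n)))).obj Y ⟶
      (localCohomology J i).obj Y :=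
  (colimit.ι (diagram (idealPowersDiagram J) i) (op (op n))).app Y

open localCohomology in
/-- Evaluation at `Y` preserves the colimit defining local cohomology. -/
noncomputable def lcColimit (i : ℕ) (Y : ModuleCat.{0} R) :=
  isColimitOfPreserves ((evaluation _ _).obj Y)
    (colimit.isColimit (diagram (idealPowersDiagram J) i))

/-- The class in local cohomology of a cocycle on the resolution of `R ⧸ J ^ n`. -/
noncomputable def lcMk (n i : ℕ) (Y : ModuleCat.{0} R) :
    extCocycles (lcRes J n) i Y →ₗ[R] (localCohomology J i).obj Y :=
  (extMk (lcRes J n) i Y ≫ lcι J i n Y).hom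

theorem lcMk_apply (n i : ℕ) (Y : ModuleCat.{0} R) (f) :
    lcMk J n i Y f = lcι J i n Y (extMk (lcRes J n) i Y f) := rfl

theorem exists_lcMk (i : ℕ) (Y : ModuleCat.{0} R) (u : (localCohomology J i).obj Y) :
    ∃ n f, lcMk J n i Y f = u := by
  obtain ⟨n, e, he⟩ := Concrete.isColimit_exists_rep _ (lcColimit J i Y) u
  obtain ⟨f, rfl⟩ := extMk_surjective (lcRes J n.unop.unop) i Y e
  exact ⟨n.unop.unop, f, he⟩

theorem lcMk_trans {n n' : ℕ} (h : n ≤ n') (i : ℕ) (Y : ModuleCat.{0} R)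
    (f : extCocycles (lcRes J n) i Y) (f' : extCocycles (lcRes J n') i Y)
    (hf : f'.1 = (lcTrans J h).f i ≫ f.1) : lcMk J n' i Y f' = lcMk J n i Y f := by
  rw [lcMk_apply, lcMk_apply, ← extMk_naturality_left _ _ _ _ (lcTrans_π J h) i Y f f' hf]
  have := colimit.w (localCohomology.diagram (localCohomology.idealPowersDiagram J) i)
    (homOfLE h).op.op
  exact congrArg (fun t => (t.app Y).hom (extMk (lcRes J n) i Y f)) this

theorem lcMk_eq_zero_iff (n i : ℕ) (Y : ModuleCat.{0} R) (f : extCocycles (lcRes J n) i Y) :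
    lcMk J n i Y f = 0 ↔ ∃ n', ∃ h : n ≤ n', ∃ j, ∃ g : (lcRes J n').complex.X j ⟶ Y,
      (lcTrans J h).f i ≫ f.1 = (lcRes J n').complex.d i j ≫ g := by
  have hc (n') (h : n ≤ n') : (lcTrans J h).f i ≫ f.1 ∈ extCocycles (lcRes J n') i Y := by
    change (lcRes J n').complex.d (i + 1) i ≫ (lcTrans J h).f i ≫ f.1 = 0
    rw [← HomologicalComplex.Hom.comm_assoc]
    have : (lcRes J n).complex.d (i + 1) i ≫ f.1 = 0 := f.2
    rw [this, comp_zero]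
  constructor
  · intro h0
    have h1 : (((evaluation _ _).obj Y).mapCocone (colimit.cocone (localCohomology.diagram
          (localCohomology.idealPowersDiagram J) i))).ι.app (op (op n))
            (extMk (lcRes J n) i Y f) =
        (((evaluation _ _).obj Y).mapCocone (colimit.cocone (localCohomology.diagram
          (localCohomology.idealPowersDiagram J) i))).ι.app (op (op n)) 0 := by
      rw [map_zero]; exact h0
    obtain ⟨k, φ, ψ, hk⟩ := Concrete.isColimit_exists_of_rep_eq _ (lcColimit J i Y) _ _ h1
    have hn : n ≤ k.unop.unop := leOfHom φ.unop.unop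
    refine ⟨k.unop.unop, hn, ?_⟩
    have h2 := (extMk_eq_zero_iff (lcRes J k.unop.unop) i Y ⟨_, hc _ hn⟩).1 (by
      rw [← extMk_naturality_left _ _ _ _ (lcTrans_π J hn) i Y f ⟨_, hc _ hn⟩ rfl]
      rw [map_zero] at hk
      exact hk)
    exact h2
  · rintro ⟨n', h, hg⟩
    rw [← lcMk_trans J h i Y f ⟨_, hc _ h⟩ rfl, lcMk_apply,
      (extMk_eq_zero_iff (lcRes J n') i Y ⟨_, hc _ h⟩).2 hg, map_zero]

theorem lcMk_naturality (n i : ℕ) {Y Y' : ModuleCat.{0} R} (v : Y ⟶ Y')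
    (f : extCocycles (lcRes J n) i Y) (f' : extCocycles (lcRes J n) i Y') (hf : f'.1 = f.1 ≫ v) :
    (localCohomology J i).map v (lcMk J n i Y f) = lcMk J n i Y' f' := by
  rw [lcMk_apply, lcMk_apply, ← extMk_naturality_right (lcRes J n) i v f f' hf]
  have := (colimit.ι (localCohomology.diagram (localCohomology.idealPowersDiagram J) i)
    (op (op n))).naturality v
  exact congrArg (fun t => t.hom (extMk (lcRes J n) i Y f)) this.symm

end LocalCohomologyClasses

section LongExactSequence

open CategoryTheory Opposite Limits

variable {R : Type} [CommRing R]

theorem exists_linearMap_of_graph {U V : Type*} [AddCommGroup U] [Module R U] [AddCommGroup V]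
    [Module R V] (G : Submodule R (U × V)) (total : ∀ u, ∃ v, (u, v) ∈ G)
    (single : ∀ v, (0, v) ∈ G → v = 0) : ∃ δ : U →ₗ[R] V, ∀ u v, (u, v) ∈ G ↔ δ u = v := by
  let π : G →ₗ[R] U := LinearMap.fst R U V ∘ₗ G.subtype
  have hπ : Function.Bijective π := by
    constructor
    · rw [injective_iff_map_eq_zero]
      rintro ⟨⟨u, v⟩, h⟩ (rfl : u = 0)
      obtain rfl := single v h
      rfl
    · intro u
      obtain ⟨v, h⟩ := total u
      exact ⟨⟨_, h⟩, rfl⟩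
  let e := LinearEquiv.ofBijective π hπ
  refine ⟨LinearMap.snd R U V ∘ₗ G.subtype ∘ₗ e.symm.toLinearMap, fun u v => ?_⟩
  constructor
  · intro h
    have : e.symm u = ⟨(u, v), h⟩ := by rw [LinearEquiv.symm_apply_eq]; rfl
    simp [this]
  · rintro rfl
    have : (e.symm u).1.1 = u := e.apply_symm_apply u
    have h2 := (e.symm u).2
    rw [← Prod.mk.eta (p := (e.symm u).1), this] at h2
    exact h2

variable (J : Ideal R)

/-- The local cohomology class of a cocycle. -/
noncomputable def lcCl (n : ℕ) {i : ℕ} {Y : ModuleCat.{0} R} (f : (lcRes J n).complex.X i ⟶ Y)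
    (hf : (lcRes J n).complex.d (i + 1) i ≫ f = 0) : (localCohomology J i).obj Y :=
  lcMk J n i Y ⟨f, hf⟩

variable {J}

theorem exists_lcCl {i : ℕ} {Y : ModuleCat.{0} R} (u : (localCohomology J i).obj Y) :
    ∃ n f hf, lcCl J n f hf = u := by
  obtain ⟨n, ⟨f, hf⟩, h⟩ := exists_lcMk J i Y u
  exact ⟨n, f, hf, h⟩

theorem lcCl_add {n i : ℕ} {Y : ModuleCat.{0} R} (f g : (lcRes J n).complex.X i ⟶ Y) (hf hg) :
    lcCl J n f hf + lcCl J n g hg =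
      lcCl J n (f + g) (by rw [Preadditive.comp_add, hf, hg, add_zero]) :=
  (map_add (lcMk J n i Y) _ _).symm

theorem lcCl_sub {n i : ℕ} {Y : ModuleCat.{0} R} (f g : (lcRes J n).complex.X i ⟶ Y) (hf hg) :
    lcCl J n f hf - lcCl J n g hg =
      lcCl J n (f - g) (by rw [Preadditive.comp_sub, hf, hg, sub_zero]) :=
  (map_sub (lcMk J n i Y) _ _).symm

theorem lcCl_smul {n i : ℕ} {Y : ModuleCat.{0} R} (r : R) (f : (lcRes J n).complex.X i ⟶ Y) (hf) :
    r • lcCl J n f hf = lcCl J n (r • f) (by rw [Linear.comp_smul, hf, smul_zero]) :=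
  (map_smul (lcMk J n i Y) r _).symm

theorem lcTrans_cocycle {n n' i : ℕ} (h : n ≤ n') {Y : ModuleCat.{0} R}
    {f : (lcRes J n).complex.X i ⟶ Y} (hf : (lcRes J n).complex.d (i + 1) i ≫ f = 0) :
    (lcRes J n').complex.d (i + 1) i ≫ (lcTrans J h).f i ≫ f = 0 := by
  rw [← HomologicalComplex.Hom.comm_assoc, hf, comp_zero]

theorem lcCl_trans {n n' i : ℕ} (h : n ≤ n') {Y : ModuleCat.{0} R}
    (f : (lcRes J n).complex.X i ⟶ Y) (hf) :
    lcCl J n' ((lcTrans J h).f i ≫ f) (lcTrans_cocycle h hf) = lcCl J n f hf :=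
  lcMk_trans J h i Y ⟨f, hf⟩ ⟨_, lcTrans_cocycle h hf⟩ rfl

theorem lcCl_eq_zero_iff {n i : ℕ} {Y : ModuleCat.{0} R} (f : (lcRes J n).complex.X i ⟶ Y) (hf) :
    lcCl J n f hf = 0 ↔ ∃ n', ∃ h : n ≤ n', ∃ j, ∃ g : (lcRes J n').complex.X j ⟶ Y,
      (lcTrans J h).f i ≫ f = (lcRes J n').complex.d i j ≫ g :=
  lcMk_eq_zero_iff J n i Y ⟨f, hf⟩

theorem map_lcCl {n i : ℕ} {Y Y' : ModuleCat.{0} R} (v : Y ⟶ Y')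
    (f : (lcRes J n).complex.X i ⟶ Y) (hf) :
    (localCohomology J i).map v (lcCl J n f hf) =
      lcCl J n (f ≫ v) (by rw [reassoc_of% hf, zero_comp]) :=
  lcMk_naturality J n i v ⟨f, hf⟩ ⟨f ≫ v, _⟩ rfl

theorem lcCl_congr {n i : ℕ} {Y : ModuleCat.{0} R} {f g : (lcRes J n).complex.X i ⟶ Y} (h : f = g)
    (hf) : lcCl J n f hf = lcCl J n g (h ▸ hf) := by
  subst h; rfl

theorem lcCl_coboundary {n i j : ℕ} {Y : ModuleCat.{0} R} (g : (lcRes J n).complex.X j ⟶ Y)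
    (hf : (lcRes J n).complex.d (i + 1) i ≫ (lcRes J n).complex.d i j ≫ g = 0) :
    lcCl J n ((lcRes J n).complex.d i j ≫ g) hf = 0 :=
  (lcCl_eq_zero_iff _ _).2 ⟨n, le_rfl, j, (lcTrans J le_rfl).f j ≫ g, by
    rw [HomologicalComplex.Hom.comm_assoc]⟩

instance lcRes_projective (n i : ℕ) : Projective ((lcRes J n).complex.X i) :=
  (lcRes J n).projective i

variable {A B C : ModuleCat.{0} R} {ι : A ⟶ B} {p : B ⟶ C}

theorem exists_lift_of_comp_eq_zero (hι : Function.Injective ι)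
    (hex : ∀ b, p b = 0 → ∃ a, ι a = b) {Z : ModuleCat.{0} R} (g : Z ⟶ B) (hg : g ≫ p = 0) :
    ∃ a : Z ⟶ A, a ≫ ι = g := by
  have hr : ∀ z, g.hom z ∈ LinearMap.range ι.hom := fun z => by
    obtain ⟨a, ha⟩ := hex (g z) (congrArg (fun t => t.hom z) hg)
    exact ⟨a, ha⟩
  refine ⟨ModuleCat.ofHom ((LinearEquiv.ofInjective ι.hom hι).symm.toLinearMap ∘ₗ
    g.hom.codRestrict _ hr), ?_⟩
  ext z
  exact congrArg Subtype.val ((LinearEquiv.ofInjective ι.hom hι).apply_symm_apply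
    (g.hom.codRestrict _ hr z))

/-- The connecting homomorphism, with exactness of the long exact sequence. -/
theorem exists_connecting (hι : Function.Injective ι) (hp : Function.Surjective p)
    (hz : ι ≫ p = 0) (hex : ∀ b, p b = 0 → ∃ a, ι a = b) (i : ℕ) :
    ∃ δ : (localCohomology J i).obj C →ₗ[R] (localCohomology J (i + 1)).obj A,
      (∀ w, δ w = 0 ↔ ∃ u, (localCohomology J i).map p u = w) ∧
      (∀ v, (localCohomology J (i + 1)).map ι v = 0 ↔ ∃ w, δ w = v) := by
  have hmono : Mono ι := (ModuleCat.mono_iff_injective _).2 hι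
  have hepi : Epi p := (ModuleCat.epi_iff_surjective _).2 hp
  have coc {n : ℕ} {g : (lcRes J n).complex.X i ⟶ B} {a : (lcRes J n).complex.X (i + 1) ⟶ A}
      (h : a ≫ ι = (lcRes J n).complex.d (i + 1) i ≫ g) :
      (lcRes J n).complex.d (i + 1) i ≫ g ≫ p = 0 ∧
      (lcRes J n).complex.d (i + 1 + 1) (i + 1) ≫ a = 0 := by
    constructor
    · rw [← reassoc_of% h, hz, comp_zero]
    · rw [← cancel_mono ι, Category.assoc, h, HomologicalComplex.d_comp_d_assoc, zero_comp,
        zero_comp]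
  have tr {n n' : ℕ} (hn : n ≤ n') {g : (lcRes J n).complex.X i ⟶ B}
      {a : (lcRes J n).complex.X (i + 1) ⟶ A} (h : a ≫ ι = (lcRes J n).complex.d (i + 1) i ≫ g) :
      ((lcTrans J hn).f (i + 1) ≫ a) ≫ ι =
        (lcRes J n').complex.d (i + 1) i ≫ (lcTrans J hn).f i ≫ g := by
    rw [Category.assoc, h, HomologicalComplex.Hom.comm_assoc]
  let G : Submodule R ((localCohomology J i).obj C × (localCohomology J (i + 1)).obj A) :=
    { carrier := {w | ∃ (n : ℕ) (g : (lcRes J n).complex.X i ⟶ B)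
        (a : (lcRes J n).complex.X (i + 1) ⟶ A)
        (h : a ≫ ι = (lcRes J n).complex.d (i + 1) i ≫ g),
        w = (lcCl J n (g ≫ p) (coc h).1, lcCl J n a (coc h).2)}
      add_mem' := by
        rintro _ _ ⟨n, g, a, h, rfl⟩ ⟨n', g', a', h', rfl⟩
        have hn : n ≤ max n n' := le_max_left _ _
        have hn' : n' ≤ max n n' := le_max_right _ _
        refine ⟨max n n', (lcTrans J hn).f i ≫ g + (lcTrans J hn').f i ≫ g',
          (lcTrans J hn).f (i + 1) ≫ a + (lcTrans J hn').f (i + 1) ≫ a', ?_, ?_⟩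
        · rw [Preadditive.add_comp, tr hn h, tr hn' h', Preadditive.comp_add]
        · rw [← lcCl_trans hn, ← lcCl_trans hn' (g' ≫ p), ← lcCl_trans hn a,
            ← lcCl_trans hn' a', Prod.mk_add_mk, lcCl_add, lcCl_add]
          congr 1
          apply lcCl_congr
          simp
      zero_mem' := ⟨0, 0, 0, by simp, by
        have e1 : lcCl J 0 ((0 : (lcRes J 0).complex.X i ⟶ B) ≫ p) (coc (a := 0) (by simp)).1 = 0 := by
          rw [lcCl_eq_zero_iff]
          exact ⟨0, le_rfl, 0, 0, by simp⟩
        have e2 : lcCl J 0 (0 : (lcRes J 0).complex.X (i + 1) ⟶ A) (by simp) = 0 := by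
          rw [lcCl_eq_zero_iff]
          exact ⟨0, le_rfl, 0, 0, by simp⟩
        rw [e1, e2]; rfl⟩
      smul_mem' := by
        rintro r _ ⟨n, g, a, h, rfl⟩
        refine ⟨n, r • g, r • a, by simp [h], ?_⟩
        rw [Prod.smul_mk, lcCl_smul, lcCl_smul]
        congr 1
        apply lcCl_congr
        simp }
  obtain ⟨δ, hδ⟩ := exists_linearMap_of_graph G (by
    intro u
    obtain ⟨n, f, hf, rfl⟩ := exists_lcCl u
    obtain ⟨a, ha⟩ := exists_lift_of_comp_eq_zero (p := p) hι hex
      ((lcRes J n).complex.d (i + 1) i ≫ Projective.factorThru f p) (by simpa using hf)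
    refine ⟨lcCl J n a (coc ha).2, n, Projective.factorThru f p, a, ha, ?_⟩
    congr 1
    apply lcCl_congr
    simp) (by
    rintro v ⟨n, g, a, h, he⟩
    rw [Prod.mk.injEq] at he
    obtain ⟨h0, rfl⟩ := he
    obtain ⟨n', hn, j, t, ht⟩ := (lcCl_eq_zero_iff _ _).1 h0.symm
    obtain ⟨b, hb⟩ := exists_lift_of_comp_eq_zero (p := p) hι hex
      ((lcTrans J hn).f i ≫ g - (lcRes J n').complex.d i j ≫ Projective.factorThru t p)
      (by simp [ht])
    have : (lcTrans J hn).f (i + 1) ≫ a = (lcRes J n').complex.d (i + 1) i ≫ b := by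
      rw [← cancel_mono ι, Category.assoc, Category.assoc, hb, h]
      simp
    rw [← lcCl_trans hn, lcCl_congr this, lcCl_coboundary])
  refine ⟨δ, fun w => ⟨fun hw => ?_, ?_⟩, fun v => ⟨fun hv => ?_, ?_⟩⟩
  · obtain ⟨n, g, a, h, he⟩ := (hδ w 0).2 hw
    rw [Prod.mk.injEq] at he
    obtain ⟨rfl, h0⟩ := he
    obtain ⟨n', hn, j, t, ht⟩ := (lcCl_eq_zero_iff _ _).1 h0.symm
    have hj : j = i ∨ (lcRes J n').complex.d (i + 1) j = 0 := by
      by_cases hij : (ComplexShape.down ℕ).Rel (i + 1) j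
      · left; simpa using hij
      · right; exact (lcRes J n').complex.shape _ _ hij
    obtain ⟨t', ht'⟩ : ∃ t' : (lcRes J n').complex.X i ⟶ A,
        (lcTrans J hn).f (i + 1) ≫ a = (lcRes J n').complex.d (i + 1) i ≫ t' := by
      rcases hj with rfl | hj
      · exact ⟨t, ht⟩
      · exact ⟨0, by rw [ht, hj]; simp⟩
    have hc : (lcRes J n').complex.d (i + 1) i ≫ ((lcTrans J hn).f i ≫ g - t' ≫ ι) = 0 := by
      rw [Preadditive.comp_sub, ← tr hn h, ht', Category.assoc, sub_self]
    refine ⟨lcCl J n' _ hc, ?_⟩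
    rw [map_lcCl, ← lcCl_trans hn]
    apply lcCl_congr
    simp [hz]
  · rintro ⟨u, rfl⟩
    obtain ⟨n, f, hf, rfl⟩ := exists_lcCl u
    rw [← hδ]
    refine ⟨n, f, 0, by simp [hf], ?_⟩
    rw [map_lcCl]
    congr 1
    symm
    rw [lcCl_eq_zero_iff]
    exact ⟨n, le_rfl, 0, 0, by simp⟩
  · obtain ⟨n, f, hf, rfl⟩ := exists_lcCl v
    rw [map_lcCl] at hv
    obtain ⟨n', hn, j, t, ht⟩ := (lcCl_eq_zero_iff _ _).1 hv
    have hj : j = i ∨ (lcRes J n').complex.d (i + 1) j = 0 := by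
      by_cases hij : (ComplexShape.down ℕ).Rel (i + 1) j
      · left; simpa using hij
      · right; exact (lcRes J n').complex.shape _ _ hij
    obtain ⟨t', ht'⟩ : ∃ t' : (lcRes J n').complex.X i ⟶ B,
        (lcTrans J hn).f (i + 1) ≫ f ≫ ι = (lcRes J n').complex.d (i + 1) i ≫ t' := by
      rcases hj with rfl | hj
      · exact ⟨t, ht⟩
      · exact ⟨0, by rw [ht, hj]; simp⟩
    have h : ((lcTrans J hn).f (i + 1) ≫ f) ≫ ι = (lcRes J n').complex.d (i + 1) i ≫ t' := by
      rw [Category.assoc, ht']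
    refine ⟨lcCl J n' (t' ≫ p) (coc h).1, (hδ _ _).1 ⟨n', t', _, h, ?_⟩⟩
    rw [lcCl_trans]
  · rintro ⟨w, rfl⟩
    obtain ⟨n, g, a, h, he⟩ := (hδ w _).2 rfl
    rw [Prod.mk.injEq] at he
    rw [he.2, map_lcCl, lcCl_congr h, lcCl_coboundary]

theorem localCohomology_exact_mid (hι : Function.Injective ι) (hp : Function.Surjective p)
    (hz : ι ≫ p = 0) (hex : ∀ b, p b = 0 → ∃ a, ι a = b) (i : ℕ)
    (u : (localCohomology J i).obj B) :
    (localCohomology J i).map p u = 0 ↔ ∃ v, (localCohomology J i).map ι v = u := by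
  have hmono : Mono ι := (ModuleCat.mono_iff_injective _).2 hι
  have hepi : Epi p := (ModuleCat.epi_iff_surjective _).2 hp
  constructor
  · intro h
    obtain ⟨n, f, hf, rfl⟩ := exists_lcCl u
    rw [map_lcCl] at h
    obtain ⟨n', hn, j, t, ht⟩ := (lcCl_eq_zero_iff _ _).1 h
    obtain ⟨b, hb⟩ := exists_lift_of_comp_eq_zero (p := p) hι hex
      ((lcTrans J hn).f i ≫ f - (lcRes J n').complex.d i j ≫ Projective.factorThru t p)
      (by simp [ht])
    have hc := lcTrans_cocycle hn hf
    refine ⟨lcCl J n' b ?_, ?_⟩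
    · rw [← cancel_mono ι, Category.assoc, hb, Preadditive.comp_sub, hc]
      simp
    · rw [map_lcCl, lcCl_congr hb, ← lcCl_sub _ _ hc (by simp), lcCl_coboundary, sub_zero,
        lcCl_trans]
  · rintro ⟨v, rfl⟩
    rw [← ConcreteCategory.comp_apply, ← Functor.map_comp, hz]
    obtain ⟨n, f, hf, rfl⟩ := exists_lcCl v
    rw [map_lcCl, lcCl_eq_zero_iff]
    exact ⟨n, le_rfl, 0, 0, by simp⟩

theorem localCohomology_injective_eq_zero [Injective A] (i : ℕ)
    (u : (localCohomology J (i + 1)).obj A) : u = 0 := by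
  obtain ⟨n, f, hf, rfl⟩ := exists_lcCl u
  let S := (lcRes J n).complex.sc' (i + 1 + 1) (i + 1) i
  have hS : S.Exact := ((lcRes J n).complex.exactAt_iff' (i + 1 + 1) (i + 1) i (by simp) (by simp)).1
    ((lcRes J n).complex_exactAt_succ i)
  obtain ⟨g, hg⟩ : ∃ g : (lcRes J n).complex.X i ⟶ A, (lcRes J n).complex.d (i + 1) i ≫ g = f :=
    ⟨hS.descToInjective f hf, hS.comp_descToInjective f hf⟩
  rw [← lcCl_congr hg (by simp), lcCl_coboundary]

theorem localCohomology_map_smul (i : ℕ) (r : R) (u : (localCohomology J i).obj A) :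
    (localCohomology J i).map (r • 𝟙 A) u = r • u := by
  obtain ⟨n, f, hf, rfl⟩ := exists_lcCl u
  rw [map_lcCl, lcCl_smul]
  apply lcCl_congr
  simp

end LongExactSequence

section ZerothLocalCohomology

open CategoryTheory Opposite Limits

variable {R : Type} [CommRing R] (J : Ideal R)

/-- The augmentation of the chosen resolution of `R ⧸ J ^ n`. -/
noncomputable def lcAug (n : ℕ) : (lcRes J n).complex.X 0 →ₗ[R] R ⧸ J ^ n :=
  ((lcRes J n).π.f 0).hom

theorem lcAug_surjective (n : ℕ) : Function.Surjective (lcAug J n) :=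
  (ModuleCat.epi_iff_surjective ((lcRes J n).π.f 0)).1 inferInstance

theorem lcAug_d (n : ℕ) (w) : lcAug J n ((lcRes J n).complex.d 1 0 w) = 0 :=
  congrArg (fun t => t.hom w) (lcRes J n).complex_d_comp_π_f_zero

theorem exists_d_of_lcAug_eq_zero (n : ℕ) (z) (hz : lcAug J n z = 0) :
    ∃ w, (lcRes J n).complex.d 1 0 w = z :=
  (ShortComplex.moduleCat_exact_iff _).1 (lcRes J n).exact₀ z hz

theorem lcAug_trans {n n' : ℕ} (h : n ≤ n') (z : (lcRes J n').complex.X 0) (r : R)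
    (hz : lcAug J n' z = Ideal.Quotient.mk _ r) :
    lcAug J n ((lcTrans J h).f 0 z) = Ideal.Quotient.mk _ r := by
  have := congrArg (fun t => t.hom z) (lcTrans_π J h)
  refine this.trans ?_
  change ((localCohomology.ringModIdeals (localCohomology.idealPowersDiagram J)).map
    (homOfLE h).op).hom (lcAug J n' z) = _
  rw [hz]
  rfl

variable {J}

/-- Evaluation of degree zero classes: graph description. -/
theorem exists_lcZeroEval (Y : ModuleCat.{0} R) : ∃ ev : (localCohomology J 0).obj Y →ₗ[R] Y,
    ∀ n (f : (lcRes J n).complex.X 0 ⟶ Y) hf z r, lcAug J n z = Ideal.Quotient.mk _ r →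
      f z = r • ev (lcCl J n f hf) := by
  let G : Submodule R ((localCohomology J 0).obj Y × Y) :=
    { carrier := {w | ∃ (n : ℕ) (f : (lcRes J n).complex.X 0 ⟶ Y) (hf : _), lcCl J n f hf = w.1 ∧
        ∀ z r, lcAug J n z = Ideal.Quotient.mk _ r → f z = r • w.2}
      add_mem' := by
        rintro ⟨_, c⟩ ⟨_, c'⟩ ⟨n, f, hf, rfl, h⟩ ⟨n', f', hf', rfl, h'⟩
        have hn : n ≤ max n n' := le_max_left _ _
        have hn' : n' ≤ max n n' := le_max_right _ _
        refine ⟨max n n', (lcTrans J hn).f 0 ≫ f + (lcTrans J hn').f 0 ≫ f', by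
          rw [Preadditive.comp_add, lcTrans_cocycle hn hf, lcTrans_cocycle hn' hf', add_zero],
          ?_, ?_⟩
        · rw [← lcCl_add _ _ (lcTrans_cocycle hn hf) (lcTrans_cocycle hn' hf'), lcCl_trans,
            lcCl_trans]
          rfl
        · intro z r hz
          have e1 := h _ r (lcAug_trans J hn z r hz)
          have e2 := h' _ r (lcAug_trans J hn' z r hz)
          change f ((lcTrans J hn).f 0 z) + f' ((lcTrans J hn').f 0 z) = _
          rw [e1, e2]
          exact (smul_add _ _ _).symm
      zero_mem' := by
        refine ⟨0, 0, by simp, ?_, ?_⟩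
        · refine (lcCl_eq_zero_iff _ _).2 ?_
          exact ⟨0, le_rfl, 0, 0, by simp⟩
        · intro z r _
          exact (smul_zero r).symm
      smul_mem' := by
        rintro a ⟨_, c⟩ ⟨n, f, hf, rfl, h⟩
        refine ⟨n, a • f, by simp [hf], ?_, ?_⟩
        · rw [← lcCl_smul]; rfl
        · intro z r hz
          change a • f z = r • a • c
          rw [h z r hz, smul_comm] }
  have fac (n : ℕ) (f : (lcRes J n).complex.X 0 ⟶ Y)
      (hf : (lcRes J n).complex.d (0 + 1) 0 ≫ f = 0) :
      ∃ c : Y, ∀ z r, lcAug J n z = Ideal.Quotient.mk _ r → f z = r • c := by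
    obtain ⟨e, he⟩ := lcAug_surjective J n (Ideal.Quotient.mk _ 1)
    refine ⟨f e, fun z r hz => ?_⟩
    obtain ⟨w, hw⟩ := exists_d_of_lcAug_eq_zero J n (z - r • e) (by
      rw [map_sub, map_smul, hz, he]
      change Ideal.Quotient.mk _ r - Ideal.Quotient.mk _ (r * 1) = 0
      simp)
    have h0 : f (z - r • e) = 0 := by
      rw [← hw]; exact congrArg (fun t => t.hom w) hf
    rwa [map_sub, map_smul, sub_eq_zero] at h0
  obtain ⟨ev, hev⟩ := exists_linearMap_of_graph G (by
    intro u
    obtain ⟨n, f, hf, rfl⟩ := exists_lcCl u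
    obtain ⟨c, hc⟩ := fac n f hf
    exact ⟨c, n, f, hf, rfl, hc⟩) (by
    rintro c ⟨n, f, hf, h0, h⟩
    obtain ⟨n', hn, j, t, ht⟩ := (lcCl_eq_zero_iff _ _).1 h0
    rw [(lcRes J n').complex.shape _ _ (by simp), zero_comp] at ht
    obtain ⟨e, he⟩ := lcAug_surjective J n' (Ideal.Quotient.mk _ 1)
    have e1 := h _ 1 (lcAug_trans J hn e 1 he)
    have e2 : f ((lcTrans J hn).f 0 e) = 0 := congrArg (fun t => t.hom e) ht
    rw [e2, one_smul] at e1
    exact e1.symm)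
  refine ⟨ev, fun n f hf z r hz => ?_⟩
  obtain ⟨c, hc⟩ := fac n f hf
  rw [(hev (lcCl J n f hf) c).1 ⟨n, f, hf, rfl, hc⟩, hc z r hz]

/-- Zeroth local cohomology maps to the module, by evaluation at `1 ∈ R ⧸ J ^ n`. -/
noncomputable def lcZeroEval (Y : ModuleCat.{0} R) : (localCohomology J 0).obj Y →ₗ[R] Y :=
  (exists_lcZeroEval Y).choose

theorem lcZeroEval_spec {Y : ModuleCat.{0} R} {n : ℕ} (f : (lcRes J n).complex.X 0 ⟶ Y) (hf) (z r)
    (hz : lcAug J n z = Ideal.Quotient.mk _ r) : f z = r • lcZeroEval Y (lcCl J n f hf) :=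
  (exists_lcZeroEval Y).choose_spec n f hf z r hz

theorem lcZeroEval_injective (Y : ModuleCat.{0} R) :
    Function.Injective (lcZeroEval (J := J) Y) := by
  rw [injective_iff_map_eq_zero]
  intro u hu
  obtain ⟨n, f, hf, rfl⟩ := exists_lcCl u
  have : f = 0 := by
    ext z
    obtain ⟨r, hr⟩ := Ideal.Quotient.mk_surjective (lcAug J n z)
    have := lcZeroEval_spec f hf z r hr.symm
    rw [hu, smul_zero] at this
    exact this
  rw [lcCl_eq_zero_iff]
  exact ⟨n, le_rfl, 0, 0, by simp [this]⟩

theorem lcZeroEval_map {Y Y' : ModuleCat.{0} R} (v : Y ⟶ Y') (u : (localCohomology J 0).obj Y) :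
    lcZeroEval Y' ((localCohomology J 0).map v u) = v (lcZeroEval Y u) := by
  obtain ⟨n, f, hf, rfl⟩ := exists_lcCl u
  obtain ⟨e, he⟩ := lcAug_surjective J n (Ideal.Quotient.mk _ 1)
  have e1 := lcZeroEval_spec f hf e 1 he
  rw [map_lcCl]
  have e2 := lcZeroEval_spec (f ≫ v) (by rw [reassoc_of% hf, zero_comp]) e 1 he
  rw [one_smul] at e1 e2
  rw [← e1, ← e2]
  rfl

theorem mem_range_lcZeroEval_iff {Y : ModuleCat.{0} R} (c : Y) :
    (∃ u, lcZeroEval (J := J) Y u = c) ↔ ∃ n, ∀ a ∈ J ^ n, a • c = 0 := by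
  constructor
  · rintro ⟨u, rfl⟩
    obtain ⟨n, f, hf, rfl⟩ := exists_lcCl u
    refine ⟨n, fun a ha => ?_⟩
    rw [← lcZeroEval_spec f hf 0 a (by rw [map_zero, Ideal.Quotient.eq_zero_iff_mem.2 ha]), map_zero]
  · rintro ⟨n, h⟩
    let f : (lcRes J n).complex.X 0 ⟶ Y := ModuleCat.ofHom
      ((Submodule.liftQ (J ^ n) (LinearMap.toSpanSingleton R Y c) (fun a ha => h a ha)) ∘ₗ lcAug J n)
    have hf : (lcRes J n).complex.d (0 + 1) 0 ≫ f = 0 := by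
      ext w
      change (Submodule.liftQ (J ^ n) (LinearMap.toSpanSingleton R Y c) (fun a ha => h a ha))
        (lcAug J n ((lcRes J n).complex.d 1 0 w)) = 0
      rw [lcAug_d, map_zero]
    refine ⟨lcCl J n f hf, ?_⟩
    obtain ⟨e, he⟩ := lcAug_surjective J n (Ideal.Quotient.mk _ 1)
    have e1 := lcZeroEval_spec f hf e 1 he
    rw [one_smul] at e1
    rw [← e1]
    change (Submodule.liftQ (J ^ n) (LinearMap.toSpanSingleton R Y c) (fun a ha => h a ha))
      (lcAug J n e) = c
    rw [he]
    change (1 : R) • c = c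
    exact one_smul _ _

/-- The `J`-power torsion submodule. -/
def powTorsion (J : Ideal R) (M : Type*) [AddCommGroup M] [Module R M] : Submodule R M where
  carrier := {c | ∃ n, ∀ a ∈ J ^ n, a • c = 0}
  zero_mem' := ⟨0, fun a _ => smul_zero a⟩
  add_mem' := by
    rintro x y ⟨n, hn⟩ ⟨m, hm⟩
    refine ⟨max n m, fun a ha => ?_⟩
    rw [smul_add, hn a (Ideal.pow_le_pow_right (le_max_left _ _) ha),
      hm a (Ideal.pow_le_pow_right (le_max_right _ _) ha), add_zero]
  smul_mem' := by
    rintro r x ⟨n, hn⟩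
    exact ⟨n, fun a ha => by rw [smul_comm, hn a ha, smul_zero]⟩

theorem injective_powTorsion [IsNoetherianRing R] (J : Ideal R) (E : Type) [AddCommGroup E]
    [Module R E] [hE : Module.Injective R E] : Module.Injective R (powTorsion J E) := by
  apply Module.Baer.injective
  intro I g
  have hk : ∃ k, ∀ a ∈ J ^ k, ∀ x, a • g x = 0 := by
    obtain ⟨s, hs⟩ : (⊤ : Submodule R I).FG := Module.Finite.fg_top
    choose! n hn using fun x : I => (g x).2
    refine ⟨s.sup n, fun a ha x => ?_⟩
    have hx : x ∈ Submodule.span R (s : Set I) := hs ▸ Submodule.mem_top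
    induction hx using Submodule.span_induction with
    | mem x hx =>
      exact Subtype.ext (hn x a (Ideal.pow_le_pow_right (Finset.le_sup hx) ha))
    | zero => simp
    | add x y _ _ h1 h2 => rw [map_add, smul_add, h1, h2, add_zero]
    | smul r x _ h => rw [map_smul, smul_comm, h, smul_zero]
  obtain ⟨k, hk⟩ := hk
  obtain ⟨m, hm⟩ := Ideal.exists_pow_inf_eq_pow_smul J I
  have hm := hm (m + k) (by omega)
  let q : I →ₗ[R] R ⧸ J ^ (m + k) := (Submodule.mkQ (J ^ (m + k))) ∘ₗ I.subtype
  have hker : LinearMap.ker q ≤ LinearMap.ker ((powTorsion J E).subtype ∘ₗ g) := by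
    rintro ⟨x, hx⟩ h
    have h1 : x ∈ J ^ (m + k) := (Submodule.Quotient.mk_eq_zero _).1 h
    have h2 : x ∈ J ^ (m + k) • (⊤ : Submodule R R) ⊓ I := ⟨by simpa using h1, hx⟩
    rw [hm, show m + k - m = k by omega] at h2
    have h3 : x ∈ J ^ k • I := Submodule.smul_mono le_rfl inf_le_right h2
    have h4 : J ^ k • I ≤ (LinearMap.ker g).map I.subtype := by
      rw [Submodule.smul_le]
      intro r hr n hn
      exact ⟨r • ⟨n, hn⟩, (map_smul g r ⟨n, hn⟩).trans (hk r hr _), rfl⟩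
    obtain ⟨⟨y, hy⟩, hy0, rfl⟩ := h4 h3
    simpa using hy0
  obtain ⟨h, hh⟩ := hE.out ((LinearMap.ker q).liftQ q le_rfl)
    (LinearMap.ker_eq_bot.1 (Submodule.ker_liftQ_eq_bot' _ _ rfl))
    ((LinearMap.ker q).liftQ _ hker)
  have htor : h (Submodule.Quotient.mk 1) ∈ powTorsion J E := by
    refine ⟨m + k, fun a ha => ?_⟩
    rw [← map_smul, ← Submodule.Quotient.mk_smul,
      (Submodule.Quotient.mk_eq_zero _).2 (by simpa using ha), map_zero]
  refine ⟨LinearMap.toSpanSingleton R _ ⟨_, htor⟩, fun x hx => ?_⟩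
  have := hh (Submodule.Quotient.mk ⟨x, hx⟩)
  apply Subtype.ext
  change x • h (Submodule.Quotient.mk 1) = _
  rw [← map_smul, ← Submodule.Quotient.mk_smul, smul_eq_mul, mul_one]
  exact this

theorem localCohomology_torsion_eq_zero [IsNoetherianRing R] (i : ℕ) (T : ModuleCat.{0} R)
    (hT : ∀ t : T, ∃ n, ∀ a ∈ J ^ n, a • t = 0)
    (u : (localCohomology J (i + 1)).obj T) : u = 0 := by
  induction i generalizing T with
  | zero => ?_
  | succ i ih => ?_
  all_goals
    let E₀ : ModuleCat.{0} R := Injective.under T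
    let E := ModuleCat.of R (powTorsion J E₀)
    have : Module.Injective R E₀ :=
      @Module.injective_module_of_injective_object R _ _ _ _
        (inferInstanceAs (Injective (Injective.under T)))
    have hI : Injective E :=
      @Module.injective_object_of_injective_module R _ _ _ _ (injective_powTorsion J _)
    have hιinj : Function.Injective (Injective.ι T) :=
      (ModuleCat.mono_iff_injective _).1 inferInstance
    have hmem (t : T) : (Injective.ι T).hom t ∈ powTorsion J E₀ := by
      obtain ⟨n, hn⟩ := hT t
      exact ⟨n, fun a ha => by rw [← map_smul, hn a ha, map_zero]⟩
    let ι : T →ₗ[R] powTorsion J E₀ := (Injective.ι T).hom.codRestrict _ hmem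
    have hι : Function.Injective (ModuleCat.ofHom ι) := fun a b h =>
      hιinj (congrArg Subtype.val h)
    let p : E ⟶ ModuleCat.of R (powTorsion J E₀ ⧸ LinearMap.range ι) :=
      ModuleCat.ofHom (Submodule.mkQ _)
    have hp : Function.Surjective p := Submodule.mkQ_surjective _
    have hz : ModuleCat.ofHom ι ≫ p = 0 := by
      ext t
      exact (Submodule.Quotient.mk_eq_zero _).2 ⟨t, rfl⟩
    have hex : ∀ b, p b = 0 → ∃ a, ModuleCat.ofHom ι a = b := fun b hb =>
      (Submodule.Quotient.mk_eq_zero (LinearMap.range ι)).1 hb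
    have hC : ∀ c : ModuleCat.of R (powTorsion J E₀ ⧸ LinearMap.range ι),
        ∃ n, ∀ a ∈ J ^ n, a • c = 0 := by
      intro c
      obtain ⟨e, rfl⟩ := hp c
      obtain ⟨n, hn⟩ := e.2
      exact ⟨n, fun a ha => by
        rw [← map_smul, (Subtype.ext (hn a ha) : a • e = 0), map_zero]⟩
  · obtain ⟨δ, h1, h2⟩ := exists_connecting (J := J) hι hp hz hex 0
    obtain ⟨w, rfl⟩ := (h2 u).1 (localCohomology_injective_eq_zero 0 _)
    rw [h1]
    obtain ⟨e, he⟩ := hp (lcZeroEval _ w)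
    obtain ⟨v, hv⟩ := (mem_range_lcZeroEval_iff (J := J) (Y := E) e).2 (by
      obtain ⟨n, hn⟩ := e.2
      exact ⟨n, fun a ha => Subtype.ext (hn a ha)⟩)
    refine ⟨v, lcZeroEval_injective _ ?_⟩
    rw [lcZeroEval_map, hv, he]
  · obtain ⟨δ, h1, h2⟩ := exists_connecting (J := J) hι hp hz hex (i + 1)
    obtain ⟨w, rfl⟩ := (h2 u).1 (localCohomology_injective_eq_zero (i + 1) _)
    rw [ih _ hC w, map_zero]

end ZerothLocalCohomology

section Saturation

open CategoryTheory Opposite Limits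
open scoped Pointwise

variable {R : Type} [CommRing R] {M : Type} [AddCommGroup M] [Module R M]

/-- The saturation of a submodule with respect to an ideal. -/
def sat (J : Ideal R) (V : Submodule R M) : Submodule R M where
  carrier := {c | ∃ n, ∀ a ∈ J ^ n, a • c ∈ V}
  zero_mem' := ⟨0, fun a _ => by simp⟩
  add_mem' := by
    rintro x y ⟨n, hn⟩ ⟨m, hm⟩
    refine ⟨max n m, fun a ha => ?_⟩
    rw [smul_add]
    exact add_mem (hn a (Ideal.pow_le_pow_right (le_max_left _ _) ha))
      (hm a (Ideal.pow_le_pow_right (le_max_right _ _) ha))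
  smul_mem' := by
    rintro r x ⟨n, hn⟩
    exact ⟨n, fun a ha => by rw [smul_comm]; exact V.smul_mem _ (hn a ha)⟩

variable {J : Ideal R} {V W : Submodule R M} {x : R}

theorem mem_sat {c : M} : c ∈ sat J V ↔ ∃ n, ∀ a ∈ J ^ n, a • c ∈ V := Iff.rfl

theorem le_sat : V ≤ sat J V := fun _ hc => ⟨0, fun a _ => V.smul_mem a hc⟩

theorem mem_sup_smul_top {u : M} : u ∈ V ⊔ x • ⊤ ↔ ∃ m, u - x • m ∈ V := by
  rw [Submodule.mem_sup]
  constructor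
  · rintro ⟨v, hv, _, ⟨m, -, rfl⟩, rfl⟩
    exact ⟨m, by simpa using hv⟩
  · rintro ⟨m, hm⟩
    exact ⟨_, hm, x • m, ⟨m, trivial, rfl⟩, by simp⟩

variable (J) in
/-- Local cohomology of the quotient of `M` by the submodule `V`. -/
noncomputable abbrev lcQuot (i : ℕ) (V : Submodule R M) : ModuleCat.{0} R :=
  (localCohomology J i).obj (ModuleCat.of R (M ⧸ V))

variable (J) in
/-- The map on local cohomology induced by the projection `M ⧸ V → M ⧸ W`. -/
noncomputable def lcFactor (i : ℕ) (h : V ≤ W) : lcQuot J i V →ₗ[R] lcQuot J i W :=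
  ((localCohomology J i).map (ModuleCat.ofHom (Submodule.factor h))).hom

theorem lcFactor_comp {U : Submodule R M} (i : ℕ) (h : U ≤ V) (h' : V ≤ W) (u : lcQuot J i U) :
    lcFactor J i h' (lcFactor J i h u) = lcFactor J i (h.trans h') u := by
  have e : ModuleCat.ofHom (Submodule.factor (h.trans h'))
      = ModuleCat.ofHom (Submodule.factor h) ≫ ModuleCat.ofHom (Submodule.factor h') := by
    ext u
    rfl
  unfold lcFactor
  rw [e, Functor.map_comp]
  rfl

theorem lcFactor_sat_bijective [IsNoetherianRing R] (i : ℕ) :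
    Function.Bijective (lcFactor J (i + 1) (le_sat (J := J) (V := V))) := by
  let p : M ⧸ V →ₗ[R] M ⧸ sat J V := Submodule.factor le_sat
  let K : ModuleCat.{0} R := ModuleCat.of R (LinearMap.ker p)
  let ι : K ⟶ ModuleCat.of R (M ⧸ V) := ModuleCat.ofHom (Submodule.subtype _)
  have hι : Function.Injective ι := Subtype.val_injective
  have hp : Function.Surjective (ModuleCat.ofHom p) := Submodule.factor_surjective le_sat
  have hz : ι ≫ ModuleCat.ofHom p = 0 := by
    ext u
    exact u.2
  have hex : ∀ b, ModuleCat.ofHom p b = 0 → ∃ a, ι a = b := fun b hb => ⟨⟨b, hb⟩, rfl⟩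
  have hK : ∀ t : K, ∃ n, ∀ a ∈ J ^ n, a • t = 0 := by
    rintro ⟨t, ht⟩
    obtain ⟨u, rfl⟩ := Submodule.mkQ_surjective _ t
    obtain ⟨n, hn⟩ : u ∈ sat J V := (Submodule.Quotient.mk_eq_zero _).1 ht
    exact ⟨n, fun a ha => Subtype.ext ((Submodule.Quotient.mk_eq_zero _).2 (hn a ha))⟩
  constructor
  · refine (injective_iff_map_eq_zero _).2 fun u hu => ?_
    obtain ⟨v, rfl⟩ := (localCohomology_exact_mid hι hp hz hex (i + 1) u).1 hu
    rw [localCohomology_torsion_eq_zero i K hK v, map_zero]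
  · intro w
    obtain ⟨δ, h1, -⟩ := exists_connecting (J := J) hι hp hz hex (i + 1)
    exact (h1 w).1 (localCohomology_torsion_eq_zero (i + 1) K hK _)

theorem smul_id_injective (hx : ∀ u : M, x • u ∈ V → u ∈ V) :
    Function.Injective (x • 𝟙 (ModuleCat.of R (M ⧸ V))) := by
  refine (injective_iff_map_eq_zero (x • 𝟙 (ModuleCat.of R (M ⧸ V))).hom).2 fun u hu => ?_
  obtain ⟨u, rfl⟩ := Submodule.mkQ_surjective _ u
  exact (Submodule.Quotient.mk_eq_zero _).2 (hx u ((Submodule.Quotient.mk_eq_zero V).1 hu))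

theorem smul_id_factor : (x • 𝟙 (ModuleCat.of R (M ⧸ V))) ≫
    ModuleCat.ofHom (Submodule.factor (le_sup_left : V ≤ V ⊔ x • ⊤)) = 0 := by
  ext u
  exact (Submodule.Quotient.mk_eq_zero _).2 (mem_sup_smul_top.2 ⟨u, by simp⟩)

theorem exists_smul_id_of_factor (b : M ⧸ V)
    (hb : Submodule.factor (le_sup_left : V ≤ V ⊔ x • ⊤) b = 0) :
    ∃ a, (x • 𝟙 (ModuleCat.of R (M ⧸ V))) a = b := by
  obtain ⟨u, rfl⟩ := Submodule.mkQ_surjective _ b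
  obtain ⟨m, hm⟩ := mem_sup_smul_top.1 ((Submodule.Quotient.mk_eq_zero _).1 hb)
  exact ⟨Submodule.Quotient.mk m, ((Submodule.Quotient.eq V).2 hm).symm⟩

theorem exists_lcQuot_connecting [IsNoetherianRing R] (hx : ∀ u : M, x • u ∈ V → u ∈ V) (i : ℕ) :
    ∃ δ : lcQuot J (i + 1) (sat J (V ⊔ x • ⊤)) →ₗ[R] lcQuot J (i + 2) V,
      (∀ w, x • w = 0 ↔ ∃ u, δ u = w) ∧
      (∀ u, δ u = 0 ↔ ∃ v, lcFactor J (i + 1) (le_sup_left.trans le_sat) v = u) := by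
  obtain ⟨δ, h1, h2⟩ := exists_connecting (J := J) (smul_id_injective hx)
    (Submodule.factor_surjective (le_sup_left : V ≤ V ⊔ x • ⊤)) smul_id_factor
    exists_smul_id_of_factor (i + 1)
  let e := LinearEquiv.ofBijective _ (lcFactor_sat_bijective (J := J) (V := V ⊔ x • ⊤) i)
  refine ⟨δ ∘ₗ e.symm.toLinearMap, fun w => ?_, fun u => ?_⟩
  · rw [← localCohomology_map_smul, h2]
    exact ⟨fun ⟨u, hu⟩ => ⟨e u, by simpa using hu⟩, fun ⟨u, hu⟩ => ⟨e.symm u, hu⟩⟩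
  · refine (h1 _).trans (exists_congr fun v => ?_)
    rw [← lcFactor_comp (i + 1) le_sup_left le_sat]
    exact e.eq_symm_apply

theorem lcFactor_eq_zero_iff [IsNoetherianRing R] (hx : ∀ u : M, x • u ∈ V → u ∈ V) (i : ℕ)
    (v : lcQuot J (i + 1) V) :
    lcFactor J (i + 1) (le_sup_left.trans le_sat : V ≤ sat J (V ⊔ x • ⊤)) v = 0 ↔
      ∃ w, x • w = v := by
  rw [← lcFactor_comp (i + 1) le_sup_left le_sat,
    map_eq_zero_iff _ (lcFactor_sat_bijective (J := J) (V := V ⊔ x • ⊤) i).1]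
  refine (localCohomology_exact_mid (smul_id_injective hx)
    (Submodule.factor_surjective (le_sup_left : V ≤ V ⊔ x • ⊤)) smul_id_factor
    exists_smul_id_of_factor (i + 1) v).trans (exists_congr fun w => ?_)
  rw [localCohomology_map_smul]

theorem exists_sat_connecting (hx : ∀ u : M, x • u ∈ V → u ∈ V) (hV : sat J V = V) :
    ∃ φ : sat J (V ⊔ x • ⊤) →ₗ[R] lcQuot J 1 V,
      (∀ u, φ u = 0 ↔ (u : M) ∈ V ⊔ x • ⊤) ∧ (∀ w, x • w = 0 ↔ ∃ u, φ u = w) := by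
  obtain ⟨δ, h1, h2⟩ := exists_connecting (J := J) (smul_id_injective hx)
    (Submodule.factor_surjective (le_sup_left : V ≤ V ⊔ x • ⊤)) smul_id_factor
    exists_smul_id_of_factor 0
  have hδ : ∀ w, δ w = 0 → w = 0 := by
    intro w hw
    obtain ⟨u, rfl⟩ := (h1 w).1 hw
    have hu : u = 0 := by
      refine lcZeroEval_injective _ ?_
      rw [map_zero]
      obtain ⟨n, hn⟩ := (mem_range_lcZeroEval_iff (lcZeroEval (J := J) _ u)).1 ⟨u, rfl⟩
      obtain ⟨c, hc⟩ := Submodule.mkQ_surjective V (lcZeroEval (J := J) _ u)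
      rw [← hc] at hn ⊢
      refine (Submodule.Quotient.mk_eq_zero V).2 (hV.le ⟨n, fun a ha => ?_⟩)
      exact (Submodule.Quotient.mk_eq_zero V).1 (hn a ha)
    rw [hu, map_zero]
  let C := M ⧸ V ⊔ x • (⊤ : Submodule R M)
  let ev := lcZeroEval (J := J) (ModuleCat.of R C)
  let e := LinearEquiv.ofInjective ev (lcZeroEval_injective _)
  let q : sat J (V ⊔ x • ⊤) →ₗ[R] LinearMap.range ev :=
    ((Submodule.mkQ (V ⊔ x • ⊤)) ∘ₗ (Submodule.subtype _)).codRestrict _ (by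
      rintro ⟨u, n, hn⟩
      exact (mem_range_lcZeroEval_iff _).2
        ⟨n, fun a ha => (Submodule.Quotient.mk_eq_zero _).2 (hn a ha)⟩)
  have hq : Function.Surjective q := by
    rintro ⟨c, hc⟩
    obtain ⟨n, hn⟩ := (mem_range_lcZeroEval_iff _).1 hc
    obtain ⟨u, rfl⟩ := Submodule.mkQ_surjective _ c
    exact ⟨⟨u, n, fun a ha => (Submodule.Quotient.mk_eq_zero _).1 (hn a ha)⟩, rfl⟩
  refine ⟨δ ∘ₗ e.symm.toLinearMap ∘ₗ q, fun u => ?_, fun w => ?_⟩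
  · trans q u = 0
    · refine ⟨fun h => ?_, fun h => by simp [h]⟩
      simpa using hδ _ h
    · rw [← Submodule.Quotient.mk_eq_zero]
      exact Subtype.ext_iff
  · rw [← localCohomology_map_smul, h2]
    refine ⟨fun ⟨u, hu⟩ => ?_, fun ⟨u, hu⟩ => ⟨_, hu⟩⟩
    obtain ⟨v, hv⟩ := hq (e u)
    exact ⟨v, by simpa [hv] using hu⟩

end Saturation

section CosetAvoidance

open scoped Pointwise

variable {R : Type} [CommRing R]

/-- Prime avoidance for cosets of an ideal. -/
theorem exists_add_notMem_primes {S : Set (Ideal R)} (hS : S.Finite) (hprime : ∀ P ∈ S, P.IsPrime)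
    (y : R) (I : Ideal R) (h : ∀ P ∈ S, ¬ Ideal.span {y} ⊔ I ≤ P) :
    ∃ a ∈ I, ∀ P ∈ S, y + a ∉ P := by
  classical
  obtain ⟨T, hT⟩ : ∃ T : Finset (Ideal R), ∀ P, P ∈ T ↔ Maximal (· ∈ S) P :=
    ⟨(hS.subset fun P (hP : Maximal (· ∈ S) P) => hP.1).toFinset, fun P =>
      Set.Finite.mem_toFinset _⟩
  obtain ⟨K, hKI, hKP, hK⟩ : ∃ K : Ideal R, K ≤ I ∧ (∀ P ∈ T, y ∉ P → K ≤ P) ∧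
      ∀ P ∈ T, y ∈ P → ¬ K ≤ P := by
    refine ⟨I * ∏ P ∈ T with y ∉ P, P, Ideal.mul_le_left, fun P hP hy => ?_, fun P hP hy hle => ?_⟩
    · exact Ideal.mul_le_right.trans (Ideal.prod_le_inf.trans
        (Finset.inf_le (f := fun P => P) (Finset.mem_filter.2 ⟨hP, hy⟩)))
    · have hPS := (hT P).1 hP
      have := hprime P hPS.1
      rcases this.mul_le.1 hle with hI | hprod
      · exact h P hPS.1 (sup_le ((Ideal.span_singleton_le_iff_mem P).2 hy) hI)
      · obtain ⟨P', hP', hle'⟩ := (Ideal.IsPrime.prod_le this).1 hprod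
        obtain ⟨hP', hy'⟩ := Finset.mem_filter.1 hP'
        exact hy' (((hT P').1 hP').2 hPS.1 hle' hy)
  have hKT : ¬ ((K : Set R) ⊆ ⋃ P ∈ ((T.filter (y ∈ ·) : Finset (Ideal R)) : Set (Ideal R)),
      (P : Set R)) := by
    intro hsub
    obtain ⟨P, hP, hle⟩ := (Ideal.subset_union_prime (f := fun P : Ideal R => P) ⊥ ⊥
      fun P hP _ _ => hprime P ((hT P).1 (Finset.mem_filter.1 hP).1).1).1 hsub
    exact hK P (Finset.mem_filter.1 hP).1 (Finset.mem_filter.1 hP).2 hle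
  obtain ⟨a, haK, ha⟩ := Set.not_subset.1 hKT
  refine ⟨a, hKI haK, fun P hP hmem => ?_⟩
  obtain ⟨P', hle, hP'⟩ := hS.exists_le_maximal hP
  by_cases hy : y ∈ P'
  · exact ha (Set.mem_biUnion (Finset.mem_coe.2 (Finset.mem_filter.2 ⟨(hT P').2 hP', hy⟩))
      ((Ideal.add_mem_iff_right _ hy).1 (hle hmem)))
  · exact hy ((Ideal.add_mem_iff_left _ (hKP P' ((hT P').2 hP') hy haK)).1 (hle hmem))

variable [IsLocalRing R]

theorem IsFiniteLength.exists_pow_maximalIdeal_smul {N : Type*} [AddCommGroup N] [Module R N]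
    (h : IsFiniteLength R N) : ∃ c, ∀ a ∈ maximalIdeal R ^ c, ∀ w : N, a • w = 0 := by
  induction h with
  | of_subsingleton => exact ⟨0, fun a _ w => Subsingleton.elim _ _⟩
  | @of_simple_quotient N _ _ W _ _ ih =>
    obtain ⟨c, hc⟩ := ih
    have hmax : Module.annihilator R (N ⧸ W) = maximalIdeal R :=
      eq_maximalIdeal (IsSimpleModule.annihilator_isMaximal (R := R) (M := N ⧸ W))
    refine ⟨c + 1, fun a ha w => ?_⟩
    rw [pow_succ] at ha
    induction ha using Submodule.mul_induction_on' with
    | mem_mul_mem a ha b hb =>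
      rw [mul_smul]
      have hb' : b • w ∈ W := by
        rw [← hmax, Module.mem_annihilator] at hb
        exact (Submodule.Quotient.mk_eq_zero W).1 (hb (Submodule.Quotient.mk w))
      exact congrArg Subtype.val (hc a ha ⟨_, hb'⟩)
    | add a _ b _ h1 h2 => rw [add_smul, h1, h2, add_zero]

theorem isFiniteLength_of_pow_maximalIdeal_smul [IsNoetherianRing R] (c : ℕ) :
    ∀ {N : Type} [AddCommGroup N] [Module R N] [Module.Finite R N],
      (∀ a ∈ maximalIdeal R ^ c, ∀ w : N, a • w = 0) → IsFiniteLength R N := by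
  intro N _ _ _ h
  rw [isFiniteLength_iff_isNoetherian_isArtinian]
  refine ⟨inferInstance, ?_⟩
  set I := maximalIdeal R ^ c with hI
  by_cases htop : I = ⊤
  · have : Subsingleton N := subsingleton_of_forall_eq 0 fun w => by
      simpa using h 1 (htop ▸ Submodule.mem_top) w
    infer_instance
  have : Nontrivial (R ⧸ I) := Ideal.Quotient.nontrivial_iff.mpr htop
  have := IsLocalRing.of_surjective' (Ideal.Quotient.mk I) Ideal.Quotient.mk_surjective
  have : IsArtinianRing (R ⧸ I) := by
    rw [isArtinianRing_iff_isNilpotent_maximalIdeal]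
    refine ⟨c, le_bot_iff.1 ?_⟩
    have hle : maximalIdeal (R ⧸ I) ≤ (maximalIdeal R).map (Ideal.Quotient.mk I) := by
      rw [← Ideal.map_comap_of_surjective _ Ideal.Quotient.mk_surjective (maximalIdeal (R ⧸ I))]
      exact Ideal.map_mono (le_maximalIdeal (Ideal.comap_ne_top _ (maximalIdeal.isMaximal _).ne_top))
    refine (Ideal.pow_right_mono hle c).trans ?_
    rw [← Ideal.map_pow, ← hI, Ideal.map_quotient_self]
  have ht : Module.IsTorsionBySet R N I := fun w a => h a a.2 w
  let _ : Module (R ⧸ I) N := ht.module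
  have : IsScalarTower R (R ⧸ I) N := ht.isScalarTower
  have : Module.Finite (R ⧸ I) N := Module.Finite.of_restrictScalars_finite R (R ⧸ I) N
  have : IsArtinian (R ⧸ I) N := inferInstance
  exact isArtinian_of_surjective_algebraMap (R := R ⧸ I) Ideal.Quotient.mk_surjective


variable {M : Type} [AddCommGroup M] [Module R M] {V W : Submodule R M}

local notation "𝔪" => maximalIdeal R

omit [IsLocalRing R] in
theorem mem_annihilator_quotient {a : R} :
    a ∈ Module.annihilator R (M ⧸ V) ↔ ∀ u : M, a • u ∈ V := by
  rw [Module.mem_annihilator]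
  refine ⟨fun h u => (Submodule.Quotient.mk_eq_zero V).1 (h (Submodule.Quotient.mk u)), ?_⟩
  rintro h ⟨u⟩
  exact (Submodule.Quotient.mk_eq_zero V).2 (h u)

omit [IsLocalRing R] in
theorem annihilator_quotient_mono (h : V ≤ W) :
    Module.annihilator R (M ⧸ V) ≤ Module.annihilator R (M ⧸ W) := fun _ ha =>
  mem_annihilator_quotient.2 fun u => h (mem_annihilator_quotient.1 ha u)

omit [IsLocalRing R] in
theorem sat_mono {J : Ideal R} (h : V ≤ W) : sat J V ≤ sat J W := fun _ ⟨n, hn⟩ =>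
  ⟨n, fun a ha => h (hn a ha)⟩

omit [IsLocalRing R] in
theorem exists_pow_smul_sat_le [IsNoetherianRing R] [Module.Finite R M] (J : Ideal R)
    (V : Submodule R M) : ∃ n, ∀ a ∈ J ^ n, ∀ u ∈ sat J V, a • u ∈ V := by
  obtain ⟨s, hs⟩ : (sat J V).FG := IsNoetherian.noetherian _
  have hsub : ∀ u : M, ∃ n, u ∈ s → ∀ a ∈ J ^ n, a • u ∈ V := fun u => by
    by_cases hu : u ∈ s
    · obtain ⟨n, hn⟩ : u ∈ sat J V := hs ▸ Submodule.subset_span hu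
      exact ⟨n, fun _ => hn⟩
    · exact ⟨0, fun h => absurd h hu⟩
  choose n hn using hsub
  refine ⟨s.sup n, fun a ha u hu => ?_⟩
  rw [← hs] at hu
  induction hu using Submodule.span_induction with
  | mem u hu => exact hn u hu a (Ideal.pow_le_pow_right (Finset.le_sup hu) ha)
  | zero => simp
  | add u v _ _ h1 h2 => rw [smul_add]; exact add_mem h1 h2
  | smul r u _ h => rw [smul_comm]; exact V.smul_mem _ h

omit [IsLocalRing R] in
theorem sat_sat [IsNoetherianRing R] [Module.Finite R M] (J : Ideal R) (V : Submodule R M) :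
    sat J (sat J V) = sat J V := by
  refine le_antisymm (fun u ⟨n, hn⟩ => ?_) le_sat
  obtain ⟨k, hk⟩ := exists_pow_smul_sat_le J V
  refine ⟨k + n, fun a ha => ?_⟩
  rw [pow_add] at ha
  induction ha using Submodule.mul_induction_on' with
  | mem_mul_mem a ha b hb => rw [mul_smul]; exact hk a ha _ (hn b hb)
  | add a _ b _ h1 h2 => rw [add_smul]; exact add_mem h1 h2

theorem exists_isRegular_coset [IsNoetherianRing R] [Module.Finite R M] (hV : sat 𝔪 V = V)
    (y : R) (I : Ideal R) {k : ℕ} (hk : 𝔪 ^ k ≤ Ideal.span {y} ⊔ I) :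
    ∃ a ∈ I, ∀ u : M, (y + a) • u ∈ V → u ∈ V := by
  obtain ⟨a, ha, h⟩ := exists_add_notMem_primes (associatedPrimes.finite R (M ⧸ V))
    (fun P hP => IsAssociatedPrime.isPrime hP) y I (by
      intro P hP hle
      obtain ⟨hprime, c, hc⟩ := isAssociatedPrime_iff.1 hP
      have hmP : 𝔪 ≤ P := Ideal.IsPrime.le_of_pow_le (hk.trans hle)
      obtain ⟨u, rfl⟩ := Submodule.mkQ_surjective _ c
      have hu : u ∈ V := by
        rw [← hV]
        refine ⟨1, fun b hb => ?_⟩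
        rw [pow_one] at hb
        have := hmP hb
        rw [hc, Submodule.mem_colon_singleton] at this
        exact (Submodule.Quotient.mk_eq_zero V).1 this
      refine hprime.ne_top ((Ideal.eq_top_iff_one _).2 ?_)
      rw [hc, Submodule.mem_colon_singleton]
      simpa using hu)
  refine ⟨a, ha, fun u hu => ?_⟩
  have hreg : y + a ∉ ⋃ p ∈ associatedPrimes R (M ⧸ V), (p : Set R) := by
    simpa using h
  rw [biUnion_associatedPrimes_eq_compl_regular] at hreg
  have hreg : IsSMulRegular (M ⧸ V) (y + a) := by simpa using hreg
  exact (Submodule.Quotient.mk_eq_zero V).1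
    (hreg.right_eq_zero_of_smul ((Submodule.Quotient.mk_eq_zero V).2 hu))

theorem mem_of_forall_mem_sup_pow_smul [IsNoetherianRing R] [Module.Finite R M] {z : R}
    (hz : z ∈ 𝔪) {u : M} (hu : ∀ n ≥ 1, u ∈ V ⊔ z ^ n • ⊤) : u ∈ V := by
  have h := Ideal.iInf_pow_smul_eq_bot_of_isLocalRing (M := M ⧸ V) 𝔪
    (maximalIdeal.isMaximal R).ne_top
  refine (Submodule.Quotient.mk_eq_zero V).1 ((Submodule.mem_bot R).1 (h ▸ ?_))
  refine (Submodule.mem_iInf _).2 fun n => ?_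
  obtain ⟨m, hm⟩ := mem_sup_smul_top.1 (hu (n + 1) (by omega))
  rw [(Submodule.Quotient.eq V).2 hm, Submodule.Quotient.mk_smul, pow_succ, mul_smul]
  exact Submodule.smul_mem_smul (Ideal.pow_mem_pow hz n) trivial

end CosetAvoidance

section ParamSetup

open scoped Pointwise

variable {R : Type} [CommRing R]

section Length
variable {A B C : Type*} [AddCommGroup A] [Module R A] [AddCommGroup B] [Module R B]
  [AddCommGroup C] [Module R C]

theorem length_eq_range_add_ker (f : A →ₗ[R] B) :
    Module.length R A =
      Module.length R (LinearMap.range f) + Module.length R (LinearMap.ker f) := by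
  rw [add_comm]
  refine Module.length_eq_add_of_exact (LinearMap.ker f).subtype f.rangeRestrict
    (Submodule.subtype_injective _) f.surjective_rangeRestrict ?_
  rw [LinearMap.exact_iff, LinearMap.ker_rangeRestrict, Submodule.range_subtype]

theorem length_range_lsmul_eq_zero_iff (x : R) :
    Module.length R (LinearMap.range (LinearMap.lsmul R A x)) = 0 ↔ ∀ w : A, x • w = 0 := by
  rw [Module.length_eq_zero_iff, Submodule.subsingleton_iff_eq_bot, LinearMap.range_eq_bot]
  exact LinearMap.ext_iff

theorem length_add_length_of_exact_smul (x : R) (f : A →ₗ[R] B) (δ : B →ₗ[R] C)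
    (h1 : ∀ a, f a = 0 ↔ ∃ w, x • w = a) (h2 : ∀ b, δ b = 0 ↔ ∃ a, f a = b)
    (h3 : ∀ c, x • c = 0 ↔ ∃ b, δ b = c) :
    Module.length R A + Module.length R C = Module.length R B +
      (Module.length R (LinearMap.range (LinearMap.lsmul R A x)) +
        Module.length R (LinearMap.range (LinearMap.lsmul R C x))) := by
  have e1 : LinearMap.ker f = LinearMap.range (LinearMap.lsmul R A x) := by
    ext a; exact h1 a
  have e2 : LinearMap.ker δ = LinearMap.range f := by ext a; exact h2 a
  have e3 : LinearMap.ker (LinearMap.lsmul R C x) = LinearMap.range δ := by ext a; exact h3 a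
  rw [length_eq_range_add_ker f, length_eq_range_add_ker δ,
    length_eq_range_add_ker (LinearMap.lsmul R C x), e1, e2, e3]
  ac_rfl

theorem isFiniteLength_of_exact (f : A →ₗ[R] B) (g : B →ₗ[R] C)
    (h : ∀ b, g b = 0 → ∃ a, f a = b) (hA : IsFiniteLength R A) (hC : IsFiniteLength R C) :
    IsFiniteLength R B := by
  rw [← Module.length_ne_top_iff, length_eq_range_add_ker g]
  rw [← Module.length_ne_top_iff] at hA hC
  refine WithTop.add_ne_top.2 ⟨ne_top_of_le_ne_top hC
    (Module.length_le_of_injective _ (Submodule.subtype_injective _)), ne_top_of_le_ne_top hA ?_⟩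
  refine (Module.length_le_of_injective (Submodule.inclusion (show
    LinearMap.ker g ≤ LinearMap.range f from fun b hb => h b hb)) (Submodule.inclusion_injective _)).trans ?_
  exact Module.length_le_of_surjective _ f.surjective_rangeRestrict

end Length

variable [IsLocalRing R] [IsNoetherianRing R] {M : Type} [AddCommGroup M] [Module R M]
  [Module.Finite R M] {V W : Submodule R M} {x : R} {l l' : List R}

local notation "𝔪" => maximalIdeal R

omit [Module.Finite R M] in
theorem isFiniteLength_lcQuot_sat {i : ℕ} (hx : ∀ u : M, x • u ∈ V → u ∈ V)
    (h1 : IsFiniteLength R (lcQuot 𝔪 (i + 1) V)) (h2 : IsFiniteLength R (lcQuot 𝔪 (i + 2) V)) :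
    IsFiniteLength R (lcQuot 𝔪 (i + 1) (sat 𝔪 (V ⊔ x • ⊤))) := by
  obtain ⟨δ, -, hδ⟩ := exists_lcQuot_connecting (J := 𝔪) hx i
  exact isFiniteLength_of_exact _ δ (fun b => (hδ b).1) h1 h2

theorem colon_le_of_isFiniteLength (s : ℕ) : ∀ (V : Submodule R M) (ys : List R) (I : Ideal R)
    (k : ℕ), ys.length = s → sat 𝔪 V = V → (∀ y ∈ ys, y ∈ 𝔪) → 𝔪 ^ k ≤ I ⊔ Ideal.ofList ys →
    (∀ i < s, IsFiniteLength R (lcQuot 𝔪 (i + 1) V)) →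
    ∀ u : M, (∀ a ∈ I, a • u ∈ V) → u ∈ V := by
  induction s with
  | zero =>
    intro V ys I k hl hV _ hk _ u hu
    obtain rfl := List.length_eq_zero_iff.1 hl
    rw [← hV]
    exact ⟨k, fun a ha => hu a (by simpa using hk ha)⟩
  | succ s ih =>
    rintro V ys I k hl hV hys hk hfl u hu
    by_cases hI : I = ⊤
    · simpa using hu 1 (hI ▸ Submodule.mem_top)
    obtain _ | ⟨y, ys⟩ := ys
    · simp at hl
    obtain ⟨a, ha, hz⟩ := exists_isRegular_coset hV y (I ⊔ Ideal.ofList ys) (k := k) (by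
      rw [Ideal.ofList_cons] at hk
      exact hk.trans (by rw [sup_left_comm]))
    set z := y + a with hzdef
    have hIm : I ≤ 𝔪 := le_maximalIdeal hI
    have hysm : Ideal.ofList ys ≤ 𝔪 :=
      Ideal.span_le.2 fun b hb => hys b (List.mem_cons_of_mem _ hb)
    have hzm : z ∈ 𝔪 := add_mem (hys y List.mem_cons_self) (sup_le hIm hysm ha)
    have hzn (n : ℕ) : ∀ u : M, z ^ n • u ∈ V → u ∈ V := by
      induction n with
      | zero => intro u; simp
      | succ n ih =>
        intro u h
        rw [pow_succ, mul_smul] at h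
        exact hz u (ih _ h)
    have hy : y ∈ Ideal.span {z} ⊔ (I ⊔ Ideal.ofList ys) := by
      rw [show y = z - a by rw [hzdef]; ring]
      exact sub_mem (Ideal.mem_sup_left (Ideal.mem_span_singleton_self z)) (Ideal.mem_sup_right ha)
    have hk' : 𝔪 ^ k ≤ Ideal.span {z} ⊔ (I ⊔ Ideal.ofList ys) := by
      refine hk.trans (sup_le (le_sup_left.trans le_sup_right) ?_)
      rw [Ideal.ofList_cons]
      exact sup_le ((Ideal.span_singleton_le_iff_mem _).2 hy) (le_sup_right.trans le_sup_right)
    have hmem (n : ℕ) (hn : 1 ≤ n) : u ∈ sat 𝔪 (V ⊔ z ^ n • ⊤) := by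
      refine ih (sat 𝔪 (V ⊔ z ^ n • ⊤)) ys (I ⊔ Ideal.span {z ^ n}) (k * (n + 1)) (by simpa using hl)
        (sat_sat _ _) (fun b hb => hys b (List.mem_cons_of_mem _ hb)) ?_ (fun i hi =>
          isFiniteLength_lcQuot_sat (hzn n) (hfl i (by omega)) (hfl (i + 1) (by omega))) u ?_
      · rw [pow_mul]
        refine (Ideal.pow_right_mono hk' _).trans ?_
        refine Ideal.sup_pow_add_le_pow_sup_pow.trans (sup_le ?_ ?_)
        · rw [Ideal.span_singleton_pow]
          exact le_sup_right.trans le_sup_left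
        · rw [pow_one]
          exact sup_le_sup_right le_sup_left _
      · intro b hb
        obtain ⟨c, hc, d, hd, rfl⟩ := Submodule.mem_sup.1 hb
        obtain ⟨e, rfl⟩ := Ideal.mem_span_singleton'.1 hd
        rw [add_smul]
        refine le_sat (add_mem (Submodule.mem_sup_left (hu c hc)) ?_)
        exact mem_sup_smul_top.2 ⟨e • u, by simp [mul_smul, smul_comm e]⟩
    obtain ⟨c, hc⟩ := (hfl 0 (by omega)).exists_pow_maximalIdeal_smul
    rw [← hV]
    refine ⟨c, fun b hb => mem_of_forall_mem_sup_pow_smul hzm fun n hn => ?_⟩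
    obtain ⟨φ, hφ, -⟩ := exists_sat_connecting (hzn n) hV
    exact (hφ (b • ⟨u, hmem n hn⟩)).1 (by rw [map_smul, hc b hb])

/-- `V` is a saturated submodule such that `M ⧸ V` has finite length local cohomology modules
below the length of `l`, and `l` is a list of elements generating an ideal of definition
for `M ⧸ V`. -/
structure ParamSetup (V : Submodule R M) (l : List R) : Prop where
  sat_eq : sat 𝔪 V = V
  mem : ∀ x ∈ l, x ∈ 𝔪
  pow_le : ∃ k, 𝔪 ^ k ≤ Ideal.ofList l ⊔ Module.annihilator R (M ⧸ V)
  isFiniteLength : ∀ i, i + 1 < l.length → IsFiniteLength R (lcQuot 𝔪 (i + 1) V)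

omit [IsLocalRing R] [IsNoetherianRing R] in
theorem Ideal.ofList_perm (h : l.Perm l') : Ideal.ofList l = Ideal.ofList l' := by
  unfold Ideal.ofList
  congr 1
  ext
  exact h.mem_iff

namespace ParamSetup

omit [IsNoetherianRing R] [Module.Finite R M] in
theorem perm (h : ParamSetup V l) (hl : l.Perm l') : ParamSetup V l' where
  sat_eq := h.sat_eq
  mem x hx := h.mem x (hl.mem_iff.2 hx)
  pow_le := Ideal.ofList_perm hl ▸ h.pow_le
  isFiniteLength i hi := h.isFiniteLength i (hl.length_eq ▸ hi)

theorem regular_head (h : ParamSetup V (x :: l)) (u : M) (hu : x • u ∈ V) : u ∈ V := by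
  obtain ⟨k, hk⟩ := h.pow_le
  refine colon_le_of_isFiniteLength l.length V l
    (Ideal.span {x} ⊔ Module.annihilator R (M ⧸ V)) k rfl h.sat_eq
    (fun y hy => h.mem y (List.mem_cons_of_mem _ hy)) ?_
    (fun i hi => h.isFiniteLength i (by simpa using hi)) u ?_
  · rw [Ideal.ofList_cons] at hk
    exact hk.trans (by rw [sup_right_comm])
  · intro a ha
    obtain ⟨c, hc, d, hd, rfl⟩ := Submodule.mem_sup.1 ha
    obtain ⟨e, rfl⟩ := Ideal.mem_span_singleton'.1 hc
    rw [add_smul, mul_smul]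
    exact add_mem (V.smul_mem _ hu) (mem_annihilator_quotient.1 hd u)

theorem regular (h : ParamSetup V l) (hx : x ∈ l) (u : M) (hu : x • u ∈ V) : u ∈ V := by
  classical
  exact (h.perm (List.perm_cons_erase hx)).regular_head u hu

theorem step (h : ParamSetup V (x :: l)) : ParamSetup (sat 𝔪 (V ⊔ x • ⊤)) l where
  sat_eq := sat_sat _ _
  mem y hy := h.mem y (List.mem_cons_of_mem _ hy)
  pow_le := by
    obtain ⟨k, hk⟩ := h.pow_le
    rw [Ideal.ofList_cons] at hk
    refine ⟨k, hk.trans (sup_le (sup_le ?_ le_sup_left) ?_)⟩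
    · refine le_sup_of_le_right ((Ideal.span_singleton_le_iff_mem _).2 ?_)
      exact mem_annihilator_quotient.2 fun u => le_sat (mem_sup_smul_top.2 ⟨u, by simp⟩)
    · exact le_sup_of_le_right (annihilator_quotient_mono (le_sup_left.trans le_sat))
  isFiniteLength i hi := isFiniteLength_lcQuot_sat h.regular_head
    (h.isFiniteLength i (by simp; omega)) (h.isFiniteLength (i + 1) (by simpa using hi))

omit [IsNoetherianRing R] [Module.Finite R M] in
theorem pow_head (h : ParamSetup V (x :: l)) {n : ℕ} (hn : 1 ≤ n) : ParamSetup V (x ^ n :: l) where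
  sat_eq := h.sat_eq
  mem y hy := by
    rcases List.mem_cons.1 hy with rfl | hy
    · exact Ideal.pow_mem_of_mem _ (h.mem x List.mem_cons_self) n hn
    · exact h.mem y (List.mem_cons_of_mem _ hy)
  pow_le := by
    obtain ⟨k, hk⟩ := h.pow_le
    rw [Ideal.ofList_cons, sup_assoc] at hk
    refine ⟨k * (n + 1), ?_⟩
    rw [pow_mul]
    refine (Ideal.pow_right_mono hk _).trans (Ideal.sup_pow_add_le_pow_sup_pow.trans ?_)
    rw [Ideal.span_singleton_pow, pow_one, Ideal.ofList_cons, sup_assoc]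
  isFiniteLength i hi := h.isFiniteLength i hi

end ParamSetup

end ParamSetup

section Colength

open scoped Pointwise

variable {R : Type} [CommRing R] {M : Type} [AddCommGroup M] [Module R M] {U V W : Submodule R M}
  {x : R}

variable (U) in
/-- The length of the quotient by a submodule, as a natural number. -/
noncomputable def qlen : ℕ := (Module.length R (M ⧸ U)).toNat

variable (U) in
/-- The quotient by a submodule has finite length. -/
def FiniteColength : Prop := Module.length R (M ⧸ U) ≠ ⊤

theorem FiniteColength.coe_qlen (h : FiniteColength U) : (qlen U : ℕ∞) = Module.length R (M ⧸ U) :=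
  ENat.natCast_toNat h

theorem length_quotient_eq (h : U ≤ W) : Module.length R (M ⧸ U) =
    Module.length R (W.map U.mkQ) + Module.length R (M ⧸ W) := by
  rw [← (Submodule.quotientQuotientEquivQuotient U W h).length_eq]
  exact Module.length_eq_add_of_exact _ _ (Submodule.subtype_injective _)
    (Submodule.mkQ_surjective _) (LinearMap.exact_subtype_mkQ _)

theorem FiniteColength.mono (hU : FiniteColength U) (h : U ≤ W) : FiniteColength W :=
  ne_top_of_le_ne_top hU (by rw [length_quotient_eq h]; exact le_add_self)

theorem FiniteColength.qlen_eq (hU : FiniteColength U) (h : U ≤ W) :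
    (qlen U : ℕ∞) = Module.length R (W.map U.mkQ) + qlen W := by
  rw [hU.coe_qlen, (hU.mono h).coe_qlen, length_quotient_eq h]

theorem FiniteColength.qlen_le (hU : FiniteColength U) (h : U ≤ W) : qlen W ≤ qlen U := by
  have := hU.qlen_eq h
  exact_mod_cast this.symm ▸ le_add_self

theorem map_mkQ_sup_left (U G : Submodule R M) : (U ⊔ G).map U.mkQ = G.map U.mkQ := by
  rw [Submodule.map_sup, Submodule.mkQ_map_self, bot_sup_eq]

theorem qlen_add_qlen_le_of_smul {A A' G : Submodule R M} {y : R} (hA : FiniteColength A)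
    (hA' : FiniteColength A') (h : y • A' ≤ A) :
    qlen A + qlen (A' ⊔ G) ≤ qlen A' + qlen (A ⊔ y • G) := by
  have h1 := hA.qlen_eq (le_sup_left : A ≤ A ⊔ y • G)
  have h2 := hA'.qlen_eq (le_sup_left : A' ≤ A' ⊔ G)
  have h3 : Module.length R ((A ⊔ y • G).map A.mkQ) ≤ Module.length R ((A' ⊔ G).map A'.mkQ) := by
    rw [map_mkQ_sup_left, map_mkQ_sup_left]
    let f : M ⧸ A' →ₗ[R] M ⧸ A := A'.mapQ A (LinearMap.lsmul R M y)
      fun u hu => h (Submodule.smul_mem_pointwise_smul u y A' hu)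
    have e : (y • G).map A.mkQ = (G.map A'.mkQ).map f := by
      ext u
      constructor
      · rintro ⟨_, ⟨g, hg, rfl⟩, rfl⟩
        exact ⟨_, ⟨g, hg, rfl⟩, rfl⟩
      · rintro ⟨_, ⟨g, hg, rfl⟩, rfl⟩
        exact ⟨_, ⟨g, hg, rfl⟩, rfl⟩
    rw [e]
    exact Module.length_le_of_surjective _ (f.submoduleMap_surjective _)
  generalize Module.length R ((A ⊔ y • G).map A.mkQ) = a at *
  generalize Module.length R ((A' ⊔ G).map A'.mkQ) = b at *
  induction b using ENat.recTopCoe with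
  | top => simp at h2
  | coe b =>
    induction a using ENat.recTopCoe with
    | top => simp at h1
    | coe a => norm_cast at *; omega

theorem FiniteColength.qlen_eq_comap_add (hU : FiniteColength U) :
    qlen U = qlen (U.comap (LinearMap.lsmul R M x)) + qlen (U ⊔ x • ⊤) := by
  have h1 := hU.qlen_eq (le_sup_left : U ≤ U ⊔ x • ⊤)
  have h2 : U ≤ U.comap (LinearMap.lsmul R M x) := fun u hu => U.smul_mem x hu
  rw [map_mkQ_sup_left] at h1
  let f : M →ₗ[R] M ⧸ U := U.mkQ ∘ₗ LinearMap.lsmul R M x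
  have e1 : LinearMap.ker f = U.comap (LinearMap.lsmul R M x) := by
    rw [LinearMap.ker_comp, Submodule.ker_mkQ]
  have e2 : LinearMap.range f = (x • ⊤ : Submodule R M).map U.mkQ := by
    rw [LinearMap.range_comp, LinearMap.range_eq_map]
    rfl
  rw [← e2, ← f.quotKerEquivRange.length_eq, e1, ← (hU.mono h2).coe_qlen] at h1
  exact_mod_cast h1

theorem FiniteColength.qlen_sup_le {C : Type*} [AddCommGroup C] [Module R C] {N : Submodule R M}
    (hU : FiniteColength (U ⊔ N)) (h : U ≤ W) (φ : W →ₗ[R] C) (hφ : ∀ u, φ u = 0 ↔ (u : M) ∈ U)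
    {t : ℕ} (ht : Module.length R (LinearMap.range φ) = t) :
    qlen (U ⊔ N) ≤ qlen (W ⊔ N) + t ∧
      (W ⊓ (U ⊔ N) ≤ U → qlen (U ⊔ N) = qlen (W ⊔ N) + t) := by
  have h1 := hU.qlen_eq (sup_le_sup_right h N)
  let f : W →ₗ[R] M ⧸ (U ⊔ N) := (U ⊔ N).mkQ ∘ₗ W.subtype
  have e : LinearMap.range f = (W ⊔ N).map (U ⊔ N).mkQ := by
    rw [LinearMap.range_comp, Submodule.range_subtype, Submodule.map_sup]
    refine (sup_eq_left.2 ?_).symm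
    rintro _ ⟨n, hn, rfl⟩
    rw [Submodule.mkQ_apply, (Submodule.Quotient.mk_eq_zero _).2 (Submodule.mem_sup_right hn)]
    exact zero_mem _
  have hle : LinearMap.ker φ ≤ LinearMap.ker f := fun u hu =>
    (Submodule.Quotient.mk_eq_zero _).2 (Submodule.mem_sup_left ((hφ u).1 hu))
  rw [← φ.quotKerEquivRange.length_eq] at ht
  rw [← e, ← f.quotKerEquivRange.length_eq] at h1
  constructor
  · have h2 : Module.length R (W ⧸ LinearMap.ker f) ≤ Module.length R (W ⧸ LinearMap.ker φ) :=
      Module.length_le_of_surjective _ (Submodule.factor_surjective hle)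
    rw [ht] at h2
    have h3 : (qlen (U ⊔ N) : ℕ∞) ≤ t + qlen (W ⊔ N) := by
      rw [h1]; gcongr
    norm_cast at h3
    omega
  · intro hinf
    have : LinearMap.ker f = LinearMap.ker φ := le_antisymm (fun u hu =>
      (hφ u).2 (hinf ⟨u.2, (Submodule.Quotient.mk_eq_zero _).1 hu⟩)) hle
    rw [this, ht] at h1
    norm_cast at h1
    omega

end Colength

section HilbertFunction

open scoped Pointwise

variable {R : Type} [CommRing R] {M : Type} [AddCommGroup M] [Module R M]
  {V : Submodule R M} {x y : R} {l : List R}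

/-- The Hilbert–Samuel function of `M ⧸ V` with respect to the ideal generated by `l`. -/
noncomputable def hilb (l : List R) (V : Submodule R M) (n : ℕ) : ℕ :=
  qlen (V ⊔ Ideal.ofList l ^ (n + 1) • ⊤)

theorem sup_pow_smul_top_eq (hx : ∀ u : M, x • u ∈ V) (I : Ideal R) (n : ℕ) :
    V ⊔ (Ideal.span {x} ⊔ I) ^ n • ⊤ = V ⊔ I ^ n • ⊤ := by
  refine le_antisymm (sup_le le_sup_left ?_)
    (sup_le_sup_left (Submodule.smul_mono_left (Ideal.pow_right_mono le_sup_right n)) _)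
  cases n with
  | zero => simp
  | succ n =>
    have h : (Ideal.span {x} ⊔ I) ^ (n + 1) ≤ Ideal.span {x} ⊔ I ^ (n + 1) := by
      induction n with
      | zero => simp
      | succ n ih =>
        rw [pow_succ, pow_succ I (n + 1)]
        refine Ideal.mul_le.2 fun a ha b hb => ?_
        obtain ⟨c, hc, d, hd, rfl⟩ := Submodule.mem_sup.1 (ih ha)
        obtain ⟨e, he, f, hf, rfl⟩ := Submodule.mem_sup.1 hb
        rw [show (c + d) * (e + f) = ((e + f) * c + d * e) + d * f by ring]
        exact Submodule.add_mem_sup (add_mem (Ideal.mul_mem_left _ _ hc)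
          (Ideal.mul_mem_left _ _ he)) (Ideal.mul_mem_mul hd hf)
    refine (Submodule.smul_mono_left h).trans ?_
    rw [Submodule.sup_smul]
    refine sup_le_sup_right (Submodule.smul_le.2 fun a ha u _ => ?_) _
    obtain ⟨b, rfl⟩ := Ideal.mem_span_singleton'.1 ha
    rw [mul_smul]
    exact V.smul_mem _ (hx u)

theorem smul_pow_smul_top_le {I : Ideal R} (hx : x ∈ I) (n : ℕ) :
    x • (I ^ n • ⊤ : Submodule R M) ≤ I ^ (n + 1) • ⊤ := by
  rw [pow_succ', Submodule.mul_smul, ← Submodule.ideal_span_singleton_smul]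
  exact Submodule.smul_mono_left ((Ideal.span_singleton_le_iff_mem I).2 hx)

variable [IsLocalRing R] [IsNoetherianRing R] [Module.Finite R M]

local notation "𝔪" => maximalIdeal R

/-- Multiplication by `x` is zero on the `i`-th local cohomology of `M ⧸ V`. -/
def Kills (x : R) (i : ℕ) (V : Submodule R M) : Prop := ∀ w : lcQuot 𝔪 i V, x • w = 0

/-- The length of the `i`-th local cohomology of `M ⧸ V`. -/
noncomputable def hlen (i : ℕ) (V : Submodule R M) : ℕ := (Module.length R (lcQuot 𝔪 i V)).toNat

theorem ParamSetup.finiteColength (h : ParamSetup V l) (n : ℕ) :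
    FiniteColength (V ⊔ Ideal.ofList l ^ n • ⊤) := by
  obtain ⟨k, hk⟩ := h.pow_le
  refine Module.length_ne_top_iff.2 (isFiniteLength_of_pow_maximalIdeal_smul (k * (n + 1)) ?_)
  rintro a ha ⟨u⟩
  refine (Submodule.Quotient.mk_eq_zero _).2 ?_
  rw [pow_mul] at ha
  obtain ⟨b, hb, c, hc, rfl⟩ := Submodule.mem_sup.1
    (Ideal.sup_pow_add_le_pow_sup_pow (Ideal.pow_right_mono hk _ ha))
  rw [pow_one] at hc
  change (b + c) • u ∈ _
  rw [add_smul, add_comm]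
  exact Submodule.add_mem_sup (mem_annihilator_quotient.1 hc u) (Submodule.smul_mem_smul hb trivial)

omit [IsNoetherianRing R] [Module.Finite R M] in
theorem hilb_cons_sat : hilb (x :: l) (sat 𝔪 (V ⊔ x • ⊤)) = hilb l (sat 𝔪 (V ⊔ x • ⊤)) := by
  ext n
  unfold hilb
  rw [Ideal.ofList_cons, sup_pow_smul_top_eq]
  exact fun u => le_sat (mem_sup_smul_top.2 ⟨u, by simp⟩)

omit [IsLocalRing R] [IsNoetherianRing R] [Module.Finite R M] in
theorem sup_smul_top_sup_pow (I : Ideal R) (n : ℕ) :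
    (V ⊔ I ^ (n + 1) • ⊤) ⊔ x • ⊤ = (V ⊔ x • ⊤) ⊔ I ^ (n + 1) • ⊤ := sup_right_comm _ _ _

omit [IsLocalRing R] [IsNoetherianRing R] [Module.Finite R M] in
theorem le_comap_smul {I : Ideal R} (hx : x ∈ I) (n : ℕ) :
    V ⊔ I ^ n • ⊤ ≤ (V ⊔ I ^ (n + 1) • ⊤).comap (LinearMap.lsmul R M x) := by
  refine sup_le (fun u hu => Submodule.mem_sup_left (V.smul_mem x hu)) fun u hu => ?_
  exact Submodule.mem_sup_right (smul_pow_smul_top_le hx n (Submodule.smul_mem_pointwise_smul u x _ hu))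

omit [IsLocalRing R] [IsNoetherianRing R] in
theorem mem_ofList_head : x ∈ Ideal.ofList (x :: l) := by
  rw [Ideal.ofList_cons]
  exact Ideal.mem_sup_left (Ideal.mem_span_singleton_self x)

theorem ParamSetup.hilb_eq (h : ParamSetup V (x :: l)) (n : ℕ) : hilb (x :: l) V n =
    qlen ((V ⊔ Ideal.ofList (x :: l) ^ (n + 1) • ⊤).comap (LinearMap.lsmul R M x)) +
      qlen ((V ⊔ x • ⊤) ⊔ Ideal.ofList (x :: l) ^ (n + 1) • ⊤) := by
  unfold hilb
  rw [(h.finiteColength (n + 1)).qlen_eq_comap_add (x := x), sup_smul_top_sup_pow]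

theorem ParamSetup.finiteColength_sup (h : ParamSetup V (x :: l)) (n : ℕ) :
    FiniteColength ((V ⊔ x • ⊤) ⊔ Ideal.ofList (x :: l) ^ (n + 1) • ⊤) :=
  (h.finiteColength (n + 1)).mono (sup_le_sup_right le_sup_left _)

theorem ParamSetup.hlen_one (h : ParamSetup V (x :: y :: l)) :
    ∃ t : ℕ, t ≤ hlen 1 V ∧ (t = hlen 1 V ↔ Kills x 1 V) ∧
      ∃ φ : sat 𝔪 (V ⊔ x • ⊤) →ₗ[R] lcQuot 𝔪 1 V, (∀ u, φ u = 0 ↔ (u : M) ∈ V ⊔ x • ⊤) ∧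
        Module.length R (LinearMap.range φ) = t := by
  obtain ⟨φ, h1, h2⟩ := exists_sat_connecting (J := 𝔪) h.regular_head h.sat_eq
  have hfl := Module.length_ne_top_iff.2 (h.isFiniteLength 0 (by simp))
  have e : LinearMap.ker (LinearMap.lsmul R (lcQuot 𝔪 1 V) x) = LinearMap.range φ := by
    ext w; exact h2 w
  have e2 := length_eq_range_add_ker (LinearMap.lsmul R (lcQuot 𝔪 1 V) x)
  have e3 := length_range_lsmul_eq_zero_iff (A := lcQuot 𝔪 1 V) x
  have e4 : (hlen 1 V : ℕ∞) = Module.length R (lcQuot 𝔪 1 V) := ENat.natCast_toNat hfl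
  rw [e, ← e4] at e2
  generalize hb : Module.length R (LinearMap.range φ) = b at *
  generalize Module.length R (LinearMap.range (LinearMap.lsmul R (lcQuot 𝔪 1 V) x)) = a at *
  induction b using ENat.recTopCoe with
  | top => simp at e2
  | coe b =>
    induction a using ENat.recTopCoe with
    | top => simp at e2
    | coe a =>
      norm_cast at e2 e3
      refine ⟨b, by omega, ?_, φ, h1, hb⟩
      unfold Kills
      rw [← e3]
      omega

theorem ParamSetup.exists_hilb_step (h : ParamSetup V (x :: y :: l)) :
    ∃ t ≤ hlen 1 V, (t = hlen 1 V ↔ Kills x 1 V) ∧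
      hilb (x :: y :: l) V 0 ≤ hilb (y :: l) (sat 𝔪 (V ⊔ x • ⊤)) 0 + t ∧
      (∀ n, hilb (x :: y :: l) V (n + 1) ≤ hilb (x :: y :: l) V n +
        hilb (y :: l) (sat 𝔪 (V ⊔ x • ⊤)) (n + 1) + t) ∧
      ((∀ n, sat 𝔪 (V ⊔ x • ⊤) ⊓ (V ⊔ Ideal.ofList (x :: y :: l) ^ (n + 1) • ⊤) ≤
          V ⊔ x • Ideal.ofList (x :: y :: l) ^ n • ⊤) →
        hilb (x :: y :: l) V 0 = hilb (y :: l) (sat 𝔪 (V ⊔ x • ⊤)) 0 + t ∧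
        ∀ n, hilb (x :: y :: l) V (n + 1) = hilb (x :: y :: l) V n +
          hilb (y :: l) (sat 𝔪 (V ⊔ x • ⊤)) (n + 1) + t) := by
  obtain ⟨t, ht, hk, φ, hφ, hlen⟩ := h.hlen_one
  refine ⟨t, ht, hk, ?_⟩
  set Q := Ideal.ofList (x :: y :: l) with hQ
  rw [← hilb_cons_sat]
  have key (n) := (h.finiteColength_sup n).qlen_sup_le le_sat φ hφ hlen
  have hcol (n) := (h.finiteColength n).qlen_le (le_comap_smul (V := V) (mem_ofList_head) n)
  have hzero : qlen ((V ⊔ Q ^ (0 + 1) • ⊤).comap (LinearMap.lsmul R M x)) = 0 := by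
    have e : (V ⊔ Q ^ (0 + 1) • ⊤).comap (LinearMap.lsmul R M x) = ⊤ := by
      refine top_le_iff.1 (le_trans ?_ (le_comap_smul mem_ofList_head 0))
      simp
    unfold qlen
    rw [e]
    simp
  refine ⟨?_, fun n => ?_, fun hcap => ?_⟩
  · rw [h.hilb_eq, hzero, zero_add]
    exact (key 0).1
  · have h1 := h.hilb_eq (n + 1)
    have h2 := hcol (n + 1)
    have h3 := (key (n + 1)).1
    unfold hilb at h1 ⊢
    omega
  · have hcap2 (n : ℕ) : sat 𝔪 (V ⊔ x • ⊤) ⊓ ((V ⊔ x • ⊤) ⊔ Q ^ (n + 1) • ⊤) ≤ V ⊔ x • ⊤ := by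
      rintro u ⟨hu, hu'⟩
      obtain ⟨a, ha, b, hb, rfl⟩ := Submodule.mem_sup.1 hu'
      have hle : x • (Q ^ n • ⊤ : Submodule R M) ≤ x • ⊤ := Submodule.map_mono le_top
      refine add_mem ha (sup_le_sup_left hle V (hcap n ⟨?_, Submodule.mem_sup_right hb⟩))
      simpa using sub_mem hu (le_sat ha)
    refine ⟨?_, fun n => ?_⟩
    · rw [h.hilb_eq, hzero, zero_add]
      exact (key 0).2 (hcap2 0)
    · have h1 := h.hilb_eq (n + 1)
      have h3 := (key (n + 1)).2 (hcap2 (n + 1))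
      suffices h4 : (V ⊔ Q ^ (n + 1 + 1) • ⊤).comap (LinearMap.lsmul R M x) =
          V ⊔ Q ^ (n + 1) • ⊤ by
        rw [← hQ, h4] at h1
        unfold hilb at h1 ⊢
        rw [← hQ] at h1 h3 ⊢
        omega
      refine le_antisymm (fun u hu => ?_) (le_comap_smul mem_ofList_head _)
      have hxu : x • u ∈ V ⊔ x • Q ^ (n + 1) • ⊤ :=
        hcap (n + 1) ⟨le_sat (mem_sup_smul_top.2 ⟨u, by simp⟩), hu⟩
      obtain ⟨v, hv, _, ⟨w, hw, rfl⟩, hvw⟩ := Submodule.mem_sup.1 hxu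
      have : u - w ∈ V := by
        refine h.regular_head _ ?_
        rw [smul_sub, ← hvw]
        simpa using hv
      rw [← sub_add_cancel u w]
      exact Submodule.add_mem_sup this hw

end HilbertFunction

section BinomialGrowth

open Filter


/-- The binomial polynomial function `n ↦ C(n + j, j)`. -/
def binom (j n : ℕ) : ℤ := (n + j).choose j

@[simp] theorem binom_zero (n : ℕ) : binom 0 n = 1 := by simp [binom]

@[simp] theorem binom_zero_right (j : ℕ) : binom j 0 = 1 := by simp [binom]

theorem binom_one (n : ℕ) : binom 1 n = n + 1 := by simp [binom]

theorem binom_succ_succ (j n : ℕ) : binom (j + 1) (n + 1) = binom (j + 1) n + binom j (n + 1) := by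
  unfold binom
  rw [show n + 1 + (j + 1) = n + 1 + j + 1 by ring, Nat.choose_succ_succ,
    show n + (j + 1) = n + 1 + j by ring]
  push_cast
  ring

theorem binom_pos (j n : ℕ) : 0 < binom j n := by
  unfold binom
  exact_mod_cast Nat.choose_pos (Nat.le_add_left j n)

theorem binom_le_succ (j n : ℕ) : binom j n ≤ binom (j + 1) n := by
  cases n with
  | zero => simp
  | succ n => rw [binom_succ_succ]; linarith [binom_pos (j + 1) n]

theorem binom_mono {j k : ℕ} (h : j ≤ k) (n : ℕ) : binom j n ≤ binom k n :=
  monotone_nat_of_le_succ (f := fun j => binom j n) (fun j => binom_le_succ j n) h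

theorem lt_binom_succ (j n : ℕ) : (n : ℤ) < binom (j + 1) n := by
  have := binom_mono (show 1 ≤ j + 1 by omega) n
  rw [binom_one] at this
  linarith

theorem succ_mul_binom_succ (j n : ℕ) : (j + 1 : ℤ) * binom (j + 1) n =
    (n + j + 1) * binom j n := by
  have := Nat.add_one_mul_choose_eq (n + j) j
  unfold binom
  rw [show n + (j + 1) = n + j + 1 by ring]
  have h2 : ((n + j + 1) * (n + j).choose j : ℤ) = ((n + j + 1).choose (j + 1)) * (j + 1) := by
    exact_mod_cast this
  linarith

/-- `f` is bounded above by a multiple of `binom j`. -/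
def Dom (f : ℕ → ℤ) (j : ℕ) : Prop := ∃ C : ℤ, ∀ n, f n ≤ C * binom j n

/-- `f` is infinitely often bounded above by a fixed multiple of `binom j`. -/
def FreqDom (f : ℕ → ℤ) (j : ℕ) : Prop := ∃ C : ℤ, ∃ᶠ n in atTop, f n ≤ C * binom j n

variable {f g : ℕ → ℤ} {j k : ℕ}

theorem Dom.add (hf : Dom f j) (hg : Dom g j) : Dom (fun n => f n + g n) j := by
  obtain ⟨C, hC⟩ := hf
  obtain ⟨D, hD⟩ := hg
  exact ⟨C + D, fun n => by linarith [hC n, hD n]⟩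

theorem Dom.of_le (hg : Dom g j) (h : ∀ n, f n ≤ g n) : Dom f j := by
  obtain ⟨C, hC⟩ := hg
  exact ⟨C, fun n => (h n).trans (hC n)⟩

theorem dom_mul_binom (C : ℤ) (h : j ≤ k) : Dom (fun n => C * binom j n) k := by
  refine ⟨|C|, fun n => ?_⟩
  have h1 := binom_mono h n
  have h2 := binom_pos j n
  nlinarith [le_abs_self C, abs_nonneg C]

theorem Dom.mono (hf : Dom f j) (h : j ≤ k) : Dom f k := by
  obtain ⟨C, hC⟩ := hf
  exact (dom_mul_binom C h).of_le hC

theorem Dom.freqDom (hf : Dom f j) : FreqDom f j := by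
  obtain ⟨C, hC⟩ := hf
  exact ⟨C, Frequently.of_forall hC⟩

theorem FreqDom.add (hf : FreqDom f j) (hg : Dom g j) : FreqDom (fun n => f n + g n) j := by
  obtain ⟨C, hC⟩ := hf
  obtain ⟨D, hD⟩ := hg
  exact ⟨C + D, hC.mono fun n hn => by linarith [hn, hD n]⟩

theorem FreqDom.congr (hf : FreqDom f j) (h : ∀ n, g n ≤ f n) : FreqDom g j := by
  obtain ⟨C, hC⟩ := hf
  exact ⟨C, hC.mono fun n hn => (h n).trans hn⟩

theorem FreqDom.nonpos {d : ℤ} (h : FreqDom (fun n => d * binom (j + 1) n) j) : d ≤ 0 := by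
  obtain ⟨C, hC⟩ := h
  by_contra! hd
  obtain ⟨n, hn, hle⟩ := frequently_atTop.1 hC (C.toNat * (j + 1))
  have h1 := succ_mul_binom_succ j n
  have h2 := binom_pos j n
  have h3 : (C : ℤ) ≤ C.toNat := Int.self_le_toNat C
  have h4 : ((C.toNat * (j + 1) : ℕ) : ℤ) ≤ n := by exact_mod_cast hn
  push_cast at h4
  have h5 : d * ((n + j + 1) * binom j n) ≤ (j + 1) * C * binom j n := by
    rw [← h1]
    nlinarith
  have h6 : d * (n + j + 1) ≤ (j + 1) * C := by
    by_contra! h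
    nlinarith
  nlinarith

theorem Dom.of_sub_le (h : ∀ n, f (n + 1) ≤ f n + g (n + 1)) (hg : Dom g j) : Dom f (j + 1) := by
  obtain ⟨C, hC⟩ := hg
  refine (((dom_mul_binom C le_rfl).add (dom_mul_binom (f 0 - C) (Nat.zero_le _)))).of_le
    fun n => ?_
  induction n with
  | zero => simp
  | succ n ih =>
    simp only [binom_zero, binom_succ_succ] at ih ⊢
    linarith [h n, hC (n + 1)]

theorem binom_monotone (j : ℕ) : Monotone (binom j) := by
  refine monotone_nat_of_le_succ fun n => ?_
  cases j with
  | zero => simp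
  | succ j => rw [binom_succ_succ]; linarith [binom_pos j (n + 1)]

theorem Dom.pred (hf : Dom f j) : Dom (fun n => f (n - 1)) j := by
  obtain ⟨C, hC⟩ := hf
  refine ⟨|C|, fun n => (hC _).trans ?_⟩
  have h1 := binom_monotone j (Nat.sub_le n 1)
  have h2 := binom_pos j (n - 1)
  nlinarith [le_abs_self C, abs_nonneg C]

theorem Dom.of_eventually (h : ∃ C N, ∀ n, N ≤ n → f n ≤ C * binom j n) : Dom f j := by
  obtain ⟨C, N, hC⟩ := h
  refine ⟨|C| + ∑ i ∈ Finset.range N, |f i|, fun n => ?_⟩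
  have h1 := binom_pos j n
  have h2 : 0 ≤ ∑ i ∈ Finset.range N, |f i| := Finset.sum_nonneg fun _ _ => abs_nonneg _
  by_cases hn : N ≤ n
  · nlinarith [hC n hn, le_abs_self C]
  · have h3 := Finset.single_le_sum (f := fun i => |f i|) (fun _ _ => abs_nonneg _)
      (Finset.mem_range.2 (not_le.1 hn))
    have h4 := le_abs_self (f n)
    nlinarith [abs_nonneg C]

theorem FreqDom.of_sub_le (h : ∀ n, f (n + 1) ≥ f n + g (n + 1)) (hf : FreqDom f (j + 1)) :
    FreqDom g j := by
  obtain ⟨C, hC⟩ := hf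
  by_contra hcon
  unfold FreqDom at hcon
  push Not at hcon
  obtain ⟨N, hN⟩ := eventually_atTop.1 (hcon (C + 1))
  have key (n : ℕ) (hn : N ≤ n) :
      f N - (C + 1) * binom (j + 1) N ≤ f n - (C + 1) * binom (j + 1) n := by
    induction n, hn using Nat.le_induction with
    | base => exact le_rfl
    | succ n hn ih =>
      rw [binom_succ_succ]
      linarith [h n, hN (n + 1) (by omega)]
  obtain ⟨n, hn, hle⟩ := frequently_atTop.1 hC
    (max N ((C + 1) * binom (j + 1) N - f N).toNat)
  have h1 := key n (by omega)
  have h2 := lt_binom_succ j n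
  have h3 : (C + 1) * binom (j + 1) N - f N ≤ n := by omega
  linarith

/-- `f` is asymptotically `E * binom (j + 1)`, up to a multiple of `binom j`. -/
def Lead (f : ℕ → ℤ) (j : ℕ) (E : ℤ) : Prop :=
  Dom (fun n => f n - E * binom (j + 1) n) j ∧ Dom (fun n => E * binom (j + 1) n - f n) j

theorem Lead.unique {E E' : ℤ} (h : Lead f j E) (h' : Lead f j E') : E = E' := by
  refine le_antisymm ?_ ?_
  · have := (h.2.add h'.1).freqDom.congr (g := fun n => (E - E') * binom (j + 1) n)
      fun n => by linarith
    linarith [this.nonpos]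
  · have := (h'.2.add h.1).freqDom.congr (g := fun n => (E' - E) * binom (j + 1) n)
      fun n => by linarith
    linarith [this.nonpos]

end BinomialGrowth

section ArtinRees

open scoped Pointwise

variable {R : Type} [CommRing R] {M : Type} [AddCommGroup M] [Module R M]
  {V : Submodule R M} {x y : R} {l : List R}

theorem ofList_cons_pow_succ_le (n : ℕ) : Ideal.ofList (y :: l) ^ (n + 1) ≤
    Ideal.ofList l ^ (n + 1) ⊔ Ideal.span {y} * Ideal.ofList (y :: l) ^ n := by
  induction n with
  | zero => simp [Ideal.ofList_cons, sup_comm]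
  | succ n ih =>
    rw [pow_succ]
    refine Ideal.mul_le.2 fun a ha b hb => ?_
    obtain ⟨c, hc, d, hd, rfl⟩ := Submodule.mem_sup.1 (ih ha)
    have hb' := hb
    rw [Ideal.ofList_cons] at hb'
    obtain ⟨e, he, f, hf, rfl⟩ := Submodule.mem_sup.1 hb'
    rw [show (c + d) * (e + f) = c * f + (e * c + d * (e + f)) by ring]
    refine Submodule.add_mem_sup (Ideal.mul_mem_mul hc hf) (add_mem ?_ ?_)
    · refine Ideal.mul_mem_mul he ?_
      exact Ideal.pow_right_mono (Ideal.ofList_cons y l ▸ le_sup_right) _ hc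
    · rw [pow_succ, ← mul_assoc]
      exact Ideal.mul_mem_mul hd hb

theorem qlen_le_qlen_sup_pow_smul (l : List R) (G : Submodule R M) (A : ℕ → Submodule R M)
    (hA : ∀ n, FiniteColength (A n)) (hl : ∀ y ∈ l, ∀ n, y • A n ≤ A (n + 1))
    (n : ℕ) : qlen (A n) ≤ qlen (A n ⊔ Ideal.ofList l ^ n • G) +
      qlen (A 0) * l.length.multichoose n := by
  induction l generalizing n with
  | nil =>
    cases n with
    | zero => simp
    | succ n => simp [pow_succ]
  | cons y l ihl =>
    induction n with
    | zero => simp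
    | succ n ih =>
      have h1 := ihl (fun z hz => hl z (List.mem_cons_of_mem _ hz)) (n + 1)
      set N := Ideal.ofList (y :: l) ^ n • G
      set K := Ideal.ofList l ^ (n + 1) • G
      have h2 := qlen_add_qlen_le_of_smul (G := N) (hA (n + 1)) (hA n) (hl y List.mem_cons_self n)
      have h3 := qlen_add_qlen_le_of_smul (A := A (n + 1) ⊔ K) (G := y • N) (y := (1 : R))
        ((hA (n + 1)).mono le_sup_left) (hA (n + 1)) (by rw [one_smul]; exact le_sup_left)
      rw [one_smul] at h3
      have h4 : qlen (A (n + 1) ⊔ K ⊔ y • N) ≤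
          qlen (A (n + 1) ⊔ Ideal.ofList (y :: l) ^ (n + 1) • G) := by
        refine ((hA (n + 1)).mono le_sup_left).qlen_le ?_
        rw [sup_assoc]
        refine sup_le_sup_left ?_ _
        refine (Submodule.smul_mono_left (ofList_cons_pow_succ_le n)).trans ?_
        rw [Submodule.sup_smul, Submodule.mul_smul, Submodule.ideal_span_singleton_smul]
      rw [List.length_cons] at ih ⊢
      rw [Nat.multichoose_succ_succ]
      nlinarith

variable [IsLocalRing R] [IsNoetherianRing R] [Module.Finite R M]

local notation "𝔪" => maximalIdeal R

omit [IsLocalRing R] in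
theorem exists_comap_le_pow_smul (hx : ∀ u : M, x • u ∈ V → u ∈ V) (I : Ideal R) :
    ∃ k, 1 ≤ k ∧ ∀ m, (V ⊔ I ^ (k + m) • ⊤).comap (LinearMap.lsmul R M x) ≤
      V ⊔ I ^ m • (V ⊔ I ^ k • ⊤).comap (LinearMap.lsmul R M x) := by
  obtain ⟨k₀, hk₀⟩ := I.exists_pow_inf_eq_pow_smul ((x • ⊤ : Submodule R M).map V.mkQ)
  obtain ⟨k, hk1, hk⟩ : ∃ k, 1 ≤ k ∧ ∀ m, I ^ (k + m) • ⊤ ⊓ (x • ⊤ : Submodule R M).map V.mkQ =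
      I ^ m • (I ^ k • ⊤ ⊓ (x • ⊤ : Submodule R M).map V.mkQ) := by
    refine ⟨k₀ + 1, by omega, fun m => ?_⟩
    rw [hk₀ _ (by omega), hk₀ (k₀ + 1) (by omega), ← Submodule.mul_smul, ← pow_add]
    congr 2
    omega
  refine ⟨k, hk1, fun m u hu => ?_⟩
  set F := (V ⊔ I ^ k • ⊤).comap (LinearMap.lsmul R M x) with hF
  have hmap (n : ℕ) (v : M) : V.mkQ v ∈ I ^ n • (⊤ : Submodule R (M ⧸ V)) ↔ v ∈ V ⊔ I ^ n • ⊤ := by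
    rw [← Submodule.range_mkQ V, LinearMap.range_eq_map, ← Submodule.map_smul'',
      ← Submodule.mem_comap, Submodule.comap_map_eq, Submodule.ker_mkQ, sup_comm]
  have h1 : V.mkQ (x • u) ∈ I ^ (k + m) • ⊤ ⊓ (x • ⊤ : Submodule R M).map V.mkQ :=
    ⟨(hmap _ _).2 hu, _, Submodule.smul_mem_pointwise_smul u x ⊤ trivial, rfl⟩
  rw [hk m] at h1
  have h2 : I ^ k • ⊤ ⊓ (x • ⊤ : Submodule R M).map V.mkQ ≤
      F.map (V.mkQ ∘ₗ LinearMap.lsmul R M x) := by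
    rintro _ ⟨hv, _, ⟨v, -, rfl⟩, rfl⟩
    exact ⟨v, (hmap _ _).1 hv, rfl⟩
  have h3 := Submodule.smul_mono le_rfl h2 h1
  rw [← Submodule.map_smul''] at h3
  obtain ⟨w, hw, hwu⟩ := h3
  have h4 : u - w ∈ V := by
    refine hx _ ((Submodule.Quotient.mk_eq_zero V).1 ?_)
    rw [smul_sub]
    change V.mkQ (x • u - x • w) = 0
    rw [map_sub, ← hwu]
    exact sub_self _
  rw [← sub_add_cancel u w]
  exact Submodule.add_mem_sup h4 hw

theorem ParamSetup.dom_hilb_step (h : ParamSetup V (x :: l)) : Dom (fun n =>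
    (hilb l (sat 𝔪 (V ⊔ x • ⊤)) (n + 1) + hilb (x :: l) V n - hilb (x :: l) V (n + 1) : ℤ))
    (l.length - 1) := by
  set Q := Ideal.ofList (x :: l) with hQ
  obtain ⟨k, hk1, hk⟩ := exists_comap_le_pow_smul h.regular_head Q
  have hQle : Antitone fun m => V ⊔ Q ^ m • ⊤ := fun a b hab =>
    sup_le_sup_left (Submodule.smul_mono_left (Ideal.pow_le_pow_right hab)) _
  have hV (n) : hilb l (sat 𝔪 (V ⊔ x • ⊤)) n ≤ qlen ((V ⊔ x • ⊤) ⊔ Q ^ (n + 1) • ⊤) := by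
    rw [← hilb_cons_sat]
    exact (h.finiteColength_sup n).qlen_le (sup_le_sup_right le_sat _)
  refine ⟨qlen (V ⊔ Q ^ k • ⊤), fun n => ?_⟩
  have h0 := h.hilb_eq (n + 1)
  have h1 := hV (n + 1)
  rw [← hQ] at h0
  have hB := binom_pos (l.length - 1) n
  by_cases hn : n + 1 < k
  · have h2 : hilb (x :: l) V n ≤ qlen (V ⊔ Q ^ k • ⊤) := (h.finiteColength k).qlen_le (hQle hn.le)
    have h3 : (hilb l (sat 𝔪 (V ⊔ x • ⊤)) (n + 1) : ℤ) ≤ hilb (x :: l) V (n + 1) := by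
      norm_cast; omega
    have h4 : (hilb (x :: l) V n : ℤ) ≤ qlen (V ⊔ Q ^ k • ⊤) := by exact_mod_cast h2
    nlinarith
  · obtain ⟨m, hm⟩ := Nat.exists_eq_add_of_le (not_lt.1 hn)
    set F := (V ⊔ Q ^ k • ⊤).comap (LinearMap.lsmul R M x) with hF
    have hlQ (y : R) (hy : y ∈ l) : y ∈ Q := Ideal.subset_span (List.mem_cons_of_mem _ hy)
    have h2 := qlen_le_qlen_sup_pow_smul l F (fun m => V ⊔ Q ^ (k + m) • ⊤)
      (fun m => h.finiteColength _)
      (fun y hy m => Submodule.map_le_iff_le_comap.2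
        (le_comap_smul (hlQ y hy) (k + m))) m
    have h3 : (V ⊔ Q ^ (n + 1 + 1) • ⊤).comap (LinearMap.lsmul R M x) ≤
        V ⊔ Q ^ (k + m) • ⊤ ⊔ Ideal.ofList l ^ m • F := by
      rw [hm, add_assoc]
      refine (hk (m + 1)).trans (sup_le (le_sup_left.trans le_sup_left) ?_)
      refine (Submodule.smul_mono_left (ofList_cons_pow_succ_le m)).trans ?_
      rw [Submodule.sup_smul, ← hQ, mul_comm, Submodule.mul_smul, Submodule.ideal_span_singleton_smul]
      refine sup_le ((Submodule.smul_mono_left (Ideal.pow_le_pow_right (Nat.le_succ m))).trans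
        le_sup_right) ?_
      have hxF : x • F ≤ V ⊔ Q ^ k • ⊤ := Submodule.map_le_iff_le_comap.2 le_rfl
      refine ((Submodule.smul_mono le_rfl hxF).trans ?_).trans le_sup_left
      rw [Submodule.smul_sup, ← Submodule.mul_smul, ← pow_add, add_comm m k]
      exact sup_le_sup_right Submodule.smul_le_right _
    have h4 := ((h.finiteColength (n + 1 + 1)).mono
      (fun u hu => Submodule.smul_mem _ x hu)).qlen_le h3
    have h5 : (l.length.multichoose m : ℤ) ≤ binom (l.length - 1) n := by
      cases hl : l.length with
      | zero =>
        cases m <;> simp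
      | succ s =>
        rw [Nat.multichoose_eq, Nat.add_sub_cancel, Nat.add_right_comm, Nat.add_sub_cancel, binom,
          ← Nat.choose_symm_add, add_comm s m]
        exact_mod_cast Nat.choose_mono _ (by omega)
    have h6 : hilb (x :: l) V n = qlen (V ⊔ Q ^ (k + m) • ⊤) := by rw [← hm]; rfl
    have h7 : hilb l (sat 𝔪 (V ⊔ x • ⊤)) (n + 1) + hilb (x :: l) V n ≤
        hilb (x :: l) V (n + 1) + qlen (V ⊔ Q ^ k • ⊤) * l.length.multichoose m := by
      simp only [add_zero] at h2
      omega
    zify at h7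
    nlinarith

end ArtinRees

section FirstCoefficient

open scoped Pointwise


theorem sum_choose_succ_mul (s : ℕ) (h : ℕ → ℕ) :
    ∑ j ∈ Finset.range (s + 2), (s + 1).choose j * h j =
      ∑ j ∈ Finset.range (s + 1), s.choose j * (h j + h (j + 1)) := by
  rw [Finset.sum_range_succ']
  simp only [Nat.choose_succ_succ, add_mul, mul_add, Finset.sum_add_distrib]
  have h1 := Finset.sum_range_succ' (fun j => s.choose j * h j) (s + 1)
  rw [Finset.sum_range_succ] at h1
  simp at h1 ⊢
  omega

variable {R : Type} [CommRing R] {M : Type} [AddCommGroup M] [Module R M]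
  {V : Submodule R M} {x y : R} {l : List R}
  [IsLocalRing R] [IsNoetherianRing R] [Module.Finite R M]

local notation "𝔪" => maximalIdeal R

theorem ParamSetup.hilb_singleton (h : ParamSetup V [x]) (n : ℕ) :
    hilb [x] V n = (n + 1) * hilb [x] V 0 := by
  have hQ (n : ℕ) : V ⊔ Ideal.ofList [x] ^ n • (⊤ : Submodule R M) = V ⊔ x ^ n • ⊤ := by
    rw [Ideal.ofList_singleton, Ideal.span_singleton_pow, Submodule.ideal_span_singleton_smul]
  have h1 (n : ℕ) : qlen ((V ⊔ x • ⊤) ⊔ Ideal.ofList [x] ^ (n + 1) • ⊤) = hilb [x] V 0 := by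
    unfold hilb
    congr 1
    have hle : x ^ (n + 1) • (⊤ : Submodule R M) ≤ x • ⊤ := by
      rw [pow_succ', mul_smul]
      exact Submodule.map_mono le_top
    rw [zero_add, sup_right_comm, hQ, hQ, pow_one, sup_assoc, sup_eq_right.2 hle]
  induction n with
  | zero => simp
  | succ n ih =>
    rw [h.hilb_eq, h1, add_mul, one_mul, ← ih]
    congr 1
    unfold hilb
    congr 1
    refine le_antisymm (fun u hu => ?_) (le_comap_smul mem_ofList_head _)
    rw [Submodule.mem_comap, hQ] at hu
    rw [hQ]
    obtain ⟨m, hm⟩ := mem_sup_smul_top.1 hu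
    refine mem_sup_smul_top.2 ⟨m, h.regular_head _ ?_⟩
    rw [smul_sub, ← mul_smul, ← pow_succ']
    exact hm

/-- The binomially weighted sum of the lengths of the local cohomology modules in degrees
`1, …, s + 1`. -/
noncomputable def lcSum (s : ℕ) (V : Submodule R M) : ℕ :=
  ∑ j ∈ Finset.range (s + 1), s.choose j * hlen (j + 1) V

theorem ParamSetup.exists_hlen_step (h : ParamSetup V (x :: l)) : ∃ a : ℕ → ℕ,
    (∀ i < l.length, a i = 0 ↔ Kills x (i + 1) V) ∧ ∀ i, i + 1 < l.length →
      hlen (i + 1) (sat 𝔪 (V ⊔ x • ⊤)) + (a i + a (i + 1)) = hlen (i + 1) V + hlen (i + 2) V := by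
  let A (i : ℕ) : ℕ∞ :=
    Module.length R (LinearMap.range (LinearMap.lsmul R (lcQuot 𝔪 (i + 1) V) x))
  have hfin (i : ℕ) (hi : i < l.length) : Module.length R (lcQuot 𝔪 (i + 1) V) ≠ ⊤ :=
    Module.length_ne_top_iff.2 (h.isFiniteLength i (by simpa using hi))
  have hA (i : ℕ) (hi : i < l.length) : A i ≠ ⊤ :=
    ne_top_of_le_ne_top (hfin i hi) (Module.length_le_of_injective _ (Submodule.subtype_injective _))
  refine ⟨fun i => (A i).toNat, fun i hi => ?_, fun i hi => ?_⟩
  · unfold Kills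
    rw [← length_range_lsmul_eq_zero_iff (A := lcQuot 𝔪 (i + 1) V) x, ENat.toNat_eq_zero,
      or_iff_left (hA i hi)]
  · obtain ⟨δ, h1, h2⟩ := exists_lcQuot_connecting (J := 𝔪) h.regular_head i
    have key := length_add_length_of_exact_smul x _ δ (lcFactor_eq_zero_iff h.regular_head i) h2 h1
    have hB : Module.length R (lcQuot 𝔪 (i + 1) (sat 𝔪 (V ⊔ x • ⊤))) ≠ ⊤ :=
      Module.length_ne_top_iff.2 (h.step.isFiniteLength i hi)
    have e1 := ENat.natCast_toNat (hfin i (by omega))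
    have e2 := ENat.natCast_toNat (hfin (i + 1) hi)
    have e3 := ENat.natCast_toNat hB
    have e4 := ENat.natCast_toNat (hA i (by omega))
    have e5 := ENat.natCast_toNat (hA (i + 1) hi)
    rw [← e1, ← e2, ← e3] at key
    change _ = _ + (A i + A (i + 1)) at key
    rw [← e4, ← e5] at key
    norm_cast at key
    exact key.symm

theorem ParamSetup.exists_lcSum_step {s : ℕ} (h : ParamSetup V (x :: l)) (hl : l.length = s + 2) :
    lcSum s (sat 𝔪 (V ⊔ x • ⊤)) ≤ lcSum (s + 1) V ∧
      (lcSum s (sat 𝔪 (V ⊔ x • ⊤)) = lcSum (s + 1) V ↔ ∀ i < l.length, Kills x (i + 1) V) := by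
  obtain ⟨a, ha, hstep⟩ := h.exists_hlen_step
  have key : lcSum s (sat 𝔪 (V ⊔ x • ⊤)) + ∑ j ∈ Finset.range (s + 2), (s + 1).choose j * a j =
      lcSum (s + 1) V := by
    unfold lcSum
    rw [sum_choose_succ_mul, sum_choose_succ_mul s (fun j => hlen (j + 1) V),
      ← Finset.sum_add_distrib]
    refine Finset.sum_congr rfl fun j hj => ?_
    rw [← mul_add, hstep j (by have := Finset.mem_range.1 hj; omega)]
  refine ⟨by omega, ?_⟩
  have : (∀ i < l.length, Kills x (i + 1) V) ↔
      ∑ j ∈ Finset.range (s + 2), (s + 1).choose j * a j = 0 := by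
    rw [Finset.sum_eq_zero_iff]
    constructor
    · intro hk i hi
      have hi := Finset.mem_range.1 hi
      rw [(ha i (by omega)).2 (hk i (by omega)), mul_zero]
    · intro h0 i hi
      refine (ha i hi).1 ((mul_eq_zero.1 (h0 i (Finset.mem_range.2 (by omega)))).resolve_left ?_)
      exact (Nat.choose_pos (by omega)).ne'
  rw [this]
  omega

theorem ParamSetup.lead_singleton (h : ParamSetup V [x]) :
    Lead (fun n => hilb [x] V n) 0 (hilb [x] V 0) := by
  constructor <;> refine (dom_mul_binom (j := 0) 0 le_rfl).of_le fun n => le_of_eq ?_ <;>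
    simp only [h.hilb_singleton n, zero_add, binom_one] <;> push_cast <;> ring

theorem ParamSetup.lead_cons {E : ℤ} (h : ParamSetup V (x :: y :: l))
    (hE : Lead (fun n => hilb (y :: l) (sat 𝔪 (V ⊔ x • ⊤)) n) l.length E) :
    Lead (fun n => hilb (x :: y :: l) V n) (l.length + 1) E := by
  obtain ⟨t, -, -, -, hstep, -⟩ := h.exists_hilb_step
  constructor
  · refine Dom.of_sub_le (fun n => ?_) (hE.1.add (dom_mul_binom t (Nat.zero_le _)))
    have := hstep n
    zify at this
    simp only [binom_succ_succ (l.length + 1), binom_zero]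
    linarith
  · refine Dom.of_sub_le (fun n => ?_) (hE.2.add h.dom_hilb_step.pred)
    simp only [binom_succ_succ (l.length + 1), Nat.add_sub_cancel]
    linarith

theorem ParamSetup.exists_lead_dom {s : ℕ} (h : ParamSetup V l) (hl : l.length = s + 2) :
    ∃ E, Lead (fun n => hilb l V n) (s + 1) E ∧
      Dom (fun n => hilb l V n - E * binom (s + 2) n - lcSum s V * binom (s + 1) n) s := by
  induction s generalizing V l with
  | zero =>
    obtain ⟨x, y, rfl⟩ := List.length_eq_two.1 hl
    refine ⟨_, h.lead_cons h.step.lead_singleton, ?_⟩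
    obtain ⟨t, ht, -, h0, hstep, -⟩ := h.exists_hilb_step
    have e : lcSum 0 V = hlen 1 V := by simp [lcSum]
    rw [e]
    set D := hilb [y] (sat 𝔪 (V ⊔ x • ⊤)) 0
    refine (dom_mul_binom (j := 0) 0 le_rfl).of_le fun n => ?_
    rw [zero_mul]
    induction n with
    | zero => simp; omega
    | succ n ih =>
      have h1 := hstep n
      rw [h.step.hilb_singleton] at h1
      zify at h1 ht
      rw [binom_one] at ih ⊢
      rw [binom_succ_succ, binom_one]
      push_cast
      linarith
  | succ s ih =>
    obtain ⟨x, _ | ⟨y, l⟩, rfl⟩ := List.exists_cons_of_length_eq_add_one hl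
    · simp at hl
    simp only [List.length_cons, Nat.add_right_cancel_iff] at hl
    obtain ⟨E, hE, hd⟩ := ih h.step (by simpa using hl)
    obtain ⟨hle, -⟩ := h.exists_lcSum_step (by simpa using hl)
    obtain ⟨t, -, -, -, hstep, -⟩ := h.exists_hilb_step
    refine ⟨E, hl ▸ h.lead_cons (hl ▸ hE), Dom.of_le (Dom.of_sub_le (f := fun n =>
      hilb (x :: y :: l) V n - E * binom (s + 3) n - lcSum s (sat 𝔪 (V ⊔ x • ⊤)) * binom (s + 2) n)
      (fun n => ?_) (hd.add (dom_mul_binom t (Nat.zero_le _)))) fun n => ?_⟩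
    · have := hstep n
      zify at this
      simp only [binom_succ_succ (s + 2), binom_succ_succ (s + 1), binom_zero]
      linarith
    · have := binom_pos (s + 1 + 1) n
      zify at hle
      nlinarith

/-- The elements of `l` successively annihilate the local cohomology modules in positive degrees
below the length of the remaining list. -/
def OrderedKills : Submodule R M → List R → Prop
  | _, [] => True
  | V, x :: l => (∀ i < l.length, Kills x (i + 1) V) ∧ OrderedKills (sat 𝔪 (V ⊔ x • ⊤)) l

theorem ParamSetup.orderedKills {s : ℕ} {E : ℤ} (h : ParamSetup V l) (hl : l.length = s + 2)
    (hE : Lead (fun n => hilb l V n) (s + 1) E)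
    (hf : FreqDom (fun n => E * binom (s + 2) n + lcSum s V * binom (s + 1) n - hilb l V n) s) :
    OrderedKills V l := by
  induction s generalizing V l with
  | zero =>
    obtain ⟨x, y, rfl⟩ := List.length_eq_two.1 hl
    obtain ⟨t, ht, hk, h0, hstep, -⟩ := h.exists_hilb_step
    have e : lcSum 0 V = hlen 1 V := by simp [lcSum]
    obtain rfl := hE.unique (h.lead_cons h.step.lead_singleton)
    set D := hilb [y] (sat 𝔪 (V ⊔ x • ⊤)) 0
    rw [e] at hf
    have key (n : ℕ) : (hilb [x, y] V n : ℤ) ≤ D * binom 2 n + t * binom 1 n := by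
      induction n with
      | zero => simp; omega
      | succ n ih =>
        have h1 := hstep n
        rw [h.step.hilb_singleton] at h1
        zify at h1
        rw [binom_one] at ih ⊢
        rw [binom_succ_succ, binom_one]
        push_cast
        linarith
    have h2 := (hf.congr (g := fun n => (hlen 1 V - t : ℤ) * binom 1 n)
      fun n => by have := key n; simp only [zero_add]; linarith).nonpos
    refine ⟨fun i hi => ?_, by simp [OrderedKills]⟩
    obtain rfl : i = 0 := by simpa using hi
    exact hk.1 (by omega)
  | succ s ih =>
    obtain ⟨x, _ | ⟨y, l⟩, rfl⟩ := List.exists_cons_of_length_eq_add_one hl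
    · simp at hl
    simp only [List.length_cons, Nat.add_right_cancel_iff] at hl
    obtain ⟨E', hE', hd⟩ := h.step.exists_lead_dom (s := s) (by simpa using hl)
    obtain rfl := hE.unique (hl ▸ h.lead_cons (hl ▸ hE'))
    obtain ⟨hle, hk⟩ := h.exists_lcSum_step (s := s) (by simpa using hl)
    obtain ⟨t, -, -, -, hstep, -⟩ := h.exists_hilb_step
    have hup := Dom.of_sub_le (f := fun n =>
      hilb (x :: y :: l) V n - E * binom (s + 3) n - lcSum s (sat 𝔪 (V ⊔ x • ⊤)) * binom (s + 2) n)
      (fun n => by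
        have := hstep n
        zify at this
        simp only [binom_succ_succ (s + 2), binom_succ_succ (s + 1), binom_zero]
        linarith) (hd.add (dom_mul_binom t (Nat.zero_le _)))
    have h2 := ((hf.add hup).congr
      (g := fun n => (lcSum (s + 1) V - lcSum s (sat 𝔪 (V ⊔ x • ⊤)) : ℤ) * binom (s + 2) n)
      fun n => by simp only [add_assoc]; linarith).nonpos
    have heq : lcSum s (sat 𝔪 (V ⊔ x • ⊤)) = lcSum (s + 1) V := by omega
    refine ⟨hk.1 heq, ih h.step (by simpa using hl) hE' ?_⟩
    rw [heq]
    have h3 := FreqDom.of_sub_le (g := fun n => E * binom (s + 2) n +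
      lcSum (s + 1) V * binom (s + 1) n - hilb (y :: l) (sat 𝔪 (V ⊔ x • ⊤)) n - t * binom 0 n)
      (fun n => by
        have := hstep n
        zify at this
        simp only [binom_succ_succ (s + 1 + 1), binom_succ_succ (s + 1), binom_zero]
        linarith) hf
    exact (h3.add (dom_mul_binom t (Nat.zero_le _))).congr fun n => by linarith

/-- Besides annihilating local cohomology successively as in `OrderedKills`, the elements of `l`
satisfy the intersection condition which makes `ParamSetup.exists_hilb_step` an equality. -/
def OrderedCap : Submodule R M → List R → Prop
  | _, [] => True
  | V, x :: l => (∀ i < l.length, Kills x (i + 1) V) ∧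
      (∀ n, sat 𝔪 (V ⊔ x • ⊤) ⊓ (V ⊔ Ideal.ofList (x :: l) ^ (n + 1) • ⊤) ≤
        V ⊔ x • Ideal.ofList (x :: l) ^ n • ⊤) ∧ OrderedCap (sat 𝔪 (V ⊔ x • ⊤)) l

theorem ParamSetup.dom_of_orderedCap {s : ℕ} {E : ℤ} (h : ParamSetup V l) (hl : l.length = s + 2)
    (hE : Lead (fun n => hilb l V n) (s + 1) E) (hc : OrderedCap V l) :
    Dom (fun n => E * binom (s + 2) n + lcSum s V * binom (s + 1) n - hilb l V n) s := by
  induction s generalizing V l with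
  | zero =>
    obtain ⟨x, y, rfl⟩ := List.length_eq_two.1 hl
    obtain ⟨t, ht, hk, -, -, heq⟩ := h.exists_hilb_step
    obtain ⟨h0, hstep⟩ := heq hc.2.1
    obtain rfl := hk.2 (hc.1 0 (by simp))
    have e : lcSum 0 V = hlen 1 V := by simp [lcSum]
    obtain rfl := hE.unique (h.lead_cons h.step.lead_singleton)
    set D := hilb [y] (sat 𝔪 (V ⊔ x • ⊤)) 0
    rw [e]
    refine (dom_mul_binom (j := 0) 0 le_rfl).of_le fun n => ?_
    rw [zero_mul]
    induction n with
    | zero => simp; omega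
    | succ n ih =>
      have h1 := hstep n
      rw [h.step.hilb_singleton] at h1
      zify at h1
      rw [binom_one] at ih ⊢
      rw [binom_succ_succ, binom_one]
      push_cast
      linarith
  | succ s ih =>
    obtain ⟨x, _ | ⟨y, l⟩, rfl⟩ := List.exists_cons_of_length_eq_add_one hl
    · simp at hl
    simp only [List.length_cons, Nat.add_right_cancel_iff] at hl
    obtain ⟨E', hE', -⟩ := h.step.exists_lead_dom (s := s) (by simpa using hl)
    obtain rfl := hE.unique (hl ▸ h.lead_cons (hl ▸ hE'))
    obtain ⟨-, hk⟩ := h.exists_lcSum_step (s := s) (by simpa using hl)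
    obtain ⟨t, -, -, -, -, heq⟩ := h.exists_hilb_step
    obtain ⟨-, hstep⟩ := heq hc.2.1
    have hd := ih h.step (by simpa using hl) hE' hc.2.2
    rw [hk.2 hc.1] at hd
    refine Dom.of_sub_le (fun n => ?_) hd
    have := hstep n
    zify at this
    simp only [binom_succ_succ (s + 1 + 1), binom_succ_succ (s + 1)]
    linarith

end FirstCoefficient

section DSequences

open scoped Pointwise

variable {R : Type} [CommRing R] {M : Type} [AddCommGroup M] [Module R M]
  {U V W : Submodule R M} {x y : R} {l l' p s : List R}

/-- `l` is a `d`-sequence on `M ⧸ V`. -/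
def DSeq : Submodule R M → List R → Prop
  | _, [] => True
  | V, x :: l => (∀ y ∈ x :: l, ∀ u, x • y • u ∈ V → y • u ∈ V) ∧ DSeq (V ⊔ x • ⊤) l

theorem sup_ofList_cons_smul_top : V ⊔ Ideal.ofList (x :: l) • ⊤ =
    V ⊔ x • ⊤ ⊔ Ideal.ofList l • ⊤ := by
  rw [Ideal.ofList_cons, Submodule.sup_smul, Submodule.ideal_span_singleton_smul, sup_assoc]

theorem sup_smul_inf_le (h : U ⊓ (W ⊔ Ideal.ofList (x :: l) • ⊤) ≤ W) :
    (U ⊔ x • ⊤) ⊓ (W ⊔ x • ⊤ ⊔ Ideal.ofList l • ⊤) ≤ W ⊔ x • ⊤ := by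
  rintro u ⟨hu, hu'⟩
  obtain ⟨m, hm⟩ := mem_sup_smul_top.1 hu
  refine mem_sup_smul_top.2 ⟨m, h ⟨hm, ?_⟩⟩
  rw [sup_ofList_cons_smul_top]
  exact sub_mem hu' (Submodule.mem_sup_left (mem_sup_smul_top.2 ⟨m, by simp⟩))

theorem smul_mem_sup_ofList (hy : y ∈ l) (u : M) : y • u ∈ W ⊔ Ideal.ofList l • ⊤ :=
  Submodule.mem_sup_right (Submodule.smul_mem_smul (Ideal.subset_span hy) trivial)

theorem DSeq.of_le (hd : DSeq U l) (hWU : W ≤ U) (h : U ⊓ (W ⊔ Ideal.ofList l • ⊤) ≤ W) :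
    DSeq W l := by
  induction l generalizing U W with
  | nil => trivial
  | cons x l ih =>
    exact ⟨fun y hy u hu => h ⟨hd.1 y hy u (hWU hu), smul_mem_sup_ofList hy u⟩,
      ih hd.2 (sup_le_sup_right hWU _) (sup_smul_inf_le h)⟩

theorem DSeq.of_ge (hd : DSeq W l) (hWU : W ≤ U) (h : U ⊓ (W ⊔ Ideal.ofList l • ⊤) ≤ W) :
    DSeq U l := by
  induction l generalizing U W with
  | nil => trivial
  | cons x l ih =>
    refine ⟨fun y hy u hu => hWU (hd.1 y hy u (h ⟨hu, ?_⟩)),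
      ih hd.2 (sup_le_sup_right hWU _) (sup_smul_inf_le h)⟩
    rw [smul_comm]
    exact smul_mem_sup_ofList hy _

theorem DSeq.mem_of_forall_smul_mem (hd : DSeq W l) {u : M} (hu : u ∈ W ⊔ Ideal.ofList l • ⊤)
    (h : ∀ y ∈ l, y • u ∈ W) : u ∈ W := by
  induction l generalizing W with
  | nil => simpa using hu
  | cons x l ih =>
    rw [sup_ofList_cons_smul_top] at hu
    obtain ⟨m, hm⟩ := mem_sup_smul_top.1 (ih hd.2 hu
      fun y hy => Submodule.mem_sup_left (h y (List.mem_cons_of_mem _ hy)))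
    have h1 : x • x • m ∈ W := by
      have := sub_mem (h x List.mem_cons_self) (W.smul_mem x hm)
      simpa [smul_sub] using this
    rw [← sub_add_cancel u (x • m)]
    exact add_mem hm (hd.1 x List.mem_cons_self m h1)

theorem DSeq.smul_mem_of_pow_smul_mem (hd : DSeq W (x :: l)) {u : M} {k : ℕ} (h : x ^ k • u ∈ W)
    (hy : y ∈ x :: l) : y • u ∈ W := by
  refine hd.1 y hy u ?_
  rw [smul_comm]
  refine W.smul_mem y ?_
  have h' : x ^ (k + 1) • u ∈ W := by
    rw [pow_succ', mul_smul]
    exact W.smul_mem x h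
  clear h
  induction k with
  | zero => simpa using h'
  | succ k ih =>
    rw [pow_succ', pow_succ', mul_smul, mul_smul] at h'
    refine ih ?_
    rw [pow_succ', mul_smul]
    exact hd.1 x List.mem_cons_self _ h'

theorem DSeq.of_append (hd : DSeq V (p ++ s)) : DSeq (V ⊔ Ideal.ofList p • ⊤) s := by
  induction p generalizing V with
  | nil => simpa using hd
  | cons x p ih =>
    rw [sup_ofList_cons_smul_top]
    exact ih hd.2

theorem DSeq.mem_sup_smul_pow (n : ℕ) (hd : DSeq V (p ++ s)) {u : M}
    (hu : u ∈ V ⊔ Ideal.ofList (p ++ s) ^ (n + 1) • ⊤)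
    (h : ∀ y ∈ s, y • u ∈ V ⊔ Ideal.ofList p • ⊤) :
    u ∈ V ⊔ (Ideal.ofList p * Ideal.ofList (p ++ s) ^ n) • ⊤ := by
  induction n generalizing u p s with
  | zero =>
    rw [pow_zero, mul_one]
    refine hd.of_append.mem_of_forall_smul_mem ?_ h
    rw [zero_add, pow_one, Ideal.ofList_append, Submodule.sup_smul, ← sup_assoc] at hu
    exact hu
  | succ n ihn =>
    induction s generalizing p with
    | nil => simpa [pow_succ'] using hu
    | cons z s ihs =>
      have h1 := ihs (p := p ++ [z]) (by simpa using hd) (by simpa using hu) (fun y hy => by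
        rw [Ideal.ofList_append, Submodule.sup_smul, ← sup_assoc]
        exact Submodule.mem_sup_left (h y (List.mem_cons_of_mem _ hy)))
      rw [List.append_assoc, List.singleton_append, Ideal.ofList_append, Ideal.ofList_singleton,
        Ideal.sup_mul, Submodule.sup_smul, ← sup_assoc, Submodule.mul_smul (Ideal.span {z}),
        Submodule.ideal_span_singleton_smul] at h1
      set Q := Ideal.ofList (p ++ z :: s) with hQ
      obtain ⟨a, ha, _, ⟨b, hb, rfl⟩, rfl⟩ := Submodule.mem_sup.1 h1
      refine add_mem ha ?_
      change z • b ∈ _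
      have hle : V ⊔ (Ideal.ofList p * Q ^ (n + 1)) • (⊤ : Submodule R M) ≤
          V ⊔ Ideal.ofList p • ⊤ := sup_le_sup_left (Submodule.smul_mono_left Ideal.mul_le_left) _
      have hd' := hd.of_append
      have hzz : z ^ 2 • b ∈ V ⊔ Ideal.ofList p • ⊤ := by
        have := sub_mem (h z List.mem_cons_self) (Submodule.smul_mem _ z (hle ha))
        rw [smul_add, add_sub_cancel_left] at this
        rw [pow_two, mul_smul]
        exact this
      have hb' := ihn hd (Submodule.mem_sup_right hb)
        fun y hy => hd'.smul_mem_of_pow_smul_mem hzz hy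
      obtain ⟨c, hc, d, hd, rfl⟩ := Submodule.mem_sup.1 hb'
      rw [smul_add]
      refine Submodule.add_mem_sup (V.smul_mem z hc) ?_
      rw [pow_succ', mul_left_comm, Submodule.mul_smul]
      refine Submodule.smul_mem_smul (Ideal.subset_span (by simp)) hd

end DSequences

section PowPermutations

open scoped Pointwise

variable {R : Type} [CommRing R]

/-- `PowPerm l l'` means that `l'` is obtained from `l` by permuting the entries and replacing them
by positive powers. -/
inductive PowPerm : List R → List R → Prop
  | perm {l l' : List R} : l.Perm l' → PowPerm l l'
  | pow (x : R) (l : List R) (n : ℕ) : 1 ≤ n → PowPerm (x :: l) (x ^ n :: l)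
  | trans {l₁ l₂ l₃ : List R} : PowPerm l₁ l₂ → PowPerm l₂ l₃ → PowPerm l₁ l₃

variable {M : Type} [AddCommGroup M] [Module R M]
  {U V W : Submodule R M} {x y : R} {l l' l₁ l₂ : List R}

theorem PowPerm.refl (l : List R) : PowPerm l l := .perm (.refl _)

theorem PowPerm.cons (x : R) (h : PowPerm l l') : PowPerm (x :: l) (x :: l') := by
  induction h with
  | perm h => exact .perm (h.cons x)
  | pow y l n hn =>
    exact (PowPerm.perm (.swap y x l)).trans ((PowPerm.pow y (x :: l) n hn).trans
      (.perm (.swap x (y ^ n) l)))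
  | trans _ _ h1 h2 => exact h1.trans h2

theorem PowPerm.cons_pow {n : ℕ} (hn : 1 ≤ n) (h : PowPerm l l') : PowPerm (x :: l) (x ^ n :: l') :=
  (h.cons x).trans (.pow x l' n hn)

theorem PowPerm.ofFn {r : ℕ} (x : Fin r → R) (n : Fin r → ℕ) (hn : ∀ k, 1 ≤ n k) :
    PowPerm (List.ofFn x) (List.ofFn fun k => x k ^ n k) := by
  induction r with
  | zero => simpa using PowPerm.refl []
  | succ r ih =>
    rw [List.ofFn_succ, List.ofFn_succ]
    exact (ih _ _ fun k => hn k.succ).cons_pow (hn 0)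

variable [IsLocalRing R] [IsNoetherianRing R] [Module.Finite R M]

local notation "𝔪" => maximalIdeal R

omit [IsNoetherianRing R] [Module.Finite R M] in
theorem ParamSetup.powPerm (h : ParamSetup V l) (hl : PowPerm l l') : ParamSetup V l' := by
  induction hl with
  | perm hl => exact h.perm hl
  | pow x l n hn => exact h.pow_head hn
  | trans _ _ h1 h2 => exact h2 (h1 h)

/-! ### Sequences annihilating local cohomology in every order -/

/-- Every permutation of `l` successively annihilates local cohomology. -/
def PermKills (V : Submodule R M) (l : List R) : Prop := ∀ l', l.Perm l' → OrderedKills V l'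

omit [Module.Finite R M] [IsNoetherianRing R] in
theorem PermKills.perm (h : PermKills V l) (hl : l.Perm l') : PermKills V l' :=
  fun _ hl' => h _ (hl.trans hl')

omit [Module.Finite R M] [IsNoetherianRing R] in
theorem PermKills.step (h : PermKills V (x :: l)) : PermKills (sat 𝔪 (V ⊔ x • ⊤)) l :=
  fun _ hl => (h _ (hl.cons x)).2

omit [Module.Finite R M] [IsNoetherianRing R] in
theorem PermKills.kills (h : PermKills V (x :: l)) {i : ℕ} (hi : i < l.length) :
    Kills x (i + 1) V :=
  (h _ (.refl _)).1 i hi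

theorem ParamSetup.sat_inf_sat_le (h : ParamSetup V (x :: y :: l)) (hk : Kills y 1 V) :
    sat 𝔪 (V ⊔ x • ⊤) ⊓ sat 𝔪 (V ⊔ y • ⊤) ≤ V ⊔ x • ⊤ := by
  rintro w ⟨hwx, hwy⟩
  have hx := h.regular_head
  have hxy := (h.perm (.swap y x l)).step.regular_head
  have hy : ∀ u : M, y • u ∈ V → u ∈ V := fun u => h.regular (by simp) u
  have hr : ∀ u : M, (x * y) • u ∈ V → u ∈ V := fun u hu => hy u (hx _ (by rwa [← mul_smul]))
  obtain ⟨c, hc⟩ := mem_sat.1 hwx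
  obtain ⟨φ, hφ, -⟩ := exists_sat_connecting (J := 𝔪) hr h.sat_eq
  have hw : w ∈ sat 𝔪 (V ⊔ (x * y) • ⊤) := by
    rw [← sat_sat]
    refine mem_sat.2 ⟨c, fun a ha => ?_⟩
    obtain ⟨m, hm⟩ := mem_sup_smul_top.1 (hc a ha)
    have hxm : x • m ∈ sat 𝔪 (V ⊔ y • ⊤) := by
      have h2 : a • w - x • m ∈ sat 𝔪 (V ⊔ y • ⊤) := le_sat (Submodule.mem_sup_left hm)
      rw [← sub_sub_cancel (a • w) (x • m)]
      exact sub_mem (Submodule.smul_mem _ a hwy) h2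
    obtain ⟨k, hk'⟩ := mem_sat.1 (hxy m hxm)
    refine mem_sat.2 ⟨k, fun b hb => ?_⟩
    obtain ⟨m', hm'⟩ := mem_sup_smul_top.1 (hk' b hb)
    refine mem_sup_smul_top.2 ⟨m', ?_⟩
    have h3 := add_mem (V.smul_mem b hm) (V.smul_mem x hm')
    convert h3 using 1
    rw [smul_sub, smul_sub, mul_smul, smul_comm b x m]
    abel
  have h1 : y • w ∈ V ⊔ (x * y) • ⊤ := by
    have := hk (φ ⟨w, hw⟩)
    rw [← map_smul, hφ] at this
    exact this
  obtain ⟨m, hm⟩ := mem_sup_smul_top.1 h1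
  refine mem_sup_smul_top.2 ⟨m, hy _ ?_⟩
  rwa [smul_sub, ← mul_smul, mul_comm y x]

theorem ParamSetup.sat_inf_sup_le (h : ParamSetup V (x :: l)) (hk : PermKills V (x :: l)) :
    sat 𝔪 (V ⊔ x • ⊤) ⊓ (V ⊔ Ideal.ofList (x :: l) • ⊤) ≤ V ⊔ x • ⊤ := by
  induction l generalizing V with
  | nil =>
    rw [sup_ofList_cons_smul_top]
    simp
  | cons y l ih =>
    have hs := List.Perm.swap y x l
    rintro w ⟨hw, hw'⟩
    have h1 := ih (h.perm hs).step (hk.perm hs).step ⟨sat_mono (sup_le_sup_right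
      (le_sup_left.trans le_sat) _) hw, ?_⟩
    · obtain ⟨m, hm⟩ := mem_sup_smul_top.1 h1
      have h2 : x • m ∈ V ⊔ x • ⊤ := mem_sup_smul_top.2 ⟨m, by simp⟩
      rw [← sub_add_cancel w (x • m)]
      exact add_mem (h.sat_inf_sat_le ((hk.perm hs).kills (by simp))
        ⟨sub_mem hw (le_sat h2), hm⟩) h2
    · rw [Ideal.ofList_perm hs, sup_ofList_cons_smul_top] at hw'
      exact (sup_le_sup_right (le_sat : V ⊔ y • ⊤ ≤ sat 𝔪 (V ⊔ y • ⊤))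
        (Ideal.ofList (x :: l) • ⊤)) hw'

theorem ParamSetup.dSeq (h : ParamSetup V l) (hk : PermKills V l) : DSeq V l := by
  induction l generalizing V with
  | nil => trivial
  | cons x l ih =>
    refine ⟨fun y _ u hu => h.regular_head _ hu, (ih h.step hk.step).of_le le_sat ?_⟩
    rw [← sup_ofList_cons_smul_top]
    exact h.sat_inf_sup_le hk

theorem ParamSetup.kills_sat_pow {n i : ℕ} (h : ParamSetup V (x :: l)) (hn : 1 ≤ n)
    (hx : Kills x (i + 1) V) (hy : Kills y (i + 2) V) (hxy : Kills y (i + 1) (sat 𝔪 (V ⊔ x • ⊤))) :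
    Kills y (i + 1) (sat 𝔪 (V ⊔ x ^ n • ⊤)) := by
  intro ξ
  have hle : sat 𝔪 (V ⊔ x ^ n • ⊤) ≤ sat 𝔪 (V ⊔ x • ⊤) := by
    refine sat_mono (sup_le_sup_left ?_ _)
    obtain ⟨n, rfl⟩ := Nat.exists_eq_add_of_le' hn
    rw [pow_succ', mul_smul]
    exact Submodule.map_mono le_top
  obtain ⟨δ, -, h2⟩ := exists_lcQuot_connecting (J := 𝔪) (h.pow_head hn).regular_head i
  obtain ⟨η, hη⟩ := (h2 (y • ξ)).1 (by rw [map_smul, hy])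
  have h3 : lcFactor 𝔪 (i + 1) hle (y • ξ) = 0 := by rw [map_smul, hxy]
  rw [← hη, lcFactor_comp] at h3
  obtain ⟨w, hw⟩ := (lcFactor_eq_zero_iff h.regular_head i η).1 h3
  rw [← hη, ← hw, hx, map_zero]

omit [IsLocalRing R] in
theorem sat_sat_sup (J : Ideal R) (V W : Submodule R M) :
    sat J (sat J V ⊔ W) = sat J (V ⊔ W) := by
  refine le_antisymm ?_ (sat_mono (sup_le_sup_right le_sat _))
  rw [← sat_sat J (V ⊔ W)]
  exact sat_mono (sup_le (sat_mono le_sup_left) (le_sup_right.trans le_sat))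

theorem sat_sup_sat_sup (V : Submodule R M) (x y : R) : sat 𝔪 (sat 𝔪 (V ⊔ x • ⊤) ⊔ y • ⊤) =
    sat 𝔪 (sat 𝔪 (V ⊔ y • ⊤) ⊔ x • ⊤) := by
  rw [sat_sat_sup, sat_sat_sup, sup_right_comm]

theorem ParamSetup.permKills_pow_head {n : ℕ} (h : ParamSetup V (x :: l)) (hn : 1 ≤ n)
    (hk : PermKills V (x :: l)) : PermKills V (x ^ n :: l) := by
  induction hm : l.length generalizing V l with
  | zero =>
    obtain rfl := List.eq_nil_of_length_eq_zero hm
    intro p hp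
    rw [← List.singleton_perm.1 hp]
    exact ⟨by simp, trivial⟩
  | succ m ih =>
    have key : ∀ z p, l.Perm (z :: p) → PermKills (sat 𝔪 (V ⊔ z • ⊤)) (x ^ n :: p) := by
      intro z p hp
      have hs := (hp.cons x).trans (.swap z x p)
      exact ih (h.perm hs).step (hk.perm hs).step
        (by have := hp.length_eq; simp only [List.length_cons] at this; lia)
    intro p hp
    obtain _ | ⟨z, p⟩ := p
    · simpa using hp.length_eq
    rcases List.mem_cons.1 (hp.mem_iff.2 List.mem_cons_self) with rfl | hz
    · have hlp := hp.cons_inv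
      refine ⟨fun i hi => ?_, ?_⟩
      · rw [← hlp.length_eq] at hi
        intro w
        obtain ⟨n, rfl⟩ := Nat.exists_eq_add_of_le' hn
        rw [pow_succ, mul_smul, hk.kills hi, smul_zero]
      · obtain _ | ⟨y, q⟩ := p
        · trivial
        have hs := (hlp.cons x).trans (.swap y x q)
        have hlen : m = q.length := by simpa [hm] using hlp.length_eq
        refine ⟨fun i hi => ?_, ?_⟩
        · exact h.kills_sat_pow hn (hk.kills (by lia))
            ((hk.perm hs).kills (by simpa using hi)) ((hk.perm (hlp.cons x)).step.kills hi)
        · rw [sat_sup_sat_sup]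
          exact (key y q hlp).step _ (.refl _)
    · obtain ⟨s, t, rfl⟩ := List.append_of_mem hz
      have hst : (s ++ z :: t).Perm (z :: (s ++ t)) := List.perm_middle
      have hp' : (x ^ n :: (s ++ t)).Perm p :=
        List.Perm.cons_inv (((List.Perm.swap _ _ _).trans (hst.symm.cons _)).trans hp)
      have hs := (hst.cons x).trans (.swap z x (s ++ t))
      refine ⟨fun i hi => (hk.perm hs).kills ?_, key z _ hst _ hp'⟩
      have := hp'.length_eq
      simp only [List.length_cons] at this ⊢
      lia

theorem ParamSetup.permKills_powPerm (h : ParamSetup V l) (hk : PermKills V l)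
    (hl : PowPerm l l') : PermKills V l' := by
  induction hl with
  | perm hl => exact hk.perm hl
  | pow x l n hn => exact h.permKills_pow_head hn hk
  | trans h12 _ h1 h2 => exact h2 (h.powPerm h12) (h1 h hk)

end PowPermutations

section PowDSequences

open scoped Pointwise

variable {R : Type} [CommRing R] [IsLocalRing R] [IsNoetherianRing R] {M : Type} [AddCommGroup M]
  [Module R M] [Module.Finite R M] {V W : Submodule R M} {x y : R} {l l' : List R}

local notation "𝔪" => maximalIdeal R

/-! ### Sequences all of whose powers are `d`-sequences in every order -/

omit [IsNoetherianRing R] [Module.Finite R M] in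
theorem DSeq.smul_mem_of_mem_sat (hd : DSeq W l) (hl : ∀ y ∈ l, y ∈ 𝔪) {u : M}
    (hu : u ∈ sat 𝔪 W) (hy : y ∈ l) : y • u ∈ W := by
  obtain _ | ⟨z, l⟩ := l
  · simp at hy
  obtain ⟨k, hk⟩ := mem_sat.1 hu
  exact hd.smul_mem_of_pow_smul_mem (hk _ (Ideal.pow_mem_pow (hl z List.mem_cons_self) k)) hy

omit [IsNoetherianRing R] [Module.Finite R M] in
theorem DSeq.step (hd : DSeq V (x :: l)) (hl : ∀ y ∈ l, y ∈ 𝔪) :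
    DSeq (sat 𝔪 (V ⊔ x • ⊤)) l :=
  hd.2.of_ge le_sat fun _ ⟨hu, hu'⟩ => hd.2.mem_of_forall_smul_mem hu' fun _ hy =>
    hd.2.smul_mem_of_mem_sat hl hu hy

/-- Every sequence of positive powers of the elements of `l`, in any order, is a `d`-sequence on
`M ⧸ V`. -/
def PowDSeq (V : Submodule R M) (l : List R) : Prop := ∀ l', PowPerm l l' → DSeq V l'

omit [IsLocalRing R] [IsNoetherianRing R] [Module.Finite R M] in
theorem PowDSeq.powPerm (h : PowDSeq V l) (hl : PowPerm l l') : PowDSeq V l' :=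
  fun _ hl' => h _ (hl.trans hl')

theorem ParamSetup.powDSeq_step (h : ParamSetup V (x :: l)) (hd : PowDSeq V (x :: l)) :
    PowDSeq (sat 𝔪 (V ⊔ x • ⊤)) l :=
  fun _ hl => (hd _ (hl.cons x)).step (h.step.powPerm hl).mem

omit [IsLocalRing R] [IsNoetherianRing R] in
theorem powPerm_swap_pow (x y : R) (l : List R) {n : ℕ} (hn : 1 ≤ n) :
    PowPerm (x :: y :: l) (y ^ n :: x :: l) :=
  (PowPerm.perm (.swap y x l)).trans (.pow y _ _ hn)

omit [IsNoetherianRing R] [Module.Finite R M] in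
theorem ParamSetup.exists_pow_smul_eq_zero {i : ℕ} (h : ParamSetup V (x :: y :: l))
    (hi : i < (y :: l).length) (w : lcQuot 𝔪 (i + 1) V) : ∃ n, 1 ≤ n ∧ y ^ n • w = 0 := by
  obtain ⟨c, hc⟩ := (h.isFiniteLength i (by simpa using hi)).exists_pow_maximalIdeal_smul
  exact ⟨c + 1, c.succ_pos,
    hc _ (Ideal.pow_le_pow_right c.le_succ (Ideal.pow_mem_pow (h.mem y (by simp)) _)) w⟩

theorem ParamSetup.kills_of_powDSeq {i : ℕ} (h : ParamSetup V (x :: l)) (hd : PowDSeq V (x :: l))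
    (hi : i < l.length) : Kills x (i + 1) V := by
  induction i generalizing V l with
  | zero =>
    obtain _ | ⟨y, l⟩ := l
    · simp at hi
    intro w
    obtain ⟨n, hn, hw⟩ := h.exists_pow_smul_eq_zero hi w
    have hp := powPerm_swap_pow x y l hn
    have h' := h.powPerm hp
    obtain ⟨φ, h1, h2⟩ := exists_sat_connecting (J := 𝔪) h'.regular_head h.sat_eq
    obtain ⟨u, rfl⟩ := (h2 w).1 hw
    rw [← map_smul, h1]
    exact (hd _ hp).2.smul_mem_of_mem_sat h'.step.mem u.2 List.mem_cons_self
  | succ i ih =>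
    obtain _ | ⟨y, l⟩ := l
    · simp at hi
    intro w
    obtain ⟨n, hn, hw⟩ := h.exists_pow_smul_eq_zero hi w
    have hp := powPerm_swap_pow x y l hn
    have h' := h.powPerm hp
    obtain ⟨δ, h1, -⟩ := exists_lcQuot_connecting (J := 𝔪) h'.regular_head i
    obtain ⟨u, rfl⟩ := (h1 w).1 hw
    rw [← map_smul, ih h'.step (h'.powDSeq_step (hd.powPerm hp)) (by simpa using hi), map_zero]

theorem ParamSetup.orderedCap (h : ParamSetup V l) (hd : PowDSeq V l) : OrderedCap V l := by
  induction l generalizing V with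
  | nil => trivial
  | cons x l ih =>
    refine ⟨fun i hi => h.kills_of_powDSeq hd hi, fun n u ⟨hu, hu'⟩ => ?_,
      ih h.step (h.powDSeq_step hd)⟩
    have hd' := hd _ (.refl _)
    have h1 := DSeq.mem_sup_smul_pow (p := [x]) n hd' hu' fun y hy => by
      rw [Ideal.ofList_singleton, Submodule.ideal_span_singleton_smul]
      exact hd'.2.smul_mem_of_mem_sat h.step.mem hu hy
    rwa [Ideal.ofList_singleton, Submodule.mul_smul, Submodule.ideal_span_singleton_smul] at h1

end PowDSequences

section IndexedFamilies

open scoped Pointwise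

variable {R : Type} [CommRing R] {M : Type} [AddCommGroup M] [Module R M]

/-! ### Comparison with the definitions in terms of families -/

theorem dSeq_ofFn {r : ℕ} {V : Submodule R M} {x : Fin r → R} :
    DSeq V (List.ofFn x) ↔ ∀ i j : Fin r, i ≤ j → ∀ u : M,
      x i • x j • u ∈ V ⊔ Ideal.span (x '' {k | k < i}) • ⊤ →
        x j • u ∈ V ⊔ Ideal.span (x '' {k | k < i}) • ⊤ := by
  induction r generalizing V with
  | zero => simp [DSeq]
  | succ r ih =>
    have hs (i : Fin r) : V ⊔ Ideal.span (x '' {k | k < i.succ}) • ⊤ =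
        V ⊔ x 0 • ⊤ ⊔ Ideal.span ((fun k => x k.succ) '' {k | k < i}) • (⊤ : Submodule R M) := by
      have : {k | k < i.succ} = insert 0 (Fin.succ '' {k | k < i}) := by
        ext k
        cases k using Fin.cases <;> simp
      rw [this, Set.image_insert_eq, Set.image_image, Ideal.span_insert, Submodule.sup_smul,
        Submodule.ideal_span_singleton_smul, sup_assoc]
    have h0 : V ⊔ Ideal.span (x '' {k : Fin (r + 1) | k < 0}) • ⊤ = V := by simp
    rw [List.ofFn_succ, DSeq, ih, ← List.ofFn_succ, List.forall_mem_ofFn_iff, Fin.forall_fin_succ,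
      Fin.forall_fin_succ (P := fun i => ∀ j, i ≤ j → _)]
    refine and_congr ?_ ?_
    · simp only [h0, Fin.forall_fin_succ, Fin.zero_le, forall_const]
    · refine forall_congr' fun i => ?_
      rw [Fin.forall_fin_succ (P := fun j => i.succ ≤ j → _)]
      simp only [hs, Fin.succ_le_succ_iff, (Fin.succ_pos i).not_ge, false_imp_iff, true_and]

theorem isDSeq_iff_dSeq {r : ℕ} {x : Fin r → R} :
    IsDSeq R x M ↔ DSeq (⊥ : Submodule R M) (List.ofFn x) := by
  rw [dSeq_ofFn]
  refine forall₃_congr fun i j _ => ⟨fun h u hu => ?_, fun h => le_antisymm (fun u hu => ?_) ?_⟩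
  · rw [bot_sup_eq] at hu ⊢
    exact h.le (by simpa [mul_smul] using hu)
  · have := h u
    rw [bot_sup_eq] at this
    exact this (by simpa [mul_smul] using hu)
  · intro u hu
    simpa [mul_smul] using Submodule.smul_mem _ (x i) hu

theorem exists_ofFn_comp_of_perm {α : Type*} {r : ℕ} {x : Fin r → α} {l : List α}
    (h : (List.ofFn x).Perm l) : ∃ σ : Equiv.Perm (Fin r), l = List.ofFn (x ∘ σ) := by
  rw [List.ofFn_eq_map, List.perm_comm] at h
  obtain ⟨L, rfl, hL⟩ : Relation.Comp (· = List.map x ·) List.Perm l (List.finRange r) := by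
    rwa [List.eq_map_comp_perm]
  have hlen : L.length = r := by simpa using hL.length_eq
  let e := List.Nodup.getEquivOfForallMemList L (hL.nodup_iff.2 (List.nodup_finRange r))
    fun i => hL.mem_iff.2 (List.mem_finRange i)
  refine ⟨(finCongr hlen.symm).trans e, ?_⟩
  rw [← List.map_ofFn]
  congr 1
  exact List.ext_getElem (by simpa) fun i _ _ => by simp [e]

theorem PowPerm.exists_eq_ofFn {r : ℕ} {x : Fin r → R} {l l' : List R} (h : PowPerm l l')
    (hl : l = List.ofFn x) : ∃ (σ : Equiv.Perm (Fin r)) (n : Fin r → ℕ), (∀ k, 1 ≤ n k) ∧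
      l' = List.ofFn fun k => x (σ k) ^ n (σ k) := by
  induction h generalizing x with
  | perm h =>
    subst hl
    obtain ⟨σ, rfl⟩ := exists_ofFn_comp_of_perm h
    exact ⟨σ, fun _ => 1, by simp, by simp [Function.comp_def]⟩
  | pow a l n hn =>
    obtain _ | r := r
    · simp at hl
    rw [List.ofFn_succ, List.cons.injEq] at hl
    obtain ⟨rfl, rfl⟩ := hl
    refine ⟨1, Fin.cons n 1, Fin.cases (by simpa) (by simp), by simp [List.ofFn_succ]⟩
  | trans _ _ h1 h2 =>
    obtain ⟨σ, n, hn, h⟩ := h1 hl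
    obtain ⟨τ, m, hm, rfl⟩ := h2 h
    refine ⟨τ.trans σ, fun k => n k * m (σ.symm k),
      fun k => Nat.mul_pos (hn _) (hm _), ?_⟩
    simp [pow_mul]

theorem isStandardSeq_iff {r : ℕ} {x : Fin r → R} :
    IsStandardSeq R x M ↔ PowDSeq (⊥ : Submodule R M) (List.ofFn x) := by
  refine ⟨fun h l hl => ?_, fun h n hn σ => ?_⟩
  · obtain ⟨σ, n, hn, rfl⟩ := hl.exists_eq_ofFn rfl
    exact isDSeq_iff_dSeq.1 (h n hn σ)
  · refine isDSeq_iff_dSeq.2 (h _ ((PowPerm.ofFn x n hn).trans (.perm ?_)))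
    exact (σ.ofFn_comp_perm fun k => x k ^ n k).symm

end IndexedFamilies

section MainReduction

open scoped Pointwise

variable {R : Type} [CommRing R] [IsLocalRing R] [IsNoetherianRing R] {M : Type} [AddCommGroup M]
  [Module R M] [Module.Finite R M] {V W : Submodule R M} {x y : R} {l l' : List R}

local notation "𝔪" => maximalIdeal R

/-! ### The first Hilbert coefficient -/

theorem ParamSetup.powDSeq_iff {s : ℕ} {E c : ℤ} (h : ParamSetup V l) (hl : l.length = s + 2)
    (h1 : Dom (fun n => hilb l V n - E * binom (s + 2) n - c * binom (s + 1) n) s)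
    (h2 : Dom (fun n => E * binom (s + 2) n + c * binom (s + 1) n - hilb l V n) s) :
    PowDSeq V l ↔ c = lcSum s V := by
  have hE : Lead (fun n => hilb l V n) (s + 1) E := by
    refine ⟨((h1.mono s.le_succ).add (dom_mul_binom c le_rfl)).of_le fun n => ?_,
      ((h2.mono s.le_succ).add (dom_mul_binom (-c) le_rfl)).of_le fun n => ?_⟩ <;> linarith
  constructor
  · intro hd
    obtain ⟨E', hE', h3⟩ := h.exists_lead_dom hl
    obtain rfl := hE.unique hE'
    have h4 := h.dom_of_orderedCap hl hE (h.orderedCap hd)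
    refine le_antisymm (sub_nonpos.1 (FreqDom.nonpos (j := s) ?_))
      (sub_nonpos.1 (FreqDom.nonpos (j := s) ?_))
    · exact (h2.add h3).freqDom.congr fun n => by linarith
    · exact (h1.add h4).freqDom.congr fun n => by linarith
  · rintro rfl
    have hk : PermKills V l := fun l' hl' => by
      have e : hilb l V = hilb l' V := by
        ext n
        rw [hilb, hilb, Ideal.ofList_perm hl']
      rw [e] at h2 hE
      exact (h.perm hl').orderedKills (hl'.length_eq ▸ hl) hE h2.freqDom
    exact fun l' hl' => (h.powPerm hl').dSeq (h.permKills_powPerm hk hl')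

omit [IsNoetherianRing R] [IsLocalRing R] in
theorem pow_mem_sup_annihilator {I : Ideal R} {a : R}
    (ha : ∀ m : M, a • m ∈ I • (⊤ : Submodule R M)) :
    ∃ n, a ^ n ∈ I ⊔ Module.annihilator R M := by
  obtain ⟨p, hp, -, hpI, h0⟩ :=
    LinearMap.exists_monic_and_natDegree_eq_and_coeff_mem_pow_and_aeval_eq_zero R
      (LinearMap.lsmul R M a) I (by rintro _ ⟨m, rfl⟩; exact ha m)
  have h1 : p.eval a ∈ Module.annihilator R M := by
    rw [Module.mem_annihilator]
    intro m
    have h2 : algebraMap R (Module.End R M) (p.eval a) = 0 := by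
      rw [← h0, ← Polynomial.coe_aeval_eq_eval, ← Polynomial.aeval_algebraMap_apply]
      rfl
    exact LinearMap.congr_fun h2 m
  refine ⟨p.natDegree, ?_⟩
  rw [Polynomial.eval_eq_sum_range, Finset.sum_range_succ, hp.coeff_natDegree, one_mul] at h1
  have h2 : ∑ i ∈ Finset.range p.natDegree, p.coeff i * a ^ i ∈ I := by
    refine sum_mem fun i hi => Ideal.mul_mem_right _ _ (Ideal.pow_le_self ?_ (hpI i))
    have := Finset.mem_range.1 hi
    lia
  have := sub_mem (Ideal.mem_sup_right h1) (Ideal.mem_sup_left h2 : _ ∈ I ⊔ Module.annihilator R M)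
  rwa [add_sub_cancel_left] at this

theorem exists_pow_le_sup_annihilator {I : Ideal R}
    (h : IsFiniteLength R (M ⧸ I • (⊤ : Submodule R M))) :
    ∃ k, 𝔪 ^ k ≤ I ⊔ Module.annihilator R M := by
  obtain ⟨c, hc⟩ := h.exists_pow_maximalIdeal_smul
  obtain ⟨k, hk⟩ := Ideal.exists_pow_le_of_le_radical_of_fg
    (I := 𝔪 ^ c) (J := I ⊔ Module.annihilator R M)
    (fun a ha => pow_mem_sup_annihilator fun m =>
      (Submodule.Quotient.mk_eq_zero _).1 (hc a ha (Submodule.Quotient.mk m)))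
    (IsNoetherian.noetherian _)
  exact ⟨c * k, by rwa [pow_mul]⟩

/-- The local cohomology of the quotient by the zero submodule. -/
noncomputable def lcQuotBotEquiv (i : ℕ) : lcQuot 𝔪 i (⊥ : Submodule R M) ≃ₗ[R] LC R i M :=
  ((localCohomology 𝔪 i).mapIso
    (Submodule.quotEquivOfEqBot (⊥ : Submodule R M) rfl).toModuleIso).toLinearEquiv

omit [IsNoetherianRing R] [Module.Finite R M] in
theorem sat_bot_eq_bot (h : ∃ x ∈ 𝔪, IsSMulRegular M x) : sat 𝔪 (⊥ : Submodule R M) = ⊥ := by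
  obtain ⟨x, hx, hreg⟩ := h
  refine (Submodule.eq_bot_iff _).2 fun u hu => ?_
  obtain ⟨n, hn⟩ := mem_sat.1 hu
  exact (hreg.pow n) ((hn _ (Ideal.pow_mem_pow hx n)).trans (smul_zero _).symm)

omit [IsLocalRing R] [IsNoetherianRing R] in
theorem Ideal.ofList_ofFn {r : ℕ} (x : Fin r → R) :
    Ideal.ofList (List.ofFn x) = Ideal.span (Set.range x) := by
  simp [Ideal.ofList, List.mem_ofFn, Set.range]

theorem IsParamIdeal.paramSetup_bot {r : ℕ} {x : Fin r → R} {Q : Ideal R}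
    (hQ : IsParamIdeal R Q M r) (hx : Q = Ideal.span (Set.range x)) (hgcm : IsGenCM R M r)
    (hdepth : ∃ x ∈ 𝔪, IsSMulRegular M x) : ParamSetup (⊥ : Submodule R M) (List.ofFn x) where
  sat_eq := sat_bot_eq_bot hdepth
  mem y hy := by
    obtain ⟨k, rfl⟩ := List.mem_ofFn.1 hy
    exact hQ.1 (hx ▸ Ideal.subset_span ⟨k, rfl⟩)
  pow_le := by
    rw [Ideal.ofList_ofFn, ← hx,
      (Submodule.quotEquivOfEqBot (⊥ : Submodule R M) rfl).annihilator_eq]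
    exact exists_pow_le_sup_annihilator hQ.2.2
  isFiniteLength i hi := (lcQuotBotEquiv (i + 1)).symm.isFiniteLength
    (hgcm _ (by simpa using hi))

omit [IsNoetherianRing R] [Module.Finite R M] in
theorem hlen_bot {i k : ℕ} (h : mLength R (LC R i M) = (k : ℕ∞)) :
    hlen i (⊥ : Submodule R M) = k := by
  have h' : (Module.length R (LC R i M) : WithBot ℕ∞) = (k : ℕ∞) := by
    rw [Module.coe_length]
    exact h
  rw [hlen, (lcQuotBotEquiv i).length_eq, WithBot.coe_injective h', ENat.toNat_natCast]

omit [IsLocalRing R] [IsNoetherianRing R] [Module.Finite R M] in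
theorem hilb_bot {n k : ℕ}
    (h : mLength R (M ⧸ Ideal.ofList l ^ (n + 1) • (⊤ : Submodule R M)) = (k : ℕ∞)) :
    hilb l (⊥ : Submodule R M) n = k := by
  have h' : (Module.length R (M ⧸ Ideal.ofList l ^ (n + 1) • (⊤ : Submodule R M)) : WithBot ℕ∞) =
      (k : ℕ∞) := by
    rw [Module.coe_length]
    exact h
  rw [hilb, bot_sup_eq, qlen, WithBot.coe_injective h', ENat.toNat_natCast]

omit [IsNoetherianRing R] [Module.Finite R M] in
theorem lcSum_bot {s : ℕ} {h : ℕ → ℕ}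
    (hh : ∀ i, 1 ≤ i → i ≤ s + 1 → mLength R (LC R i M) = ((h i : ℕ) : ℕ∞)) :
    (lcSum s (⊥ : Submodule R M) : ℤ) =
      ∑ i ∈ Finset.Icc 1 (s + 1), (s.choose (i - 1) : ℤ) * h i := by
  rw [lcSum, ← Finset.Ico_add_one_right_eq_Icc, Finset.sum_Ico_eq_sum_range]
  push_cast
  refine Finset.sum_congr rfl fun i hi => ?_
  rw [Nat.add_sub_cancel_left, add_comm 1 i,
    hlen_bot (hh (i + 1) (by simp) (by have := Finset.mem_range.1 hi; lia))]

omit [IsLocalRing R] [IsNoetherianRing R] [Module.Finite R M] in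
/-- Up to multiples of `binom s`, only the first two Hilbert coefficients matter. -/
theorem HasHilbCoeffs.dom {s : ℕ} {e : ℕ → ℤ} (he : HasHilbCoeffs R (Ideal.ofList l) M (s + 2) e) :
    Dom (fun n => hilb l (⊥ : Submodule R M) n - e 0 * binom (s + 2) n - -e 1 * binom (s + 1) n) s ∧
      Dom (fun n => e 0 * binom (s + 2) n + -e 1 * binom (s + 1) n -
        hilb l (⊥ : Submodule R M) n) s := by
  obtain ⟨N, hN⟩ := he
  have hb (i n : ℕ) (hi : i ≤ s + 2) :
      ((n + (s + 2) - i).choose (s + 2 - i) : ℤ) = binom (s + 2 - i) n := by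
    rw [binom, Nat.add_sub_assoc hi]
  set C : ℤ := ∑ i ∈ Finset.range (s + 1), |e (i + 2)|
  have key : ∀ n, N ≤ n →
      |hilb l (⊥ : Submodule R M) n - e 0 * binom (s + 2) n - -e 1 * binom (s + 1) n| ≤
        C * binom s n := by
    intro n hn
    obtain ⟨k, hk, hke⟩ := hN n hn
    rw [hilb_bot hk, hke, Finset.sum_range_succ', Finset.sum_range_succ', hb _ _ (by simp),
      hb _ _ (by simp)]
    have : ∀ a : ℤ, a + (-1) ^ (0 + 1) * e (0 + 1) * binom (s + 2 - (0 + 1)) n +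
        (-1) ^ 0 * e 0 * binom (s + 2 - 0) n - e 0 * binom (s + 2) n - -e 1 * binom (s + 1) n
        = a := fun a => by
      rw [Nat.sub_zero, zero_add, show s + 2 - 1 = s + 1 by rfl]
      ring
    rw [this, Finset.sum_mul]
    refine (Finset.abs_sum_le_sum_abs _ _).trans (Finset.sum_le_sum fun i hi => ?_)
    have hi' := Finset.mem_range.1 hi
    rw [hb _ _ (by lia), abs_mul, abs_mul, abs_pow, abs_neg, abs_one, one_pow, one_mul,
      abs_of_pos (binom_pos _ _)]
    exact mul_le_mul_of_nonneg_left (binom_mono (by lia) n) (abs_nonneg _)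
  exact ⟨.of_eventually ⟨C, N, fun n hn => (abs_le.1 (key n hn)).2⟩,
    .of_eventually ⟨C, N, fun n hn => by linarith [(abs_le.1 (key n hn)).1]⟩⟩

end MainReduction

theorem statement14 (R : Type) [CommRing R] [IsLocalRing R] [IsNoetherianRing R]
    (M : Type) [AddCommGroup M] [Module R M] [Module.Finite R M]
    (r : ℕ) (hr : mDim R M = (r : ℕ∞)) (hr2 : 2 ≤ r)
    (hgcm : IsGenCM R M r)
    (hdepth : ∃ x ∈ maximalIdeal R, IsSMulRegular M x)
    (Q : Ideal R) (hQ : IsParamIdeal R Q M r)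
    (e : ℕ → ℤ) (he : HasHilbCoeffs R Q M r e)
    (h : ℕ → ℕ)
    (hh : ∀ i, 1 ≤ i → i ≤ r - 1 → mLength R ↥(LC R i M) = ((h i : ℕ) : ℕ∞)) :
    IsStandardParamIdeal R Q M r ↔
      e 1 = -(∑ i ∈ Finset.Icc 1 (r - 1),
        (((r - 2).choose (i - 1) : ℤ) * (h i : ℤ))) := by
  obtain ⟨s, rfl⟩ := Nat.exists_eq_add_of_le' hr2
  have key (x : Fin (s + 2) → R) (hx : Q = Ideal.span (Set.range x)) : IsStandardSeq R x M ↔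
      e 1 = -∑ i ∈ Finset.Icc 1 (s + 1), (s.choose (i - 1) : ℤ) * h i := by
    have he' : HasHilbCoeffs R (Ideal.ofList (List.ofFn x)) M (s + 2) e := by
      rwa [Ideal.ofList_ofFn, ← hx]
    rw [isStandardSeq_iff, (hQ.paramSetup_bot hx hgcm hdepth).powDSeq_iff (by simp) he'.dom.1
      he'.dom.2, lcSum_bot hh, neg_eq_iff_eq_neg]
  constructor
  · rintro ⟨-, x, hx, hs⟩
    exact (key x hx).1 hs
  · intro h1
    obtain ⟨x, hx⟩ := hQ.2.1
    exact ⟨hQ, x, hx, (key x hx).2 h1⟩
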